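/- Let q = 2^n and let f ∈ F_q[x] be a polynomial of odd degree d ≥ 3, where d is neither a Gold number nor a Kasami–Welch number. Then there exists a positive integer M such that for every m ≥ M, the function induced by f on F_{q^m} is not APN. -/

import Mathlib

/-- A function `f` on a finite field `L` is almost perfect nonlinear (APN) if for every
`a ≠ 0` and every `b`, the equation `f (x + a) + f x = b` has at most 2 solutions. -/
def IsAPN {L : Type*} [Field L] (f : L → L) : Prop :=
  ∀ a : L, a ≠ 0 → ∀ b : L, Set.ncard {x : L | f (x + a) + f x = b} ≤ 2

set_option linter.all false

open Polynomial

section PartA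
variable {k : Type*} [Field k]

/-- total degree at most `t` -/
def wtle (t : ℕ) (p : k[X][X]) : Prop := ∀ i j, t < i + j → (p.coeff j).coeff i = 0

lemma wtle.mono {s t : ℕ} (h : s ≤ t) {p : k[X][X]} (hp : wtle s p) : wtle t p :=
  fun i j hij => hp i j (lt_of_le_of_lt h hij)

lemma wtle_zero (t : ℕ) : wtle t (0 : k[X][X]) := fun i j _ => by simp

lemma wtle.add {t : ℕ} {p q : k[X][X]} (hp : wtle t p) (hq : wtle t q) : wtle t (p + q) :=
  fun i j h => by simp [hp i j h, hq i j h]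

lemma wtle.neg {t : ℕ} {p : k[X][X]} (hp : wtle t p) : wtle t (-p) :=
  fun i j h => by simp [hp i j h]

lemma wtle.sub {t : ℕ} {p q : k[X][X]} (hp : wtle t p) (hq : wtle t q) : wtle t (p - q) :=
  fun i j h => by simp [hp i j h, hq i j h]

lemma wtle_sum {ι : Type*} {t : ℕ} (s : Finset ι) (f : ι → k[X][X]) (h : ∀ i ∈ s, wtle t (f i)) :
    wtle t (∑ i ∈ s, f i) := by
  intro i j hij
  rw [finsetSum_coeff, finsetSum_coeff]
  exact Finset.sum_eq_zero fun a ha => h a ha i j hij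

lemma wtle.mul {s t : ℕ} {p q : k[X][X]} (hp : wtle s p) (hq : wtle t q) :
    wtle (s + t) (p * q) := by
  intro i j hij
  rw [coeff_mul, finsetSum_coeff]
  refine Finset.sum_eq_zero fun a ha => ?_
  rw [coeff_mul]
  refine Finset.sum_eq_zero fun b hb => ?_
  rw [Finset.HasAntidiagonal.mem_antidiagonal] at ha hb
  by_cases h : s < b.1 + a.1
  · rw [hp _ _ h, zero_mul]
  · rw [hq b.2 a.2 (by omega), mul_zero]

lemma wtle_one : wtle 0 (1 : k[X][X]) := by
  intro i j hij
  rw [coeff_one]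
  split_ifs with h
  · rw [coeff_one, if_neg (by omega)]
  · simp

lemma wtle.pow {s : ℕ} {p : k[X][X]} (hp : wtle s p) (n : ℕ) : wtle (n * s) (p ^ n) := by
  induction n with
  | zero => simpa using wtle_one
  | succ n ih => rw [pow_succ, Nat.succ_mul]; exact ih.mul hp

lemma wtle_C {p : k[X]} {t : ℕ} (h : p.natDegree ≤ t) : wtle t (C p) := by
  intro i j hij
  rw [coeff_C]
  split_ifs with h0
  · exact coeff_eq_zero_of_natDegree_lt (by omega)
  · simp

lemma wtle_X : wtle 1 (X : k[X][X]) := by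
  intro i j hij
  rw [coeff_X]
  split_ifs with h0
  · rw [coeff_one, if_neg (by omega)]
  · simp

lemma wtle_CX : wtle 1 (C X : k[X][X]) := wtle_C natDegree_X_le

lemma wtle_CC (a : k) : wtle 0 (C (C a) : k[X][X]) := wtle_C (by simp)

lemma exists_wtle (p : k[X][X]) : ∃ t, wtle t p := by
  induction p using Polynomial.induction_on' with
  | add p q hp hq =>
    obtain ⟨s, hs⟩ := hp
    obtain ⟨t, ht⟩ := hq
    exact ⟨max s t, (hs.mono (le_max_left _ _)).add (ht.mono (le_max_right _ _))⟩
  | monomial n a =>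
    rw [← C_mul_X_pow_eq_monomial]
    exact ⟨_, (wtle_C le_rfl).mul (wtle_X.pow n)⟩

lemma wtle.natDegree_coeff {t : ℕ} {p : k[X][X]} (hp : wtle t p) {j : ℕ} (h : p.coeff j ≠ 0) :
    (p.coeff j).natDegree + j ≤ t := by
  by_contra hc
  have := hp (p.coeff j).natDegree j (by omega)
  exact h (leadingCoeff_eq_zero.mp this)

lemma wtle.natDegree_le {t : ℕ} {p : k[X][X]} (hp : wtle t p) : p.natDegree ≤ t := by
  rcases eq_or_ne p 0 with h | h
  · simp [h]
  · have := hp.natDegree_coeff (j := p.natDegree) (by simpa using h)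
    omega

lemma wtle.derivative {t : ℕ} {p : k[X][X]} (hp : wtle t p) : wtle t (derivative p) := by
  intro i j hij
  rw [coeff_derivative]
  have : (p.coeff (j+1)).coeff i = 0 := hp _ _ (by omega)
  have h2 : ((j:k[X]) + 1) = C ((j:k)+1) := by simp
  rw [h2, coeff_mul_C, this, zero_mul]

lemma wtle.divX {t : ℕ} {p : k[X][X]} (hp : wtle t p) : wtle (t-1) (divX p) := by
  intro i j hij
  rw [coeff_divX]
  exact hp _ _ (by omega)

lemma wtle.modByMonic {D : ℕ} {P : k[X][X]} (hP : P.Monic) (hD : P.natDegree = D)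
    (hwP : wtle D P) {t : ℕ} (p : k[X][X]) (hp : wtle t p) : wtle t (p %ₘ P) := by
  induction hn : p.natDegree using Nat.strong_induction_on generalizing p with
  | _ n ih =>
  subst hn
  by_cases hlt : p.degree < P.degree
  · rwa [(modByMonic_eq_self_iff hP).mpr hlt]
  · have hp0 : p ≠ 0 := by
      rintro rfl
      apply hlt
      rw [degree_zero]
      exact bot_lt_iff_ne_bot.mpr (degree_ne_bot.mpr hP.ne_zero)
    have hle : D ≤ p.natDegree := by
      rw [not_lt] at hlt
      rw [← hD]; exact natDegree_le_natDegree hlt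
    set q : k[X][X] := C p.leadingCoeff * X ^ (p.natDegree - D) with hq
    have hwq : wtle (t - D) q := by
      have h1 := hp.natDegree_coeff (j := p.natDegree) (by simpa using hp0)
      refine ((wtle_C le_rfl).mul (wtle_X.pow _)).mono ?_
      change (p.coeff p.natDegree).natDegree + _ ≤ _
      omega
    have h1 : wtle t (p - q * P) := by
      refine hp.sub ((hwq.mul hwP).mono ?_)
      have := hp.natDegree_le
      omega
    have h2 : p %ₘ P = (p - q * P) %ₘ P := by
      rw [sub_modByMonic]
      have : (q * P) %ₘ P = 0 := (modByMonic_eq_zero_iff_dvd hP).mpr (dvd_mul_left _ _)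
      rw [this, sub_zero]
    rw [h2]
    by_cases h0 : p - q * P = 0
    · rw [h0, zero_modByMonic]; exact wtle_zero t
    · refine ih _ ?_ _ h1 rfl
      have hd : (p - q * P).degree < p.degree := by
        have := div_wf_lemma (p := p) (q := P) ⟨not_lt.mp hlt, hp0⟩ hP
        rw [hD] at this
        rwa [mul_comm q P]
      exact natDegree_lt_natDegree h0 hd

/-- the box polynomials -/
noncomputable def box (D t : ℕ) : (Fin D → Fin t → k) →ₗ[k] k[X][X] where
  toFun a := ∑ j : Fin D, ∑ i : Fin t, monomial (j:ℕ) (monomial (i:ℕ) (a j i))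
  map_add' a b := by simp [Finset.sum_add_distrib]
  map_smul' c a := by simp [Finset.smul_sum, smul_monomial]

noncomputable def coords (D t : ℕ) : k[X][X] →ₗ[k] (Fin D → Fin t → k) where
  toFun p := fun j i => (p.coeff j).coeff i
  map_add' p q := by ext; simp
  map_smul' c p := by ext; simp

lemma coords_box (D t : ℕ) (a : Fin D → Fin t → k) : coords D t (box D t a) = a := by
  ext j i
  simp only [coords, box, LinearMap.coe_mk, AddHom.coe_mk, finsetSum_coeff, coeff_monomial]
  rw [Finset.sum_eq_single j]
  · simp only [↓reduceIte, coeff_monomial]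
    rw [Finset.sum_eq_single i]
    · simp
    · intro b _ hb
      rw [if_neg]; exact fun h => hb (Fin.ext h)
    · simp
  · intro b _ hb
    refine Finset.sum_eq_zero fun c _ => ?_
    rw [if_neg (fun h => hb (Fin.ext h)), coeff_zero]
  · simp

lemma wtle_box (D t : ℕ) (a : Fin D → Fin t → k) : wtle (t + D) (box D t a) := by
  change wtle (t + D) (∑ j : Fin D, ∑ i : Fin t, monomial (j:ℕ) (monomial (i:ℕ) (a j i)))
  refine wtle_sum (k := k) _ _ fun j _ => wtle_sum _ _ fun i _ => ?_
  rw [← C_mul_X_pow_eq_monomial]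
  refine ((wtle_C (natDegree_monomial_le _)).mul (wtle_X.pow _)).mono ?_
  have := i.2
  have := j.2
  omega

lemma box_degree (D t : ℕ) (a : Fin D → Fin t → k) {m : ℕ} (hm : D ≤ m) :
    (box D t a).coeff m = 0 := by
  simp only [box, LinearMap.coe_mk, AddHom.coe_mk, finsetSum_coeff, coeff_monomial]
  refine Finset.sum_eq_zero fun j _ => Finset.sum_eq_zero fun i _ => ?_
  rw [if_neg (by have := j.2; omega)]

lemma box_not_dvd {D t : ℕ} {P : k[X][X]} (hP : P.Monic) (hD : P.natDegree = D)
    {a : Fin D → Fin t → k} (h : P ∣ box D t a) : a = 0 := by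
  have h0 : box D t a = 0 := by
    by_contra hne
    have h1 := hP.not_dvd_of_natDegree_lt hne
    apply h1 _ h
    have : (box D t a).natDegree < D := by
      by_contra hc
      have := box_degree D t a (not_lt.mp hc)
      exact hne (leadingCoeff_eq_zero.mp this)
    omega
  rw [← coords_box D t a, h0, map_zero]

lemma coords_eq_zero {D t : ℕ} {P : k[X][X]} (hP : P.Monic) (hD : P.natDegree = D)
    (hwP : wtle D P) {p : k[X][X]} {s : ℕ} (hp : wtle s p) (hs : s < t)
    (h : coords D t (p %ₘ P) = 0) : P ∣ p := by
  rw [← modByMonic_eq_zero_iff_dvd hP]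
  ext j i
  have hw := wtle.modByMonic hP hD hwP p hp
  rw [coeff_zero, coeff_zero]
  by_cases hj : j < D
  · by_cases hi : i < t
    · exact congrFun (congrFun h ⟨j, hj⟩) ⟨i, hi⟩
    · exact hw _ _ (by omega)
  · have : (p %ₘ P).degree < P.degree := degree_modByMonic_lt _ hP
    have h3 : (p %ₘ P).coeff j = 0 := coeff_eq_zero_of_degree_lt ?_
    · rw [h3, coeff_zero]
    refine this.trans_le ?_
    rw [degree_eq_natDegree hP.ne_zero, hD]
    exact_mod_cast not_lt.mp hj

/-- linear reduction map -/
noncomputable def redc (P : k[X][X]) (D t : ℕ) : k[X][X] →ₗ[k] (Fin D → Fin t → k) :=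
  (coords D t).comp ((Polynomial.modByMonicHom P).restrictScalars k)

lemma redc_apply (P : k[X][X]) (D t : ℕ) (p : k[X][X]) : redc P D t p = coords D t (p %ₘ P) := rfl

lemma lemmaN {D : ℕ} {P : k[X][X]} (hP : P.Monic) (hD : P.natDegree = D) (hwP : wtle D P)
    (hirr : Irreducible P) {B : k[X][X]} {β : ℕ} (hB : wtle β B) (hPB : ¬ P ∣ B) :
    ∃ (n : k[X]) (w : k[X][X]), n ≠ 0 ∧ n.natDegree ≤ D * (β + D + 1) ∧ P ∣ B * w - C n := by
  classical
  set N := D * (β + D + 1) with hN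
  set t' := N + β + D + 1 with ht'
  let toP : (Fin (N+1) → k) →ₗ[k] k[X][X] :=
    { toFun := fun a => ∑ i : Fin (N+1), C (monomial (i:ℕ) (a i))
      map_add' := fun a b => by simp [Finset.sum_add_distrib]
      map_smul' := fun c a => by
        simp only [Pi.smul_apply, RingHom.id_apply, Finset.smul_sum]
        refine Finset.sum_congr rfl fun i _ => ?_
        rw [smul_C, smul_monomial] }
  have htoP : ∀ a, toP a = C (∑ i : Fin (N+1), monomial (i:ℕ) (a i)) := fun a => by
    simp [toP]
  let Φ : ((Fin (N+1) → k) × (Fin D → Fin N → k)) →ₗ[k] (Fin D → Fin t' → k) :=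
    (redc P D t').comp (((LinearMap.mulLeft k B).comp ((box D N).comp (LinearMap.snd k _ _)))
      - toP.comp (LinearMap.fst k _ _))
  have hker : LinearMap.ker Φ ≠ ⊥ := by
    apply LinearMap.ker_ne_bot_of_finrank_lt
    simp only [Module.finrank_pi, Module.finrank_prod, Module.finrank_pi_fintype,
      Finset.sum_const, Finset.card_univ, Fintype.card_fin, smul_eq_mul]
    rw [ht', hN]
    ring_nf
    omega
  obtain ⟨⟨a, b⟩, hab, hne⟩ := (Submodule.ne_bot_iff _).mp hker
  have hΦ : Φ (a, b) = redc P D t' (B * box D N b - toP a) := rfl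
  rw [LinearMap.mem_ker, hΦ, redc_apply] at hab
  have hdeg : (∑ i : Fin (N+1), monomial (i:ℕ) (a i)).natDegree ≤ N := by
    refine natDegree_sum_le_of_forall_le _ _ fun i _ => (natDegree_monomial_le _).trans ?_
    have := i.2; omega
  have hdvd := coords_eq_zero hP hD hwP (s := N + β + D) (t := t') (by
    refine wtle.sub ((hB.mul (wtle_box _ _ _)).mono (by omega)) ?_
    rw [htoP]
    exact wtle_C (by omega)) (by omega) hab
  refine ⟨_, box D N b, ?_, hdeg, by rwa [← htoP]⟩
  intro h0
  rw [htoP, h0, C_0, sub_zero] at hdvd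
  rcases (hirr.prime.dvd_or_dvd hdvd) with h | h
  · exact hPB h
  · have hb := box_not_dvd hP hD h
    apply hne
    rw [hb, Prod.mk_eq_zero]
    refine ⟨?_, rfl⟩
    ext i
    have := congrArg (fun p => p.coeff (i:ℕ)) h0
    simp only [finsetSum_coeff, coeff_monomial, coeff_zero] at this
    rw [Finset.sum_eq_single i] at this
    · simpa using this
    · intro b _ hb
      rw [if_neg]; exact fun h => hb (Fin.ext h)
    · simp

lemma exists_lagrange (S : Finset (k × k)) (s : k × k) : ∃ p : k[X][X],
    evalEval s.1 s.2 p ≠ 0 ∧ ∀ s' ∈ S, s' ≠ s → evalEval s'.1 s'.2 p = 0 := by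
  classical
  have h1 : ∀ s' : k × k, s' ≠ s → ∃ p : k[X][X], evalEval s.1 s.2 p ≠ 0 ∧
      evalEval s'.1 s'.2 p = 0 := by
    intro s' hs'
    by_cases h : s'.1 = s.1
    · have h2 : s.2 ≠ s'.2 := fun h2 => hs' (Prod.ext h h2.symm)
      refine ⟨X - C (C s'.2), ?_, ?_⟩
      · simpa [evalEval, sub_eq_zero] using h2
      · simp [evalEval]
    · refine ⟨C (X - C s'.1), ?_, ?_⟩
      · simpa [evalEval, sub_eq_zero] using fun h' => h (h'.symm)
      · simp [evalEval]
  choose! p hp1 hp2 using h1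
  refine ⟨∏ s' ∈ S.erase s, p s', ?_, ?_⟩
  · rw [← coe_evalEvalRingHom, map_prod]
    exact Finset.prod_ne_zero_iff.mpr fun s' hs' => hp1 s' (Finset.mem_erase.mp hs').1
  · intro s' hs' hne
    rw [← coe_evalEvalRingHom, map_prod]
    exact Finset.prod_eq_zero (Finset.mem_erase.mpr ⟨hne, hs'⟩) (hp2 s' hne)

lemma lemmaZ {D : ℕ} {P : k[X][X]} (hP : P.Monic) (hD : P.natDegree = D) (hwP : wtle D P)
    (hirr : Irreducible P) {B : k[X][X]} {β : ℕ} (hB : wtle β B) (hPB : ¬ P ∣ B)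
    (S : Finset (k × k)) (hS : ∀ s ∈ S, evalEval s.1 s.2 P = 0 ∧ evalEval s.1 s.2 B = 0) :
    S.card ≤ D * (β + D + 1) := by
  classical
  choose L hL1 hL2 using exists_lagrange S
  choose T hT using fun s => exists_wtle (L s)
  set t := ∑ s ∈ S, T s with ht
  set t' := t + β + D + 1 with ht'
  let LL : (S → k) →ₗ[k] k[X][X] :=
    { toFun := fun c => ∑ s : S, c s • L s
      map_add' := fun a b => by simp [Finset.sum_add_distrib, add_smul]
      map_smul' := fun c a => by simp [Finset.smul_sum, mul_smul] }
  let Φ : ((S → k) × (Fin D → Fin t → k)) →ₗ[k] (Fin D → Fin t' → k) :=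
    (redc P D t').comp (((LinearMap.mulLeft k B).comp ((box D t).comp (LinearMap.snd k _ _)))
      + LL.comp (LinearMap.fst k _ _))
  have hinj : Function.Injective Φ := by
    rw [← LinearMap.ker_eq_bot, Submodule.eq_bot_iff]
    rintro ⟨c, b⟩ hcb
    have hΦ : Φ (c, b) = redc P D t' (B * box D t b + LL c) := rfl
    rw [LinearMap.mem_ker, hΦ, redc_apply] at hcb
    have hdvd := coords_eq_zero hP hD hwP (s := t + β + D) (t := t') (by
      refine wtle.add ((hB.mul (wtle_box _ _ _)).mono (by omega)) ?_
      refine wtle_sum _ _ fun s _ => ?_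
      have : wtle (T s) (c s • L s) := fun i j hij => by simp [hT s i j hij]
      refine this.mono ?_
      have := Finset.single_le_sum (f := T) (fun _ _ => Nat.zero_le _) s.2
      omega) (by omega) hcb
    have hc : c = 0 := by
      ext s
      obtain ⟨q, hq⟩ := hdvd
      have h1 := congrArg (evalEvalRingHom s.1.1 s.1.2) hq
      rw [map_add, map_mul, map_mul] at h1
      simp only [coe_evalEvalRingHom] at h1
      rw [(hS s s.2).1, (hS s s.2).2, zero_mul, zero_mul, zero_add] at h1
      change evalEval _ _ (∑ s' : S, c s' • L s') = 0 at h1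
      rw [← coe_evalEvalRingHom, map_sum, Finset.sum_eq_single s] at h1
      · have h2 : c s • L s = C (C (c s)) * L s := by
          ext; simp
        rw [h2, map_mul, coe_evalEvalRingHom] at h1
        rcases mul_eq_zero.mp h1 with h | h
        · simpa [evalEval] using h
        · exact absurd h (hL1 s)
      · intro s' _ hne
        have h2 : c s' • L s' = C (C (c s')) * L s' := by
          ext; simp
        rw [h2, map_mul, coe_evalEvalRingHom, hL2 s' s s.2 (fun h => hne (Subtype.ext h.symm)),
          mul_zero]
      · simp
    subst hc
    rw [map_zero, add_zero] at hdvd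
    rcases (hirr.prime.dvd_or_dvd hdvd) with h | h
    · exact absurd h hPB
    · rw [box_not_dvd hP hD h]; rfl
  have := LinearMap.finrank_le_finrank_of_injective hinj
  simp only [Module.finrank_pi, Module.finrank_prod, Module.finrank_pi_fintype,
      Finset.sum_const, Finset.card_univ, Fintype.card_fin, smul_eq_mul, Fintype.card_coe] at this
  rw [ht'] at this
  nlinarith
end PartA


section PartA2
variable {k : Type*} [Field k]

lemma exists_simple [IsAlgClosed k] {D : ℕ} {P : k[X][X]} (hP : P.Monic) (hD : P.natDegree = D)
    (hD0 : 0 < D) (hwP : wtle D P) (hirr : Irreducible P) (hder : ¬ P ∣ derivative P) :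
    ∃ x y : k, evalEval x y P = 0 ∧ evalEval x y (derivative P) ≠ 0 := by
  classical
  have hfin : {s : k × k | evalEval s.1 s.2 P = 0 ∧ evalEval s.1 s.2 (derivative P) = 0}.Finite := by
    by_contra hinf
    obtain ⟨S, hS, hcard⟩ := Set.Infinite.exists_subset_card_eq hinf (D * (D + D + 1) + 1)
    have := lemmaZ hP hD hwP hirr hwP.derivative hder S (fun s hs => hS hs)
    omega
  have : Infinite k := IsAlgClosed.instInfinite
  obtain ⟨x, hx⟩ := (hfin.image Prod.fst).exists_notMem
  have hm : (P.map (evalRingHom x)).Monic := hP.map _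
  obtain ⟨y, hy⟩ := IsAlgClosed.exists_root (P.map (evalRingHom x)) (by
    rw [hP.degree_map, degree_eq_natDegree hP.ne_zero, hD]
    exact_mod_cast hD0.ne')
  have hy' : evalEval x y P = 0 := by
    rw [← map_evalRingHom_eval]; exact hy
  refine ⟨x, y, hy', fun h => hx ⟨(x, y), ⟨hy', h⟩, rfl⟩⟩

open PowerSeries in
lemma exists_hensel {P : k[X][X]} (hP : P.Monic) {x y : k} (h1 : evalEval x y P = 0)
    (h2 : evalEval x y (derivative P) ≠ 0) :
    ∃ ψ : k[X][X] →+* PowerSeries k, ψ P = 0 ∧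
      (∀ a : k, ψ (Polynomial.C (Polynomial.C a)) = PowerSeries.C a) ∧
      (∀ n : k[X], n ≠ 0 → ∀ s : ℕ, n.natDegree < s →
        ¬ (PowerSeries.X : PowerSeries k) ^ s ∣ ψ (Polynomial.C n)) := by
  let φ : k[X] →+* PowerSeries k :=
    Polynomial.eval₂RingHom PowerSeries.C (PowerSeries.C x + PowerSeries.X)
  let I : Ideal (PowerSeries k) := Ideal.span {PowerSeries.X}
  have hH : HenselianRing (PowerSeries k) I := inferInstance
  have key : ∀ p : k[X][X], PowerSeries.constantCoeff ((p.map φ).eval (PowerSeries.C y))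
      = evalEval x y p := by
    intro p
    have : ((PowerSeries.constantCoeff (R := k)).comp
      ((Polynomial.evalRingHom (PowerSeries.C y)).comp (Polynomial.mapRingHom φ)))
      = evalEvalRingHom x y := by
      ext <;> simp [φ]
    exact congrArg (fun f : k[X][X] →+* k => f p) this
  obtain ⟨a, ha, -⟩ := hH.is_henselian (P.map φ) (hP.map φ) (PowerSeries.C y) (by
      rw [Ideal.mem_span_singleton, PowerSeries.X_dvd_iff, key, h1]) (by
      apply IsUnit.map
      rw [PowerSeries.isUnit_iff_constantCoeff, derivative_map, key]
      exact h2.isUnit)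
  refine ⟨(Polynomial.evalRingHom a).comp (Polynomial.mapRingHom φ), ha, ?_, ?_⟩
  · intro c; simp [φ]
  · intro n hn s hs hdvd
    have e1 : ((Polynomial.evalRingHom a).comp (Polynomial.mapRingHom φ)) (Polynomial.C n)
      = ((n.comp (Polynomial.C x + Polynomial.X) : k[X]) : PowerSeries k) := by
      simp only [RingHom.comp_apply, coe_mapRingHom, Polynomial.map_C, coe_evalRingHom, eval_C, φ,
        coe_eval₂RingHom]
      have : (Polynomial.eval₂RingHom PowerSeries.C (PowerSeries.C x + PowerSeries.X))
        = (Polynomial.coeToPowerSeries.ringHom (R := k)).comp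
          (Polynomial.compRingHom (Polynomial.C x + Polynomial.X)) := by
        ext <;> simp
      exact congrArg (fun f : k[X] →+* PowerSeries k => f n) this
    rw [e1, PowerSeries.X_pow_dvd_iff] at hdvd
    have h3 : n.comp (Polynomial.C x + Polynomial.X) = 0 := by
      ext m
      by_cases hm : m < s
      · have := hdvd m hm
        rwa [Polynomial.coeff_coe] at this
      · rw [Polynomial.coeff_zero]
        apply coeff_eq_zero_of_natDegree_lt
        have : (Polynomial.C x + Polynomial.X).natDegree = 1 := by
          rw [add_comm]; exact natDegree_X_add_C x
        rw [natDegree_comp, this]; omega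
    have h4 : (Polynomial.C x + Polynomial.X).natDegree ≠ 0 := by
          rw [add_comm, natDegree_X_add_C x]; exact one_ne_zero
    rw [comp_eq_zero_iff] at h3
    rcases h3 with h3 | h3
    · exact hn h3
    · rw [h3.2] at h4; simp at h4

/-- the Stepanov auxiliary polynomial `∑ c X^i Y^j X^(s k) Y^(s l)` -/
noncomputable def stepB {D : ℕ} (I K s : ℕ) (g : Fin D → Fin I → Fin D → Fin K → k) : k[X][X] :=
  ∑ j : Fin D, ∑ i : Fin I, (monomial (j:ℕ) (monomial (i:ℕ) 1)) * (box D K (g j i)) ^ s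

lemma stepB_not_dvd [IsAlgClosed k] [CharP k 2] {D : ℕ} {P : k[X][X]} (hP : P.Monic) (hD : P.natDegree = D)
    (hD0 : 0 < D) (hwP : wtle D P) (hirr : Irreducible P) (hder : ¬ P ∣ derivative P)
    {I K s e : ℕ} (hs : s = 2 ^ e) (hI : D * (I + 2 * D + 1) < s)
    (g : Fin D → Fin I → Fin D → Fin K → k) (hg : g ≠ 0) : ¬ P ∣ stepB I K s g := by
  classical
  obtain ⟨x, y, h1, h2⟩ := exists_simple hP hD hD0 hwP hirr hder
  obtain ⟨ψ, hψP, hψC, hψn⟩ := exists_hensel hP h1 h2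
  have hψ : ∀ p, P ∣ p → ψ p = 0 := by
    rintro _ ⟨q, rfl⟩; rw [map_mul, hψP, zero_mul]
  have hbox : ∀ (t : ℕ) (a : Fin D → Fin t → k) (S : ℕ), a ≠ 0 → D * (t + 2 * D + 1) < S →
      ¬ (PowerSeries.X : PowerSeries k) ^ S ∣ ψ (box D t a) := by
    intro t a S ha hS hdvd
    obtain ⟨n, w, hn, hdeg, hPn⟩ := lemmaN hP hD hwP hirr (wtle_box D t a)
      (fun h => ha (box_not_dvd hP hD h))
    have h3 := hψ _ hPn
    rw [map_sub, map_mul, sub_eq_zero] at h3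
    apply hψn n hn S (lt_of_le_of_lt hdeg ?_) (h3 ▸ hdvd.mul_right _)
    have : t + D + D + 1 = t + 2 * D + 1 := by ring
    rw [this]; exact hS
  intro hdvd
  have h0 := hψ _ hdvd
  set w : Fin D → Fin I → PowerSeries k := fun j i => ψ (box D K (g j i)) with hw
  have hex : ∃ n : ℕ, ∃ j i, ¬ (PowerSeries.X : PowerSeries k) ^ n ∣ w j i := by
    obtain ⟨j, hj⟩ := Function.ne_iff.mp hg
    obtain ⟨i, hi⟩ := Function.ne_iff.mp hj
    exact ⟨_, j, i, hbox K (g j i) _ hi (Nat.lt_succ_self _)⟩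
  obtain ⟨j0, i0, hn0⟩ := Nat.find_spec hex
  have hnpos : Nat.find hex ≠ 0 := by
    intro h; rw [h] at hn0; exact hn0 (by simp)
  obtain ⟨n, hn⟩ := Nat.exists_eq_succ_of_ne_zero hnpos
  have hall : ∀ j i, (PowerSeries.X : PowerSeries k) ^ n ∣ w j i := by
    by_contra hc
    push Not at hc
    obtain ⟨j, i, hc⟩ := hc
    exact Nat.find_min hex (m := n) (by omega) ⟨j, i, hc⟩
  rw [hn] at hn0
  choose w' hw' using hall
  have hc0 : PowerSeries.constantCoeff (w' j0 i0) ≠ 0 := by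
    intro h
    apply hn0
    rw [hw', pow_succ]
    exact mul_dvd_mul_left _ (PowerSeries.X_dvd_iff.mpr h)
  have hw'' : ∀ j i, ∃ r, w' j i = PowerSeries.C (PowerSeries.constantCoeff (w' j i))
      + PowerSeries.X * r := by
    intro j i
    have : (PowerSeries.X : PowerSeries k) ∣ w' j i - PowerSeries.C (PowerSeries.constantCoeff (w' j i)) := by
      rw [PowerSeries.X_dvd_iff]; simp
    obtain ⟨r, hr⟩ := this
    exact ⟨r, by rw [← hr]; ring⟩
  choose r hr using hw''
  have hcp : CharP (PowerSeries k) 2 := by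
    exact charP_of_injective_ringHom (PowerSeries.C_injective) 2
  set c : Fin D → Fin I → k := fun j i => (PowerSeries.constantCoeff (w' j i)) ^ s with hc
  have hcne : c ≠ 0 := by
    intro h
    have := congrFun (congrFun h j0) i0
    exact hc0 (eq_zero_of_pow_eq_zero this)
  apply hbox I c s hcne hI
  have e1 : ψ (stepB I K s g) = (PowerSeries.X ^ n) ^ s *
      (ψ (box D I c) + PowerSeries.X ^ s * ∑ j : Fin D, ∑ i : Fin I,
        ψ (monomial (j:ℕ) (monomial (i:ℕ) 1)) * (r j i) ^ s) := by
    have e2 : box D I c = ∑ j : Fin D, ∑ i : Fin I, monomial (j:ℕ) (monomial (i:ℕ) 1) *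
        Polynomial.C (Polynomial.C (c j i)) := by
      change ∑ j : Fin D, ∑ i : Fin I, monomial (j:ℕ) (monomial (i:ℕ) (c j i)) = _
      simp [monomial_mul_C]
    rw [e2, stepB]
    simp only [map_sum, map_mul, map_pow, Finset.mul_sum, ← Finset.sum_add_distrib]
    refine Finset.sum_congr rfl fun j _ => Finset.sum_congr rfl fun i _ => ?_
    have e3 : ψ (box D K (g j i)) = PowerSeries.X ^ n * (PowerSeries.C (PowerSeries.constantCoeff (w' j i))
      + PowerSeries.X * r j i) := by rw [← hr, ← hw']
    rw [e3, mul_pow, hs, add_pow_char_pow, ← hs, hψC, hc, map_pow]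
    ring
  rw [h0] at e1
  have e4 := (mul_eq_zero.mp e1.symm).resolve_left (by simp)
  rw [eq_neg_of_add_eq_zero_left e4]
  exact (dvd_mul_right _ _).neg_right
end PartA2


section PartA3
variable {k : Type*} [Field k]

def frobfix (Q : ℕ) (P : k[X][X]) : Prop := ∀ i j, ((P.coeff j).coeff i) ^ Q = (P.coeff j).coeff i

lemma frobfix_eval [CharP k 2] {Q e : ℕ} (hQ : Q = 2 ^ e) {P : k[X][X]} (hf : frobfix Q P)
    (x y : k) : evalEval (x ^ Q) (y ^ Q) P = (evalEval x y P) ^ Q := by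
  have h := map_mapRingHom_evalEval (iterateFrobenius k 2 e) P x y
  have h2 : P.map (mapRingHom (iterateFrobenius k 2 e)) = P := by
    ext j i
    rw [coeff_map, coe_mapRingHom, coeff_map, iterateFrobenius_def, ← hQ]
    exact hf i j
  rw [h2] at h
  simpa [iterateFrobenius_def, ← hQ] using h

/-- divided difference coefficient -/
noncomputable def dd (P : k[X][X]) (b : ℕ) : k[X][X] := divX^[b+1] P

lemma wtle_iter_divX {t : ℕ} {p : k[X][X]} (hp : wtle t p) (n : ℕ) : wtle t (divX^[n] p) := by
  induction n with
  | zero => exact hp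
  | succ n ih =>
    rw [Function.iterate_succ_apply']
    exact ih.divX.mono (by omega)

lemma coeff_iter_divX (p : k[X][X]) (n j : ℕ) : (divX^[n] p).coeff j = p.coeff (j + n) := by
  induction n generalizing j with
  | zero => rfl
  | succ n ih =>
    rw [Function.iterate_succ_apply', coeff_divX, ih]; congr 1; ring

lemma dd_eval {D : ℕ} {P : k[X][X]} (hD : P.natDegree = D) (x y z : k) :
    (∑ b ∈ Finset.range D, evalEval x y (dd P b) * z ^ b) * (z - y)
      = evalEval x z P - evalEval x y P := by
  have h1 : ∀ (p : k[X][X]) (n : ℕ), p.natDegree < n → ∀ y, evalEval x y p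
      = ∑ m ∈ Finset.range n, (p.coeff m).eval x * y ^ m := by
    intro p n hn y
    rw [← map_evalRingHom_eval, eval_eq_sum_range' (n := n)]
    · simp
    · exact lt_of_le_of_lt natDegree_map_le hn
  have hdeg : ∀ b, (dd P b).natDegree ≤ D - (b+1) := by
    intro b
    rw [natDegree_le_iff_coeff_eq_zero]
    intro N hN
    rw [dd, coeff_iter_divX]
    exact coeff_eq_zero_of_natDegree_lt (by omega)
  rw [h1 P (D+1) (by omega), h1 P (D+1) (by omega), ← Finset.sum_sub_distrib]
  have h2 : ∀ m, (P.coeff m).eval x * z ^ m - (P.coeff m).eval x * y ^ m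
     = ((P.coeff m).eval x * ∑ b ∈ Finset.range m, z ^ b * y ^ (m - 1 - b)) * (z - y) := by
    intro m
    rw [mul_assoc, (Commute.all z y).geom_sum₂_mul]; ring
  simp only [h2]
  rw [← Finset.sum_mul]
  congr 1
  have h3 : ∀ b ∈ Finset.range D, evalEval x y (dd P b) * z ^ b =
     ∑ m ∈ Finset.range (D+1), if b < m then (P.coeff m).eval x * (z ^ b * y ^ (m - 1 - b)) else 0 := by
    intro b hb
    rw [Finset.mem_range] at hb
    rw [h1 (dd P b) (D - b) (by have := hdeg b; omega), ← Finset.sum_filter, Finset.sum_mul]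
    refine Finset.sum_bij' (fun j _ => j + (b + 1)) (fun m _ => m - (b+1)) ?_ ?_ ?_ ?_ ?_
    · intro a ha
      simp only [Finset.mem_range, Finset.mem_filter] at ha ⊢
      omega
    · intro a ha
      simp only [Finset.mem_range, Finset.mem_filter] at ha ⊢
      omega
    · intro a ha
      simp only [Finset.mem_range] at ha ⊢
      omega
    · intro a ha
      simp only [Finset.mem_range, Finset.mem_filter] at ha ⊢
      omega
    · intro a ha
      simp only [Finset.mem_range] at ha
      rw [dd, coeff_iter_divX]
      have : a + (b + 1) - 1 - b = a := by omega
      rw [this]; ring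
  rw [Finset.sum_congr rfl h3, Finset.sum_comm]
  refine Finset.sum_congr rfl fun m hm => ?_
  rw [Finset.mem_range] at hm
  rw [← Finset.sum_filter, Finset.mul_sum]
  refine Finset.sum_congr ?_ fun _ _ => rfl
  ext b
  simp only [Finset.mem_range, Finset.mem_filter]
  omega

lemma dd_top {D : ℕ} {P : k[X][X]} (hP : P.Monic) (hD : P.natDegree = D) (hD0 : 0 < D) :
    dd P (D - 1) = 1 := by
  ext j : 1
  rw [dd, coeff_iter_divX, coeff_one]
  split_ifs with h
  · rw [h, show 0 + (D - 1 + 1) = P.natDegree by omega]; exact hP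
  · exact coeff_eq_zero_of_natDegree_lt (by omega)

/-- rewriting coefficients of the second power -/
noncomputable def rwc (P : k[X][X]) (D : ℕ) (l l' : ℕ) : k[X][X] :=
  if l = D - 1 then - dd P l' else if l = l' then 1 else 0

lemma rwc_eval {D : ℕ} {P : k[X][X]} (hP : P.Monic) (hD : P.natDegree = D) (hD0 : 0 < D)
    {x y z : k} (h1 : evalEval x y P = 0) (h2 : evalEval x z P = 0) (hne : z ≠ y) (l : ℕ)
    (hl : l < D) :
    ∑ l' : Fin (D-1), evalEval x y (rwc P D l l') * z ^ (l':ℕ) = z ^ l := by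
  rw [Finset.sum_range (n := D-1) (f := fun l' => evalEval x y (rwc P D l l') * z ^ l') |>.symm]
  unfold rwc
  by_cases h : l = D - 1
  · simp only [h, if_true]
    have h3 := dd_eval hD x y z
    rw [h1, h2, sub_zero] at h3
    have h4 := (mul_eq_zero.mp h3).resolve_right (sub_ne_zero.mpr hne)
    have h5 : Finset.range D = Finset.range (D - 1 + 1) := by congr 1; omega
    rw [h5, Finset.sum_range_succ, dd_top hP hD hD0, evalEval_one, one_mul] at h4
    simp only [evalEval_neg, neg_mul, Finset.sum_neg_distrib]
    exact (eq_neg_of_add_eq_zero_right h4).symm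
  · simp only [h, if_false]
    rw [Finset.sum_eq_single l]
    · simp
    · intro b _ hb
      rw [if_neg (fun h => hb h.symm)]; simp
    · intro hb
      rw [Finset.mem_range] at hb
      omega

lemma wtle_rwc {D : ℕ} {P : k[X][X]} (hwP : wtle D P) (l l' : ℕ) : wtle D (rwc P D l l') := by
  unfold rwc
  split_ifs
  · exact (wtle_iter_divX hwP _).neg
  · exact wtle_one.mono (by omega)
  · exact wtle_zero _

lemma step_vanish [IsAlgClosed k] [CharP k 2] {D : ℕ} {P : k[X][X]} (hP : P.Monic)
    (hD : P.natDegree = D) (hD0 : 0 < D) (hwP : wtle D P)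
    {I K s M Q e₁ e₂ : ℕ} (hs : s = 2 ^ e₁) (hM : M = 2 ^ e₂) (hQ : Q = s * M)
    (hf : frobfix Q P)
    (hdim : (D - 1) * (D * (M * (I + D) + K + D + 1)) < D * (I * (D * K))) :
    ∃ g : Fin D → Fin I → Fin D → Fin K → k, g ≠ 0 ∧ ∀ x y : k, x ^ Q = x →
      evalEval x y P = 0 → y ^ Q ≠ y → evalEval x y (stepB I K s g) = 0 := by
  classical
  set T := M * (I + D) + K + D + 1 with hT
  let mono : Fin D → Fin I → Fin K → k[X][X] := fun j i κ =>
    monomial (M * j) (monomial (M * i + κ) 1)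
  let lin : Fin (D - 1) → (Fin D → Fin I → Fin D → Fin K → k) →ₗ[k] k[X][X] := fun l' =>
    { toFun := fun α => ∑ j, ∑ i, ∑ l, ∑ κ, α j i l κ • (mono j i κ * rwc P D l l')
      map_add' := fun a b => by simp [Finset.sum_add_distrib, add_smul]
      map_smul' := fun c a => by simp [Finset.smul_sum, mul_smul] }
  have hlin : ∀ l' α, wtle (M * (I + D) + K + D) (lin l' α) := by
    intro l' α
    change wtle (M * (I + D) + K + D) (∑ j, ∑ i, ∑ l, ∑ κ, α j i l κ • (mono j i κ * rwc P D l l'))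
    refine wtle_sum (k := k) _ _ fun j _ => wtle_sum _ _ fun i _ => wtle_sum _ _ fun l _ =>
      wtle_sum _ _ fun κ _ => ?_
    have : wtle (M * (I + D) + K + D) (mono j i κ * rwc P D l l') := by
      refine wtle.mul ?_ (wtle_rwc hwP _ _)
      simp only [mono]
      rw [← C_mul_X_pow_eq_monomial]
      refine ((wtle_C (natDegree_monomial_le _)).mul (wtle_X.pow _)).mono ?_
      have h1 := Nat.mul_le_mul_left M i.2.le
      have h2 := Nat.mul_le_mul_left M j.2.le
      have := κ.2
      rw [mul_add, mul_one]; omega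
    exact fun a b hab => by simp [this a b hab]
  let Φ : (Fin D → Fin I → Fin D → Fin K → k) →ₗ[k] (Fin (D-1) → Fin D → Fin T → k) :=
    LinearMap.pi fun l' => (redc P D T).comp (lin l')
  have hker : LinearMap.ker Φ ≠ ⊥ := by
    apply LinearMap.ker_ne_bot_of_finrank_lt
    simpa only [Module.finrank_pi, Module.finrank_prod, Module.finrank_pi_fintype,
      Finset.sum_const, Finset.card_univ, Fintype.card_fin, smul_eq_mul] using hdim
  obtain ⟨α, hα, hne⟩ := (Submodule.ne_bot_iff _).mp hker
  have hQ2 : Q = 2 ^ (e₁ + e₂) := by rw [hQ, hs, hM, pow_add]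
  have hQ0 : 0 < Q := by rw [hQ2]; positivity
  choose g hg using fun j i l κ => IsAlgClosed.exists_pow_nat_eq (α j i l κ) hQ0
  refine ⟨g, ?_, ?_⟩
  · rintro rfl
    apply hne
    ext j i l κ
    rw [← hg]; simp [hQ0.ne']
  intro x y hx hy hyne
  have hy' : evalEval x (y ^ Q) P = 0 := by
    have := frobfix_eval hQ2 hf x y
    rwa [hx, hy, zero_pow hQ0.ne'] at this
  have hl0 : ∀ l', evalEval x y (lin l' α) = 0 := by
    intro l'
    have h1 : redc P D T (lin l' α) = 0 := congrFun (LinearMap.mem_ker.mp hα) l'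
    obtain ⟨q, hq⟩ := coords_eq_zero hP hD hwP (hlin l' α) (Nat.lt_succ_self _) h1
    rw [hq, evalEval_mul, hy, zero_mul]
  have hM0 : M ≠ 0 := by rw [hM]; positivity
  refine eq_zero_of_pow_eq_zero (n := M) ?_
  calc (evalEval x y (stepB I K s g)) ^ M
      = ∑ j : Fin D, ∑ i : Fin I, ∑ l : Fin D, ∑ κ : Fin K,
          α j i l κ * (x ^ (M * i + κ) * y ^ (M * j)) * (y ^ Q) ^ (l:ℕ) := by
        have hb : ∀ a : Fin D → Fin K → k, (evalEval x y (box D K a)) ^ Q =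
            ∑ l : Fin D, ∑ κ : Fin K, (a l κ) ^ Q * x ^ (κ:ℕ) * (y ^ Q) ^ (l:ℕ) := by
          intro a
          change (evalEval x y (∑ j : Fin D, ∑ i : Fin K, monomial (j:ℕ) (monomial (i:ℕ) (a j i)))) ^ Q = _
          simp only [evalEval_finsetSum]
          rw [hQ2]
          simp only [sum_pow_char_pow]
          rw [← hQ2]
          refine Finset.sum_congr rfl fun j _ => Finset.sum_congr rfl fun i _ => ?_
          simp only [evalEval, eval_monomial, eval_mul, eval_pow, eval_C, mul_pow]
          rw [← pow_mul x, mul_comm (i:ℕ), pow_mul x, hx, pow_right_comm]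
        unfold stepB
        simp only [evalEval_finsetSum]
        rw [hM]
        simp only [sum_pow_char_pow]
        rw [← hM]
        refine Finset.sum_congr rfl fun j _ => Finset.sum_congr rfl fun i _ => ?_
        rw [evalEval_mul, evalEval_pow, mul_pow, ← pow_mul, ← hQ, hb, Finset.mul_sum]
        refine Finset.sum_congr rfl fun l _ => ?_
        rw [Finset.mul_sum]
        refine Finset.sum_congr rfl fun κ _ => ?_
        rw [hg]
        simp only [evalEval, eval_monomial, eval_mul, eval_pow, eval_C, mul_pow, one_pow]
        ring
    _ = ∑ l' : Fin (D-1), evalEval x y (lin l' α) * (y ^ Q) ^ (l':ℕ) := by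
        have e1 : ∀ l', evalEval x y (lin l' α) = ∑ j, ∑ i, ∑ l, ∑ κ,
          α j i l κ * (x ^ (M * (i:ℕ) + κ) * y ^ (M * (j:ℕ))) * evalEval x y (rwc P D l l') := by
          intro l'
          change evalEval x y (∑ j, ∑ i, ∑ l, ∑ κ, α j i l κ • (mono j i κ * rwc P D l l')) = _
          simp only [evalEval_finsetSum, mono]
          refine Finset.sum_congr rfl fun j _ => Finset.sum_congr rfl fun i _ =>
            Finset.sum_congr rfl fun l _ => Finset.sum_congr rfl fun κ _ => ?_
          rw [evalEval_smul, evalEval_mul, smul_eq_mul, ← mul_assoc]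
          simp [evalEval, eval_monomial]
        simp only [e1, Finset.sum_mul]
        symm
        rw [Finset.sum_comm]
        refine Finset.sum_congr rfl fun j _ => ?_
        rw [Finset.sum_comm]
        refine Finset.sum_congr rfl fun i _ => ?_
        rw [Finset.sum_comm]
        refine Finset.sum_congr rfl fun l _ => ?_
        rw [Finset.sum_comm]
        refine Finset.sum_congr rfl fun κ _ => ?_
        rw [← rwc_eval hP hD hD0 hy hy' hyne l l.2, Finset.mul_sum]
        refine Finset.sum_congr rfl fun l' _ => ?_
        ring
    _ = 0 := by simp [hl0]
end PartA3


lemma arith_dim {E M s I K C : ℕ} (hC : C = 3 * (E+1)^2) (hs : M ≤ s) (hI : s ≤ 2 * (E+1) * I)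
    (hI4 : 4 ≤ I) (hK1 : (E+1) * K ≤ E * M + (E+1) * C) (hK2 : E * M + (E+1) * C ≤ (E+1) * K + E) :
    E * ((E+1) * (M * (I + (E+1)) + K + (E+1) + 1)) < (E+1) * (I * ((E+1) * K)) := by
  have e1 : (E+1) * (I * ((E+1) * K)) = (E+1) * (I * ((E+1) * K)) := rfl
  rw [mul_left_comm E (E+1)]
  apply Nat.mul_lt_mul_of_pos_left _ (Nat.succ_pos E)
  have h1 : I * (E * M + (E+1) * C) ≤ I * ((E+1) * K) + I * E := by
    rw [← mul_add]; exact Nat.mul_le_mul_left _ hK2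
  have hKM : K ≤ M + C := by
    have : (E+1) * K ≤ (E+1) * (M + C) := by nlinarith
    exact Nat.le_of_mul_le_mul_left this (Nat.succ_pos E)
  have hMI : M ≤ 2 * (E+1) * I := hs.trans hI
  have h2 : E * (M * (E+2)) ≤ E * ((2 * (E+1) * I) * (E+2)) := by gcongr
  have h3 : E * K ≤ E * (M + C) := by gcongr
  have h4 : E * (M * I) = I * (E * M) := by ring
  suffices h : E * ((2 * (E+1) * I) * (E+2)) + E * (C + E + 2) + I * E < I * ((E+1) * C) by
    nlinarith
  subst hC
  have h5 : 4 * (E * (3 * (E+1)^2 + E + 2)) ≤ I * (E * (3 * (E+1)^2 + E + 2)) := by gcongr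
  have h6 : 4 * (E * (2 * (E+1) * (E+2))) + (E * (3 * (E+1)^2 + E + 2)) + 4 * E < 4 * ((E+1) * (3 * (E+1)^2)) := by
    ring_nf
    nlinarith [sq_nonneg E]
  have h7 : 4 * ( I * (E * (2 * (E+1) * (E+2))) + (E * (3 * (E+1)^2 + E + 2)) + I * E) <
     4 * (I * ((E+1) * (3 * (E+1)^2))) := by
    have := Nat.mul_lt_mul_of_pos_left h6 (show 0 < I by omega)
    nlinarith
  nlinarith

section PartA4
variable {k : Type*} [Field k]

lemma card_FQ [IsAlgClosed k] [CharP k 2] {Q e : ℕ} (hQ : Q = 2 ^ e) (he : 0 < e) :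
    ∃ S : Finset k, S.card = Q ∧ ∀ x ∈ S, x ^ Q = x := by
  classical
  have h2 : 2 ∣ Q := by rw [hQ]; exact dvd_pow_self 2 he.ne'
  have hQ1 : 1 < Q := by rw [hQ]; exact Nat.one_lt_two_pow he.ne'
  have hsep := galois_poly_separable (K := k) 2 Q h2
  refine ⟨(X ^ Q - X : k[X]).roots.toFinset, ?_, ?_⟩
  · rw [Multiset.toFinset_card_of_nodup (nodup_roots hsep)]
    rw [← (IsAlgClosed.splits (X ^ Q - X : k[X])).natDegree_eq_card_roots]
    exact FiniteField.X_pow_card_sub_X_natDegree_eq k hQ1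
  · intro x hx
    rw [Multiset.mem_toFinset, mem_roots'] at hx
    simpa [sub_eq_zero] using hx.2

lemma stepanov_count [IsAlgClosed k] [CharP k 2] {D : ℕ} {P : k[X][X]} (hP : P.Monic)
    (hD : P.natDegree = D) (hD0 : 0 < D) (hwP : wtle D P)
    (hirr : Irreducible P) (hder : ¬ P ∣ derivative P)
    {I K s M Q e₁ e₂ : ℕ} (hs : s = 2 ^ e₁) (hM : M = 2 ^ e₂) (hQ : Q = s * M) (he : 0 < e₁ + e₂)
    (hf : frobfix Q P) (hI : D * (I + 2 * D + 1) < s)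
    (hdim : (D - 1) * (D * (M * (I + D) + K + D + 1)) < D * (I * (D * K))) :
    ∃ S : Finset (k × k), (∀ z ∈ S, z.1 ^ Q = z.1 ∧ z.2 ^ Q = z.2 ∧ evalEval z.1 z.2 P = 0) ∧
      D * Q ≤ S.card + D * (D * (2 * D + 1)) + D * (I + D + s * (K + D) + D + 1) := by
  classical
  have hQ2 : Q = 2 ^ (e₁ + e₂) := by rw [hQ, hs, hM, pow_add]
  obtain ⟨g, hg, hgv⟩ := step_vanish hP hD hD0 hwP hs hM hQ hf hdim
  have hnd := stepB_not_dvd hP hD hD0 hwP hirr hder hs hI g hg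
  have hwB : wtle (I + D + s * (K + D)) (stepB I K s g) := by
    refine wtle_sum (k := k) _ _ fun j _ => wtle_sum _ _ fun i _ => ?_
    refine wtle.mul ?_ ((wtle_box _ _ _).pow s)
    rw [← C_mul_X_pow_eq_monomial]
    refine ((wtle_C (natDegree_monomial_le _)).mul (wtle_X.pow _)).mono ?_
    have := i.2
    have := j.2
    omega
  have hfin : {z : k × k | evalEval z.1 z.2 P = 0 ∧ evalEval z.1 z.2 (derivative P) = 0}.Finite := by
    by_contra hinf
    obtain ⟨S, hS, hcard⟩ := Set.Infinite.exists_subset_card_eq hinf (D * (D + D + 1) + 1)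
    have := lemmaZ hP hD hwP hirr hwP.derivative hder S (fun s hs => hS hs)
    omega
  have hbad := lemmaZ hP hD hwP hirr hwP.derivative hder hfin.toFinset (fun s hs => by simpa using hs)
  set Bad := hfin.toFinset.image Prod.fst with hBad
  have hbadc : Bad.card ≤ D * (2 * D + 1) := by
    refine Finset.card_image_le.trans (hbad.trans (le_of_eq (by ring)))
  obtain ⟨FQ, hFQ, hFQ2⟩ := card_FQ (k := k) hQ2 he
  let fib : k → Finset k := fun x => (P.map (evalRingHom x)).roots.toFinset
  have hfib : ∀ x ∉ Bad, (fib x).card = D := by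
    intro x hx
    have hnd : (P.map (evalRingHom x)).roots.Nodup := by
      rw [Multiset.nodup_iff_count_le_one]
      intro y
      rw [count_roots]
      by_contra hc
      have hne : P.map (evalRingHom x) ≠ 0 := (hP.map _).ne_zero
      rw [not_le, one_lt_rootMultiplicity_iff_isRoot hne] at hc
      apply hx
      rw [hBad, Finset.mem_image]
      refine ⟨(x, y), ?_, rfl⟩
      rw [Set.Finite.mem_toFinset]
      refine ⟨?_, ?_⟩
      · rw [← map_evalRingHom_eval]; exact hc.1
      · rw [← map_evalRingHom_eval, ← derivative_map]; exact hc.2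
    simp only [fib]
    rw [Multiset.toFinset_card_of_nodup hnd, ← (IsAlgClosed.splits _).natDegree_eq_card_roots,
      hP.natDegree_map, hD]
  let Z : Finset (k × k) := (FQ \ Bad).biUnion fun x => (fib x).image fun y => (x, y)
  have hZ : ∀ z ∈ Z, z.1 ^ Q = z.1 ∧ evalEval z.1 z.2 P = 0 := by
    intro z hz
    simp only [Z, Finset.mem_biUnion, Finset.mem_image, Finset.mem_sdiff] at hz
    obtain ⟨x, ⟨hx, -⟩, y, hy, rfl⟩ := hz
    refine ⟨hFQ2 x hx, ?_⟩
    simp only [fib, Multiset.mem_toFinset, mem_roots'] at hy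
    rw [← map_evalRingHom_eval]; exact hy.2
  have hZc : Z.card = (FQ \ Bad).card * D := by
    simp only [Z]
    rw [Finset.card_biUnion]
    · rw [Finset.sum_const_nat]
      intro x hx
      rw [Finset.card_image_of_injective _ (Prod.mk_right_injective x)]
      exact hfib x (Finset.mem_sdiff.mp hx).2
    · intro x _ x' _ hne
      rw [Function.onFun, Finset.disjoint_left]
      intro z hz hz'
      rw [Finset.mem_image] at hz hz'
      obtain ⟨y, _, rfl⟩ := hz
      obtain ⟨y', _, h⟩ := hz'
      exact hne (Prod.ext_iff.mp h).1.symm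
  have hsplit := Finset.card_filter_add_card_filter_not (s := Z) (fun z => z.2 ^ Q = z.2)
  have hT := lemmaZ hP hD hwP hirr hwB hnd (Z.filter fun z => ¬ z.2 ^ Q = z.2) (fun z hz => by
    rw [Finset.mem_filter] at hz
    exact ⟨(hZ z hz.1).2, hgv _ _ (hZ z hz.1).1 (hZ z hz.1).2 hz.2⟩)
  refine ⟨Z.filter fun z => z.2 ^ Q = z.2, ?_, ?_⟩
  · intro z hz
    rw [Finset.mem_filter] at hz
    exact ⟨(hZ z hz.1).1, hz.2, (hZ z hz.1).2⟩
  · have h1 : Q ≤ (FQ \ Bad).card + D * (2 * D + 1) := by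
      have := Finset.le_card_sdiff Bad FQ
      omega
    have h2 : D * Q ≤ D * ((FQ \ Bad).card + D * (2 * D + 1)) := Nat.mul_le_mul_left _ h1
    rw [mul_comm, ← hsplit] at hZc
    rw [mul_add, ← hZc] at h2
    omega
end PartA4

theorem stepanov (D K0 : ℕ) (hD0 : 0 < D) : ∃ N0 : ℕ, ∀ N ≥ N0, ∀ (k : Type) [Field k] [IsAlgClosed k]
    [CharP k 2] (P : k[X][X]), P.Monic → P.natDegree = D → wtle D P → Irreducible P →
    ¬ P ∣ derivative P → frobfix (2 ^ N) P →
    ∃ S : Finset (k × k), K0 ≤ S.card ∧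
      ∀ z ∈ S, z.1 ^ (2 ^ N) = z.1 ∧ z.2 ^ (2 ^ N) = z.2 ∧ evalEval z.1 z.2 P = 0 := by
  obtain ⟨E, rfl⟩ : ∃ E, D = E + 1 := ⟨D - 1, by omega⟩
  set D := E + 1 with hDE
  set C := 3 * D ^ 2 with hC
  set big := K0 + D * (D * (2 * D + 1)) + D * C + D * D + 2 + 2 * D * (2 * D + 9) with hbig
  refine ⟨2 * big, fun N hN k _ _ _ P hP hD hwP hirr hder hf => ?_⟩
  set e₁ := N - N / 2 with he₁
  set e₂ := N / 2 with he₂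
  set M := 2 ^ e₂ with hM
  set s := 2 ^ e₁ with hs
  have hQ : 2 ^ N = s * M := by rw [hs, hM, ← pow_add]; congr 1; omega
  have hbe : big ≤ e₂ := by omega
  have hMb : big < M := lt_of_le_of_lt hbe (Nat.lt_two_pow_self)
  have hMs : M ≤ s := Nat.pow_le_pow_right (by norm_num) (by omega)
  set I := s / D - 2 * D - 2 with hI
  set K := (E * M) / D + C with hK
  have hD0' : 0 < D := by omega
  have hsD := Nat.div_add_mod s D
  have hsm := Nat.mod_lt s hD0'
  have hEM := Nat.div_add_mod (E * M) D
  have hEMm := Nat.mod_lt (E * M) hD0'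
  have hbigs : 2 * D * (2 * D + 9) ≤ s := by
    have : 2 * D * (2 * D + 9) ≤ big := by rw [hbig]; omega
    omega
  have hsDlarge : 2 * (2 * D + 9) ≤ s / D := by
    rw [Nat.le_div_iff_mul_le hD0']
    nlinarith
  have hI' : I + 2 * D + 2 = s / D := by omega
  have hI1 : D * (I + 2 * D + 1) < s := by
    have : D * (I + 2 * D + 1) + D = D * (s / D) := by rw [← hI']; ring
    omega
  have hI2 : s ≤ 2 * D * I := by
    have : 2 * (D * (s / D)) = 2 * D * I + 2 * D * (2 * D + 2) := by rw [← hI']; ring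
    have h3 : 2 * D * (2 * D + 9) = 2 * D * (2 * D + 2) + 14 * D := by ring
    omega
  have hI4 : 4 ≤ I := by omega
  have hDK : D * K = D * ((E * M) / D) + D * C := by rw [hK]; ring
  have hdim := arith_dim (E := E) (M := M) (s := s) (I := I) (K := K) (C := C) hC hMs hI2 hI4
    (by rw [← hDE]; omega) (by rw [← hDE]; omega)
  obtain ⟨S, hS, hcard⟩ := stepanov_count hP hD hD0' hwP hirr hder hs hM hQ (by omega) hf hI1 (by
    rw [← hDE] at hdim
    have : D - 1 = E := by omega
    rw [this]; exact hdim)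
  refine ⟨S, ?_, hS⟩
  rw [hQ] at hcard
  have h1 : D * (I + D + s * (K + D) + D + 1) = D * (I + 2 * D + 1) + s * (D * K) + s * (D * D) := by
    ring
  have h2 : s * (D * K) ≤ s * (E * M + D * C) := Nat.mul_le_mul_left _ (by omega)
  have h3 : D * (s * M) = s * (E * M) + s * M := by rw [hDE]; ring
  have h4 : s * (K0 + D * (D * (2 * D + 1)) + D * C + D * D + 2) ≤ s * M :=
    Nat.mul_le_mul_left _ (by omega)
  have h5 : s * (E * M + D * C) = s * (E * M) + s * (D * C) := by ring
  have h6 : s * (K0 + D * (D * (2 * D + 1)) + D * C + D * D + 2) =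
    s * (K0 + D * (D * (2 * D + 1))) + s * (D * C) + s * (D * D) + 2 * s := by ring
  have h7 : 1 * (K0 + D * (D * (2 * D + 1))) ≤ s * (K0 + D * (D * (2 * D + 1))) :=
    Nat.mul_le_mul_right _ (by omega)
  omega


section PartB1
variable {k : Type*} [Field k]

/-- weight-graded version of a bivariate polynomial -/
noncomputable def theta : k[X][X] →+* k[X][X][X] :=
  eval₂RingHom (R := k[X]) (S := k[X][X][X]) (eval₂RingHom (R := k) (S := k[X][X][X]) (((C : k[X][X] →+* k[X][X][X]).comp (C : k[X] →+* k[X][X])).comp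
    (C : k →+* k[X])) (C (C X) * X)) (C X * X)

lemma theta_coeff (p : k[X][X]) (n j i : ℕ) :
    (((theta p).coeff n).coeff j).coeff i = if i + j = n then (p.coeff j).coeff i else 0 := by
  induction p using Polynomial.induction_on' with
  | add p q hp hq =>
    rw [map_add]
    simp only [coeff_add, hp, hq]
    split_ifs <;> simp
  | monomial m a =>
    induction a using Polynomial.induction_on' with
    | add p q hp hq =>
      simp only [map_add, coeff_add, hp, hq]
      split_ifs <;> simp
    | monomial l c =>
      have : theta (monomial m (monomial l c)) = monomial (l + m) (monomial m (monomial l c)) := by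
        simp only [theta, coe_eval₂RingHom, eval₂_monomial, RingHom.comp_apply]
        simp only [← C_mul_X_pow_eq_monomial, C_mul, pow_add, C_pow]
        ring
      rw [this]
      by_cases h1 : m = j
      · by_cases h2 : l = i
        · subst h1 h2
          by_cases h3 : l + m = n <;> simp [coeff_monomial, h3]
        · subst h1
          by_cases h3 : l + m = n <;> simp [coeff_monomial, h2, h3]
      · by_cases h3 : l + m = n <;> simp [coeff_monomial, h1, h3]

lemma wtle_iff_theta (t : ℕ) (p : k[X][X]) : wtle t p ↔ (theta p).natDegree ≤ t := by
  rw [natDegree_le_iff_coeff_eq_zero]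
  constructor
  · intro h n hn
    ext j i
    rw [theta_coeff]
    split_ifs with h1
    · rw [h i j (by omega)]; simp
    · simp
  · intro h i j hij
    have := h (i + j) hij
    have h2 := theta_coeff p (i + j) j i
    rw [this] at h2
    simpa using h2.symm

lemma theta_injective : Function.Injective (theta (k := k)) := by
  rw [injective_iff_map_eq_zero]
  intro p hp
  ext j i
  have := theta_coeff p (i + j) j i
  rw [hp] at this
  simpa using this.symm

lemma natDegree_le_theta {p : k[X][X]} : p.natDegree ≤ (theta p).natDegree :=
  ((wtle_iff_theta _ p).mpr le_rfl).natDegree_le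

lemma theta_natDegree_mul {p q : k[X][X]} (hp : p ≠ 0) (hq : q ≠ 0) :
    (theta (p * q)).natDegree = (theta p).natDegree + (theta q).natDegree := by
  rw [map_mul, natDegree_mul]
  · rwa [Ne, map_eq_zero_iff _ theta_injective]
  · rwa [Ne, map_eq_zero_iff _ theta_injective]

lemma wtle_factor {P u v : k[X][X]} (hP : P = u * v) (hu : u.Monic) (hv : v.Monic)
    (hw : wtle P.natDegree P) : wtle u.natDegree u := by
  rw [wtle_iff_theta] at hw ⊢
  have h1 := theta_natDegree_mul hu.ne_zero hv.ne_zero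
  rw [← hP] at h1
  have h2 : P.natDegree = u.natDegree + v.natDegree := by rw [hP, hu.natDegree_mul hv]
  have := natDegree_le_theta (p := v)
  omega
end PartB1

section Val
variable {k : Type*} [Field k] {Ω : Type*} [Field Ω] [Algebra k Ω]

lemma exists_val (T : Ω) (hT : Function.Injective (aeval (R := k) T)) :
    ∃ v : ValuationSubring Ω, (∀ c : k, c ≠ 0 → v.valuation (algebraMap k Ω c) = 1) ∧
      v.valuation T < 1 ∧ v.valuation T ≠ 0 := by
  let A : Subring Ω := (aeval (R := k) T).range.toSubring
  have hTA : T ∈ A := ⟨X, by simp⟩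
  let I : Ideal A := Ideal.span {⟨T, hTA⟩}
  have hI : I ≠ ⊤ := by
    intro h
    rw [Ideal.eq_top_iff_one, Ideal.mem_span_singleton] at h
    obtain ⟨⟨c, p, hp⟩, hc⟩ := h
    have hc' : (1 : Ω) = T * c := congrArg Subtype.val hc
    have hp' : aeval T p = c := hp
    rw [← hp'] at hc'
    have : (1 : k[X]) = X * p := by
      apply hT; rw [map_mul, aeval_X, map_one]; exact hc'
    have := congrArg (fun q => q.coeff 0) this
    simp at this
  obtain ⟨v, hv1, hv2⟩ := Ideal.image_subset_nonunits_valuationSubring I hI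
  refine ⟨v, ?_, ?_, ?_⟩
  · intro c hc
    have hm : ∀ c : k, v.valuation (algebraMap k Ω c) ≤ 1 := by
      intro c
      rw [ValuationSubring.valuation_le_one_iff]
      exact hv1 ⟨C c, by simp⟩
    refine le_antisymm (hm c) ?_
    have h2 := hm c⁻¹
    rw [map_inv₀, map_inv₀] at h2
    have hne : v.valuation (algebraMap k Ω c) ≠ 0 := by simpa using hc
    exact (inv_le_one₀ (zero_lt_iff.mpr hne)).mp h2
  · have : T ∈ (v.nonunits : Set Ω) := hv2 ⟨⟨T, hTA⟩, Ideal.subset_span rfl, rfl⟩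
    exact v.mem_nonunits_iff.mp this
  · rw [Valuation.ne_zero_iff]
    rintro rfl
    have : (X : k[X]) = 0 := by apply hT; simp
    exact X_ne_zero this
end Val


section ValHelp
variable {Ω Γ : Type*} [Field Ω] [LinearOrderedCommGroupWithZero Γ] (v : Valuation Ω Γ)

lemma val_dom0 {x E : Ω} (h : x + E = 0) (hE : v E < v x) : False := by
  have : x = -E := eq_neg_of_add_eq_zero_left h
  rw [this, Valuation.map_neg] at hE
  exact lt_irrefl _ hE

lemma val_dom2 {x y E : Ω} (h : x + y + E = 0) (hE : v E < v x ∨ v E < v y) : v x = v y := by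
  rcases hE with hE | hE
  · have h1 : y = -(x + E) := by linear_combination h
    rw [h1, Valuation.map_neg, Valuation.map_add_eq_of_lt_left _ hE]
  · have h1 : x = -(y + E) := by linear_combination h
    rw [h1, Valuation.map_neg, Valuation.map_add_eq_of_lt_left _ hE]

lemma val_add_eq {x E : Ω} (hE : v E < v x) : v (x + E) = v x :=
  Valuation.map_add_eq_of_lt_left _ hE

lemma val_mul_le {x y : Ω} {A B : Γ} (hx : v x ≤ A) (hy : v y ≤ B) : v (x * y) ≤ A * B := by
  rw [map_mul]; exact mul_le_mul' hx hy

lemma val_pow_le {x : Ω} {A : Γ} (hx : v x ≤ A) (n : ℕ) : v (x ^ n) ≤ A ^ n := by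
  rw [map_pow]; exact pow_le_pow_left' hx n

lemma val_mul_le_right {x y : Ω} {B : Γ} (hx : v x ≤ 1) (hy : v y ≤ B) : v (x * y) ≤ B := by
  simpa using val_mul_le v hx hy

lemma val_mul_le_left {x y : Ω} {A : Γ} (hx : v x ≤ A) (hy : v y ≤ 1) : v (x * y) ≤ A := by
  simpa using val_mul_le v hx hy

lemma val_mul_lt_right {x y : Ω} {B : Γ} (hx : v x ≤ 1) (hy : v y < B) : v (x * y) < B :=
  lt_of_le_of_lt (val_mul_le_right v hx le_rfl) hy

lemma val_approx_mul {M : Γ} {x y x' y' : Ω} (hx : v x ≤ 1) (hy' : v y' ≤ 1)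
    (h1 : v (x - x') ≤ M) (h2 : v (y - y') ≤ M) : v (x * y - x' * y') ≤ M := by
  have : x * y - x' * y' = x * (y - y') + (x - x') * y' := by ring
  rw [this]
  exact Valuation.map_add_le _ (val_mul_le_right v hx h2) (val_mul_le_left v h1 hy')

lemma val_approx_pow {M : Γ} {x x' : Ω} (hx : v x ≤ 1) (hx' : v x' ≤ 1)
    (h1 : v (x - x') ≤ M) (n : ℕ) : v (x ^ n - x' ^ n) ≤ M := by
  induction n with
  | zero => simp
  | succ n ih =>
    rw [pow_succ, pow_succ]
    exact val_approx_mul v (by rw [map_pow]; exact pow_le_one' hx n) hx' ih h1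

lemma val_pow_lt {A B : Γ} (h : A < B) {n : ℕ} (hn : n ≠ 0) : A ^ n < B ^ n :=
  pow_lt_pow_left₀ h zero_le hn

lemma val_pow_le_iff {A B : Γ} {n : ℕ} (hn : n ≠ 0) : A ^ n ≤ B ^ n ↔ A ≤ B :=
  pow_le_pow_iff_left₀ zero_le zero_le hn

lemma val_pow_anti {A : Γ} (h0 : A ≠ 0) (h1 : A < 1) {m n : ℕ} : A ^ m ≤ A ^ n ↔ n ≤ m :=
  pow_le_pow_iff_right_of_lt_one₀ (zero_lt_iff.mpr h0) h1

lemma val_pow_anti_lt {A : Γ} (h0 : A ≠ 0) (h1 : A < 1) {m n : ℕ} : A ^ m < A ^ n ↔ n < m :=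
  pow_lt_pow_iff_right_of_lt_one₀ (zero_lt_iff.mpr h0) h1

lemma val_pow_anti_eq {A : Γ} (h0 : A ≠ 0) (h1 : A < 1) {m n : ℕ} : A ^ m = A ^ n ↔ m = n := by
  constructor
  · intro h
    exact le_antisymm ((val_pow_anti h0 h1).mp h.ge) ((val_pow_anti h0 h1).mp h.le)
  · rintro rfl; rfl
end ValHelp

section Loc1
variable {k Ω Γ : Type*} [Field k] [Field Ω] [CharP k 2] [CharP Ω 2]
  [LinearOrderedCommGroupWithZero Γ]

/-- valuation trivial on constants -/
def TrivOn (v : Valuation Ω Γ) (κ : k →+* Ω) : Prop := ∀ c : k, c ≠ 0 → v (κ c) = 1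

variable {v : Valuation Ω Γ} {κ : k →+* Ω}

lemma TrivOn.le_one (h : TrivOn v κ) (c : k) : v (κ c) ≤ 1 := by
  by_cases hc : c = 0
  · simp [hc]
  · exact (h c hc).le

lemma TrivOn.eq_zero (h : TrivOn v κ) {c : k} (hc : v (κ c) < 1) : c = 0 := by
  by_contra h0
  rw [h c h0] at hc
  exact lt_irrefl _ hc

lemma gdiff (h : TrivOn v κ) {ℓ : ℕ} (hℓ : Odd ℓ) {a : k} (ha : a ^ ℓ = 1) {M : Γ} (hM : M ≤ 1)
    {x x' : Ω} (hx : v (x - κ a) ≤ M) (hx' : v (x' - κ a) ≤ M) :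
    ∃ c, v c ≤ M ∧ x ^ ℓ - x' ^ ℓ = (x - x') * (κ a⁻¹ + c) := by
  have hle : ∀ z : Ω, v (z - κ a) ≤ M → v z ≤ 1 := by
    intro z hz
    have : z = (z - κ a) + κ a := by ring
    rw [this]
    exact Valuation.map_add_le _ (hz.trans hM) (h.le_one a)
  have ha0 : a ≠ 0 := by
    rintro rfl
    rw [zero_pow hℓ.pos.ne'] at ha
    exact zero_ne_one ha
  have hainv : κ a⁻¹ = ∑ i ∈ Finset.range ℓ, κ a ^ i * κ a ^ (ℓ - 1 - i) := by
    have h1 : ∀ i ∈ Finset.range ℓ, κ a ^ i * κ a ^ (ℓ - 1 - i) = κ (a ^ (ℓ - 1)) := by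
      intro i hi
      rw [Finset.mem_range] at hi
      rw [← pow_add, map_pow]; congr 1; omega
    rw [Finset.sum_congr rfl h1, Finset.sum_const, Finset.card_range, nsmul_eq_mul]
    have h2 : (ℓ : Ω) = 1 := by
      obtain ⟨j, rfl⟩ := hℓ
      have : (2 : Ω) = 0 := CharTwo.two_eq_zero
      push_cast; rw [this]; ring
    rw [h2, one_mul]
    congr 1
    rw [inv_eq_iff_eq_inv]
    have h3 : a ^ (ℓ - 1) * a = 1 := by rw [← pow_succ, Nat.sub_add_cancel hℓ.pos, ha]
    exact eq_inv_of_mul_eq_one_right h3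
  refine ⟨(∑ i ∈ Finset.range ℓ, x ^ i * x' ^ (ℓ - 1 - i)) - κ a⁻¹, ?_, ?_⟩
  · rw [hainv, ← Finset.sum_sub_distrib]
    apply Valuation.map_sum_le
    intro i _
    exact val_approx_mul v (by rw [map_pow]; exact pow_le_one' (hle x hx) _)
      (by rw [map_pow]; exact pow_le_one' (h.le_one a) _)
      (val_approx_pow v (hle x hx) (h.le_one a) hx i)
      (val_approx_pow v (hle x' hx') (h.le_one a) hx' _)
  · have := (Commute.all x x').geom_sum₂_mul ℓ
    rw [← this]; ring

/-- the form `x^d+y^d+1+(x+y+1)^d` -/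
def Fh (d : ℕ) (x y : Ω) : Ω := x ^ d + y ^ d + 1 + (x + y + 1) ^ d

lemma Fh_eq {i ℓ : ℕ} (x y : Ω) : Fh (2 ^ i * ℓ + 1) x y = x * (x ^ ℓ - 1) ^ 2 ^ i +
    y * (y ^ ℓ - 1) ^ 2 ^ i + (x + y + 1) * ((x + y + 1) ^ ℓ - 1) ^ 2 ^ i := by
  unfold Fh
  haveI : Fact (Nat.Prime 2) := ⟨Nat.prime_two⟩
  simp only [sub_pow_char_pow, one_pow, pow_succ, mul_comm (2 ^ i) ℓ, pow_mul]
  have : (2 : Ω) = 0 := CharTwo.two_eq_zero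
  linear_combination (x + y + 1) * this

lemma Fx_eq {i ℓ : ℕ} (x w : Ω) : x ^ (2 ^ i * ℓ) + w ^ (2 ^ i * ℓ) =
    ((x ^ ℓ - 1) + (w ^ ℓ - 1)) ^ 2 ^ i := by
  haveI : Fact (Nat.Prime 2) := ⟨Nat.prime_two⟩
  simp only [add_pow_char_pow, sub_pow_char_pow, one_pow, mul_comm (2 ^ i) ℓ, pow_mul]
  have : (2 : Ω) = 0 := CharTwo.two_eq_zero
  linear_combination  this

/-- the expansion -/
lemma Fh_expand (h : TrivOn v κ) {i ℓ : ℕ} (hℓ : Odd ℓ) {a b e : k} (ha : a ^ ℓ = 1)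
    (hb : b ^ ℓ = 1) (he : e ^ ℓ = 1) (habe : e = a + b + 1) {x t X W : Ω} {m : Γ}
    (hm1 : m ≤ 1) (hX : v X ≤ m) (ht : v t ≤ m) (hx : x = κ a + X) (hW : W = X + t) :
    ∃ R, v R ≤ m ^ (2 * 2 ^ i) ∧ Fh (2 ^ i * ℓ + 1) x (κ b + t) =
      κ (a * a⁻¹ ^ 2 ^ i + e * e⁻¹ ^ 2 ^ i) * X ^ 2 ^ i +
      κ (b * b⁻¹ ^ 2 ^ i + e * e⁻¹ ^ 2 ^ i) * t ^ 2 ^ i + κ (a⁻¹ ^ 2 ^ i) * X ^ (2 ^ i + 1) +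
      κ (b⁻¹ ^ 2 ^ i) * t ^ (2 ^ i + 1) + κ (e⁻¹ ^ 2 ^ i) * W ^ (2 ^ i + 1) + R := by
  haveI : Fact (Nat.Prime 2) := ⟨Nat.prime_two⟩
  have hW' : v W ≤ m := by rw [hW]; exact Valuation.map_add_le _ hX ht
  have key : ∀ (a : k) (X : Ω), a ^ ℓ = 1 → v X ≤ m → ∃ R, v R ≤ m ^ (2 * 2 ^ i) ∧
      (κ a + X) * ((κ a + X) ^ ℓ - 1) ^ 2 ^ i =
      κ (a * a⁻¹ ^ 2 ^ i) * X ^ 2 ^ i + κ (a⁻¹ ^ 2 ^ i) * X ^ (2 ^ i + 1) + R := by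
    intro a X ha hX
    obtain ⟨c, hc, hc2⟩ := gdiff h hℓ ha hm1 (x := κ a + X) (x' := κ a) (by simpa using hX)
      (by simp)
    refine ⟨(κ a + X) * (X * c) ^ 2 ^ i, ?_, ?_⟩
    · apply val_mul_le_right
      · exact Valuation.map_add_le _ (h.le_one a) (hX.trans hm1)
      · have := val_pow_le v (val_mul_le v hX hc) (2 ^ i)
        rwa [← pow_two, ← pow_mul] at this
    · rw [← map_pow, ha, map_one] at hc2
      rw [hc2]
      have : (κ a + X - κ a) * (κ a⁻¹ + c) = X * κ a⁻¹ + X * c := by ring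
      rw [this, add_pow_char_pow]
      simp only [map_mul, map_pow, mul_pow]
      ring
  obtain ⟨R1, hR1, h1⟩ := key a X ha hX
  obtain ⟨R2, hR2, h2⟩ := key b t hb ht
  obtain ⟨R3, hR3, h3⟩ := key e W he hW'
  refine ⟨R1 + R2 + R3, Valuation.map_add_le _ (Valuation.map_add_le _ hR1 hR2) hR3, ?_⟩
  have hw : x + (κ b + t) + 1 = κ e + W := by
    rw [hx, hW, habe]; simp only [map_add, map_one]; ring
  rw [Fh_eq, hw, h3, h2, hx, h1]
  have h4 : W ^ 2 ^ i = X ^ 2 ^ i + t ^ 2 ^ i := by rw [hW, add_pow_char_pow]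
  simp only [map_add]
  linear_combination κ (e * e⁻¹ ^ 2 ^ i) * h4

lemma Fx_expand (h : TrivOn v κ) {ℓ : ℕ} (hℓ : Odd ℓ) {a e : k} (ha : a ^ ℓ = 1)
    (he : e ^ ℓ = 1) {X W : Ω} {m : Γ} (hm1 : m ≤ 1) (hX : v X ≤ m) (hW : v W ≤ m) :
    ∃ R, v R ≤ m ^ 2 ∧ ((κ a + X) ^ ℓ - 1) + ((κ e + W) ^ ℓ - 1) =
      κ a⁻¹ * X + κ e⁻¹ * W + R := by
  have key : ∀ (a : k) (X : Ω), a ^ ℓ = 1 → v X ≤ m → ∃ R, v R ≤ m ^ 2 ∧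
      ((κ a + X) ^ ℓ - 1) = κ a⁻¹ * X + R := by
    intro a X ha hX
    obtain ⟨c, hc, hc2⟩ := gdiff h hℓ ha hm1 (x := κ a + X) (x' := κ a) (by simpa using hX)
      (by simp)
    refine ⟨X * c, by rw [pow_two]; exact val_mul_le v hX hc, ?_⟩
    rw [← map_pow, ha, map_one] at hc2
    rw [hc2]; ring
  obtain ⟨R1, hR1, h1⟩ := key a X ha hX
  obtain ⟨R3, hR3, h3⟩ := key e W he hW
  refine ⟨R1 + R3, Valuation.map_add_le _ hR1 hR3, ?_⟩
  rw [h1, h3]; ring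
end Loc1


section Loc2
variable {k Ω Γ : Type*} [Field k] [Field Ω] [CharP k 2] [CharP Ω 2]
  [LinearOrderedCommGroupWithZero Γ]

/-- a candidate singular point and a local parameter -/
structure SP (v : Valuation Ω Γ) (κ : k →+* Ω) (i ℓ : ℕ) (a b e : k) (t : Ω) : Prop where
  triv : TrivOn v κ
  hi : 1 ≤ i
  hℓ : Odd ℓ
  ha : a ^ ℓ = 1
  hb : b ^ ℓ = 1
  he : e ^ ℓ = 1
  habe : e = a + b + 1
  ht0 : t ≠ 0
  ht1 : v t < 1

variable {v : Valuation Ω Γ} {κ : k →+* Ω} {i ℓ : ℕ} {a b e : k} {t : Ω}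

/-- coefficient of the leading form -/
def cA (i : ℕ) (a e : k) : k := a * a⁻¹ ^ 2 ^ i + e * e⁻¹ ^ 2 ^ i

lemma ne_zero_of_pow_odd {ℓ : ℕ} (hℓ : Odd ℓ) {a : k} (ha : a ^ ℓ = 1) : a ≠ 0 := by
  rintro rfl
  rw [zero_pow hℓ.pos.ne'] at ha
  exact zero_ne_one ha

lemma SP.r2 (H : SP v κ i ℓ a b e t) : 2 ≤ 2 ^ i := by
  calc 2 = 2 ^ 1 := rfl
    _ ≤ 2 ^ i := Nat.pow_le_pow_right (by norm_num) H.hi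

lemma SP.vt0 (H : SP v κ i ℓ a b e t) : v t ≠ 0 := by
  simpa using H.ht0

lemma SP.expand2 (H : SP v κ i ℓ a b e t) {X : Ω} {m : Γ} (hm1 : m ≤ 1) (hX : v X ≤ m)
    (ht : v t ≤ m) :
    ∃ R, v R ≤ m ^ (2 * 2 ^ i) ∧ Fh (2 ^ i * ℓ + 1) (κ a + X) (κ b + t) =
      κ (cA i a e) * X ^ 2 ^ i +
      κ (cA i b e) * t ^ 2 ^ i + κ (a⁻¹ ^ 2 ^ i) * X ^ (2 ^ i + 1) +
      κ (b⁻¹ ^ 2 ^ i) * t ^ (2 ^ i + 1) + κ (e⁻¹ ^ 2 ^ i) * (X + t) ^ (2 ^ i + 1) + R :=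
  Fh_expand H.triv H.hℓ H.ha H.hb H.he H.habe hm1 hX ht rfl rfl

lemma SP.expand1 (H : SP v κ i ℓ a b e t) {X : Ω} {m : Γ} (hm1 : m ≤ 1) (hX : v X ≤ m)
    (ht : v t ≤ m) :
    ∃ R, v R ≤ m ^ (2 ^ i + 1) ∧ Fh (2 ^ i * ℓ + 1) (κ a + X) (κ b + t) =
      κ (cA i a e) * X ^ 2 ^ i + κ (cA i b e) * t ^ 2 ^ i + R := by
  obtain ⟨R, hR, h⟩ := H.expand2 hm1 hX ht
  refine ⟨κ (a⁻¹ ^ 2 ^ i) * X ^ (2 ^ i + 1) + κ (b⁻¹ ^ 2 ^ i) * t ^ (2 ^ i + 1) +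
    κ (e⁻¹ ^ 2 ^ i) * (X + t) ^ (2 ^ i + 1) + R, ?_, by rw [h]; ring⟩
  have hr := H.r2
  refine Valuation.map_add_le _ (Valuation.map_add_le _ (Valuation.map_add_le _ ?_ ?_) ?_) ?_
  · exact val_mul_le_right v (H.triv.le_one _) (val_pow_le v hX _)
  · exact val_mul_le_right v (H.triv.le_one _) (val_pow_le v ht _)
  · exact val_mul_le_right v (H.triv.le_one _) (val_pow_le v (Valuation.map_add_le _ hX ht) _)
  · exact hR.trans (pow_le_pow_right_of_le_one' hm1 (by omega))

/-- if `A ≠ 0` then `v X ≤ v t` -/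
lemma SP.X_le (H : SP v κ i ℓ a b e t) (hA : cA i a e ≠ 0) {X : Ω} (hX1 : v X < 1)
    (h0 : Fh (2 ^ i * ℓ + 1) (κ a + X) (κ b + t) = 0) : v X ≤ v t := by
  by_contra hlt
  rw [not_le] at hlt
  obtain ⟨R, hR, h⟩ := H.expand1 hX1.le le_rfl hlt.le
  rw [h0, add_assoc] at h
  have hr := H.r2
  have hX0 : v X ≠ 0 := (lt_of_le_of_lt zero_le hlt).ne'
  have hvX : v (κ (cA i a e) * X ^ 2 ^ i) = v X ^ 2 ^ i := by
    rw [map_mul, H.triv _ hA, one_mul, map_pow]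
  refine val_dom0 v h.symm ?_
  rw [hvX]
  refine Valuation.map_add_lt _ ?_ ?_
  · refine val_mul_lt_right v (H.triv.le_one _) ?_
    rw [map_pow]; exact val_pow_lt hlt (by positivity)
  · exact lt_of_le_of_lt hR ((val_pow_anti_lt hX0 hX1).mpr (by omega))

/-- value at `X = 0` if `B ≠ 0` -/
lemma SP.val_at_zero (H : SP v κ i ℓ a b e t) (hB : cA i b e ≠ 0) :
    v (Fh (2 ^ i * ℓ + 1) (κ a) (κ b + t)) = v t ^ 2 ^ i := by
  obtain ⟨R, hR, h⟩ := H.expand1 (X := 0) H.ht1.le (by simp) le_rfl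
  have hr := H.r2
  rw [add_zero, zero_pow (by omega), mul_zero, zero_add] at h
  have hvt : v (κ (cA i b e) * t ^ 2 ^ i) = v t ^ 2 ^ i := by
    rw [map_mul, H.triv _ hB, one_mul, map_pow]
  rw [h, val_add_eq, hvt]
  rw [hvt]
  exact lt_of_le_of_lt hR ((val_pow_anti_lt H.vt0 H.ht1).mpr (by omega))

/-- expansion when `A = 0`, `v t < v X` -/
lemma SP.expandA0 (H : SP v κ i ℓ a b e t) (hA : cA i a e = 0) {X : Ω}
    (hX1 : v X < 1) (hlt : v t < v X) (h0 : Fh (2 ^ i * ℓ + 1) (κ a + X) (κ b + t) = 0) :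
    ∃ E, v E < v X ^ (2 ^ i + 1) ∧ κ (a⁻¹ ^ 2 ^ i + e⁻¹ ^ 2 ^ i) * X ^ (2 ^ i + 1) +
      κ (cA i b e) * t ^ 2 ^ i + E = 0 := by
  have : Fact (Nat.Prime 2) := ⟨Nat.prime_two⟩
  obtain ⟨R, hR, h⟩ := H.expand2 hX1.le le_rfl hlt.le
  have hr := H.r2
  have hX0 : v X ≠ 0 := (lt_of_le_of_lt zero_le hlt).ne'
  have hX0' : 0 < v X := zero_lt_iff.mpr hX0
  refine ⟨κ (b⁻¹ ^ 2 ^ i) * t ^ (2 ^ i + 1) + κ (e⁻¹ ^ 2 ^ i) *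
    (X * t ^ 2 ^ i + t * X ^ 2 ^ i + t ^ (2 ^ i + 1)) + R, ?_, ?_⟩
  · have ht1 : v (t ^ (2 ^ i + 1)) < v X ^ (2 ^ i + 1) := by
      rw [map_pow]; exact val_pow_lt hlt (by omega)
    refine Valuation.map_add_lt _ (Valuation.map_add_lt _ ?_ ?_) ?_
    · exact val_mul_lt_right v (H.triv.le_one _) ht1
    · refine val_mul_lt_right v (H.triv.le_one _) ?_
      refine Valuation.map_add_lt _ (Valuation.map_add_lt _ ?_ ?_) ht1
      · rw [map_mul, map_pow, pow_succ, mul_comm]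
        exact mul_lt_mul_of_pos_right (val_pow_lt hlt (by positivity)) hX0'
      · rw [map_mul, map_pow, pow_succ, mul_comm]
        exact mul_lt_mul_of_pos_left hlt (pow_pos hX0' _)
    · exact lt_of_le_of_lt hR ((val_pow_anti_lt hX0 hX1).mpr (by omega))
  · rw [h0, hA, map_zero, zero_mul, zero_add, pow_succ (X + t), add_pow_char_pow] at h
    rw [h]
    simp only [map_add]
    ring

lemma inv_pow_add_ne {i : ℕ} {a e : k} (hae : a ≠ e) : a⁻¹ ^ 2 ^ i + e⁻¹ ^ 2 ^ i ≠ 0 := by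
  have : Fact (Nat.Prime 2) := ⟨Nat.prime_two⟩
  rw [← add_pow_char_pow]
  apply pow_ne_zero
  intro h
  apply hae
  have := CharTwo.add_eq_zero.mp h
  exact inv_injective this

/-- Type II (i) -/
lemma SP.typeIIi (H : SP v κ i ℓ a b e t) (hA : cA i a e = 0) (hB : cA i b e ≠ 0) (hae : a ≠ e)
    {X : Ω} (hX1 : v X < 1) (h0 : Fh (2 ^ i * ℓ + 1) (κ a + X) (κ b + t) = 0) :
    v X ^ (2 ^ i + 1) = v t ^ 2 ^ i := by
  have hr := H.r2
  have hvt : v (κ (cA i b e) * t ^ 2 ^ i) = v t ^ 2 ^ i := by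
    rw [map_mul, H.triv _ hB, one_mul, map_pow]
  have hlt : v t < v X := by
    by_contra hle
    rw [not_lt] at hle
    obtain ⟨R, hR, h⟩ := H.expand1 H.ht1.le hle le_rfl
    rw [h0, hA, map_zero, zero_mul, zero_add] at h
    refine val_dom0 v h.symm ?_
    rw [hvt]
    exact lt_of_le_of_lt hR ((val_pow_anti_lt H.vt0 H.ht1).mpr (by omega))
  obtain ⟨E, hE, h⟩ := H.expandA0 hA hX1 hlt h0
  have hvX : v (κ (a⁻¹ ^ 2 ^ i + e⁻¹ ^ 2 ^ i) * X ^ (2 ^ i + 1)) = v X ^ (2 ^ i + 1) := by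
    rw [map_mul, H.triv _ (inv_pow_add_ne hae), one_mul, map_pow]
  have := val_dom2 v h (Or.inl (by rw [hvX]; exact hE))
  rwa [hvX, hvt] at this

/-- formula for `b = 1` -/
lemma SP.b1_formula (H : SP v κ i ℓ a b e t) (hb1 : b = 1) {X : Ω} {m : Γ} (hm1 : m < 1)
    (hX : v X ≤ m) (ht : v t ≤ m) : ∃ K S, v (K - κ (a * a⁻¹ ^ 2 ^ i + 1)) ≤ m ∧ v S = 1 ∧
      Fh (2 ^ i * ℓ + 1) (κ a + X) (κ b + t) = t * ((X + t) * S) ^ 2 ^ i + t ^ 2 ^ i * K := by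
  have : Fact (Nat.Prime 2) := ⟨Nat.prime_two⟩
  have two : (2 : k) = 0 := CharTwo.two_eq_zero
  have two' : (2 : Ω) = 0 := CharTwo.two_eq_zero
  have hea : e = a := by rw [H.habe, hb1]; linear_combination two
  subst hea
  subst hb1
  have ha0 := ne_zero_of_pow_odd H.hℓ H.ha
  obtain ⟨c1, hc1, h1⟩ := gdiff H.triv H.hℓ H.ha hm1.le (x := κ e + (X + t)) (x' := κ e + X)
    (by simpa using Valuation.map_add_le _ hX ht) (by simpa using hX)
  obtain ⟨c2, hc2, h2⟩ := gdiff H.triv H.hℓ H.hb hm1.le (x := κ 1 + t) (x' := κ 1)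
    (by simpa using ht) (by simp)
  obtain ⟨c3, hc3, h3⟩ := gdiff H.triv H.hℓ H.ha hm1.le (x := κ e + (X + t)) (x' := κ e)
    (by simpa using Valuation.map_add_le _ hX ht) (by simp)
  have e3 : (κ e) ^ ℓ = 1 := by rw [← map_pow, H.ha, map_one]
  refine ⟨(κ e + X) * (κ e⁻¹ + c1) ^ 2 ^ i + (1 + t) * (1 + c2) ^ 2 ^ i, κ e⁻¹ + c3, ?_, ?_, ?_⟩
  · have hle : ∀ (c : k) (z : Ω), v z ≤ m → v (κ c + z) ≤ 1 := fun c z hz =>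
      Valuation.map_add_le _ (H.triv.le_one c) (hz.trans hm1.le)
    have e1 : v ((κ e + X) * (κ e⁻¹ + c1) ^ 2 ^ i - κ e * κ e⁻¹ ^ 2 ^ i) ≤ m := by
      refine val_approx_mul v (hle _ _ hX) ?_ (by simpa using hX) ?_
      · rw [map_pow]; exact pow_le_one' (H.triv.le_one _) _
      · exact val_approx_pow v (hle _ _ hc1) (H.triv.le_one _) (by simpa using hc1) _
    have e2 : v ((κ 1 + t) * (κ 1 + c2) ^ 2 ^ i - κ 1 * κ 1 ^ 2 ^ i) ≤ m := by
      refine val_approx_mul v (hle _ _ ht) ?_ (by simpa using ht) ?_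
      · rw [map_pow]; exact pow_le_one' (H.triv.le_one _) _
      · exact val_approx_pow v (hle _ _ hc2) (H.triv.le_one _) (by simpa using hc2) _
    have := Valuation.map_add_le _ e1 e2
    convert this using 2
    simp only [map_add, map_mul, map_pow, map_one, one_pow]
    ring
  · rw [val_add_eq, H.triv _ (inv_ne_zero ha0)]
    rw [H.triv _ (inv_ne_zero ha0)]
    exact lt_of_le_of_lt hc3 hm1
  · rw [Fh_eq]
    have hw : κ e + X + (κ 1 + t) + 1 = κ e + (X + t) := by
      rw [map_one]; linear_combination two'
    rw [hw]
    have h3' : (κ e + (X + t)) ^ ℓ - 1 = (X + t) * (κ e⁻¹ + c3) := by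
      rw [e3] at h3; rw [h3]; ring
    have h2' : (κ 1 + t) ^ ℓ - 1 = t * (1 + c2) := by
      simp only [map_one, one_pow, inv_one] at h2 ⊢
      rw [h2]; ring
    have h1' : (κ e + X) ^ ℓ - 1 = ((κ e + (X + t)) ^ ℓ - 1) + t * (κ e⁻¹ + c1) := by
      linear_combination -h1 - (κ e⁻¹ + c1) * t * two'
    rw [h1', h2', h3', add_pow_char_pow]
    simp only [map_one, mul_pow]
    linear_combination (κ e + X) * (X + t) ^ 2 ^ i * (κ e⁻¹ + c3) ^ 2 ^ i * two'
end Loc2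


section Loc3
variable {k Ω Γ : Type*} [Field k] [Field Ω] [CharP k 2] [CharP Ω 2]
  [LinearOrderedCommGroupWithZero Γ]
variable {v : Valuation Ω Γ} {κ : k →+* Ω} {i ℓ : ℕ} {a b e : k} {t : Ω}

lemma SP.ea (H : SP v κ i ℓ a b e t) (hb1 : b = 1) : e = a := by
  rw [H.habe, hb1]; linear_combination (CharTwo.two_eq_zero : (2 : k) = 0)

lemma SP.ea_iff (H : SP v κ i ℓ a b e t) : a = e ↔ b = 1 := by
  constructor
  · intro h
    have h1 := H.habe
    rw [← h] at h1
    have : b + 1 = 0 := by linear_combination -h1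
    exact CharTwo.add_eq_zero.mp this
  · intro h; exact (H.ea h).symm

/-- Type II, `b = 1` -/
lemma SP.typeIIb1 (H : SP v κ i ℓ a b e t) (hb1 : b = 1) (hB : cA i b e ≠ 0) {X : Ω}
    (hX1 : v X < 1) (h0 : Fh (2 ^ i * ℓ + 1) (κ a + X) (κ b + t) = 0) :
    v X ^ 2 ^ i = v t ^ (2 ^ i - 1) := by
  have hr := H.r2
  obtain ⟨K, S, hK, hS, h⟩ := H.b1_formula hb1 (max_lt hX1 H.ht1) (le_max_left _ _)
    (le_max_right (v X) (v t))
  have hc : a * a⁻¹ ^ 2 ^ i + 1 ≠ 0 := by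
    rw [cA, H.ea hb1, hb1] at hB
    simpa [add_comm] using hB
  have hK1 : v K = 1 := by
    have e1 : K = κ (a * a⁻¹ ^ 2 ^ i + 1) + (K - κ (a * a⁻¹ ^ 2 ^ i + 1)) := by ring
    rw [e1, val_add_eq, H.triv _ hc]
    rw [H.triv _ hc]
    exact lt_of_le_of_lt hK (max_lt hX1 H.ht1)
  rw [h0] at h
  have h2 := val_dom2 v (E := 0) (by rw [add_zero]; exact h.symm)
    (Or.inr (by
      rw [map_zero, map_mul, hK1, mul_one, map_pow]; exact pow_pos (zero_lt_iff.mpr H.vt0) _))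
  rw [map_mul, map_mul, hK1, map_pow, map_pow, map_mul, hS, mul_one, mul_one] at h2
  have h3 : v (X + t) ^ 2 ^ i = v t ^ (2 ^ i - 1) := by
    have e2 : v t ^ 2 ^ i = v t * v t ^ (2 ^ i - 1) := by
      rw [← pow_succ', Nat.sub_add_cancel (by omega)]
    rw [e2] at h2
    exact mul_left_cancel₀ H.vt0 h2
  have hlt : v t < v (X + t) := by
    rw [← not_le]
    intro hle
    have := pow_le_pow_left' hle (2 ^ i)
    rw [h3, val_pow_anti H.vt0 H.ht1] at this
    omega
  have e3 : X = (X + t) + (-t) := by ring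
  rw [e3, val_add_eq, h3]
  rwa [Valuation.map_neg]

/-- Type III: `v X ≤ v t` -/
lemma SP.typeIII_X_le (H : SP v κ i ℓ a b e t) (hA : cA i a e = 0) (hB : cA i b e = 0) {X : Ω}
    (hX1 : v X < 1) (h0 : Fh (2 ^ i * ℓ + 1) (κ a + X) (κ b + t) = 0) : v X ≤ v t := by
  have hr := H.r2
  by_contra hlt
  rw [not_le] at hlt
  have hX0 : v X ≠ 0 := (lt_of_le_of_lt zero_le hlt).ne'
  by_cases hae : a = e
  · have hb1 := H.ea_iff.mp hae
    obtain ⟨K, S, hK, hS, h⟩ := H.b1_formula hb1 hX1 le_rfl hlt.le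
    have hc : a * a⁻¹ ^ 2 ^ i + 1 = 0 := by
      rw [cA, H.ea hb1, hb1] at hB
      simpa [add_comm] using hB
    rw [hc, map_zero, sub_zero] at hK
    have hW : v (X + t) = v X := val_add_eq v hlt
    rw [h0] at h
    have h2 : t * ((X + t) * S) ^ 2 ^ i = - (t ^ 2 ^ i * K) := by linear_combination -h
    have h3 := congrArg v h2
    rw [Valuation.map_neg, map_mul, map_mul, map_pow, map_pow, map_mul, hS, mul_one, hW] at h3
    have e2 : ∀ z : Γ, z ^ 2 ^ i = z * z ^ (2 ^ i - 1) := by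
      intro z; rw [← pow_succ', Nat.sub_add_cancel (by omega)]
    have h4 : v t * (v X * v X ^ (2 ^ i - 1)) ≤ v t * (v t ^ (2 ^ i - 1) * v X) := by
      rw [← e2, h3, e2 (v t), mul_assoc]
      gcongr
    have h5 : v X * v X ^ (2 ^ i - 1) ≤ v X * v t ^ (2 ^ i - 1) := by
      rw [mul_comm (v X) (v t ^ _)]
      exact le_of_mul_le_mul_left h4 (zero_lt_iff.mpr H.vt0)
    have h6 := le_of_mul_le_mul_left h5 (zero_lt_iff.mpr hX0)
    rw [val_pow_le_iff (by omega)] at h6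
    exact absurd hlt (not_lt.mpr h6)
  · obtain ⟨E, hE, h⟩ := H.expandA0 hA hX1 hlt h0
    rw [hB, map_zero, zero_mul, add_zero] at h
    refine val_dom0 v h ?_
    rwa [map_mul, H.triv _ (inv_pow_add_ne hae), one_mul, map_pow]

lemma SP.a0 (H : SP v κ i ℓ a b e t) : a ≠ 0 := ne_zero_of_pow_odd H.hℓ H.ha
lemma SP.b0 (H : SP v κ i ℓ a b e t) : b ≠ 0 := ne_zero_of_pow_odd H.hℓ H.hb
lemma SP.e0 (H : SP v κ i ℓ a b e t) : e ≠ 0 := ne_zero_of_pow_odd H.hℓ H.he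

/-- in type III, `a ^ r = a` -/
lemma typeIII_pow (ha0 : a ≠ 0) (hb0 : b ≠ 0) (he0 : e ≠ 0) (habe : e = a + b + 1)
    (hA : cA i a e = 0) (hB : cA i b e = 0) : a ^ 2 ^ i = a ∧ b ^ 2 ^ i = b ∧ e ^ 2 ^ i = e := by
  have : Fact (Nat.Prime 2) := ⟨Nat.prime_two⟩
  have two : (2 : k) = 0 := CharTwo.two_eq_zero
  have h1 : a * a⁻¹ ^ 2 ^ i = e * e⁻¹ ^ 2 ^ i := CharTwo.add_eq_zero.mp hA
  have h2 : b * b⁻¹ ^ 2 ^ i = e * e⁻¹ ^ 2 ^ i := CharTwo.add_eq_zero.mp hB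
  obtain ⟨c, hc⟩ : ∃ c, c = e * e⁻¹ ^ 2 ^ i := ⟨_, rfl⟩
  rw [← hc] at h1 h2
  have ha : a = c * a ^ 2 ^ i := by
    rw [← h1, mul_assoc, ← mul_pow, inv_mul_cancel₀ ha0]; simp
  have hb : b = c * b ^ 2 ^ i := by
    rw [← h2, mul_assoc, ← mul_pow, inv_mul_cancel₀ hb0]; simp
  have he : e = c * e ^ 2 ^ i := by
    rw [hc, mul_assoc, ← mul_pow, inv_mul_cancel₀ he0]; simp
  have hs : (a + b + e) ^ 2 ^ i = a ^ 2 ^ i + b ^ 2 ^ i + e ^ 2 ^ i := by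
    rw [add_pow_char_pow, add_pow_char_pow]
  have hone : a + b + e = 1 := by rw [habe]; linear_combination (a + b) * two
  rw [hone, one_pow] at hs
  have hc1 : c = 1 := by
    linear_combination -ha - hb - he + c * hs + hone
  rw [hc1, one_mul] at ha hb he
  exact ⟨ha.symm, hb.symm, he.symm⟩

/-- key computation : if `h1 = 0` then `κ ≠ 0`, valuation version, `X = t * x1` -/
lemma SP.key_h (H : SP v κ i ℓ a b e t) {z : Ω} (hz : v z ≤ 1)
    (hκ : v (κ (a⁻¹ ^ 2 ^ i) * z ^ (2 ^ i + 1) + κ (b⁻¹ ^ 2 ^ i) +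
      κ (e⁻¹ ^ 2 ^ i) * (z + 1) ^ (2 ^ i + 1)) < 1) :
    v (κ a⁻¹ * z + κ e⁻¹ * (z + 1)) = 1 := by
  have : Fact (Nat.Prime 2) := ⟨Nat.prime_two⟩
  have two : (2 : k) = 0 := CharTwo.two_eq_zero
  have two' : (2 : Ω) = 0 := CharTwo.two_eq_zero
  have hle : v (κ a⁻¹ * z + κ e⁻¹ * (z + 1)) ≤ 1 := by
    refine Valuation.map_add_le _ ?_ ?_
    · exact val_mul_le_right v (H.triv.le_one _) hz
    · exact val_mul_le_right v (H.triv.le_one _) (Valuation.map_add_le _ hz (by simp))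
  refine le_antisymm hle ?_
  by_contra hlt
  rw [not_le] at hlt
  obtain ⟨h, hh⟩ : ∃ h, h = κ a⁻¹ * z + κ e⁻¹ * (z + 1) := ⟨_, rfl⟩
  rw [← hh] at hlt
  obtain ⟨p, hp⟩ : ∃ p, p = κ a⁻¹ * z := ⟨_, rfl⟩
  have ha1 : κ a * κ a⁻¹ = 1 := by rw [← map_mul, mul_inv_cancel₀ H.a0, map_one]
  have hb1 : κ b * κ b⁻¹ = 1 := by rw [← map_mul, mul_inv_cancel₀ H.b0, map_one]
  have he1 : κ e * κ e⁻¹ = 1 := by rw [← map_mul, mul_inv_cancel₀ H.e0, map_one]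
  have habe : κ e = κ a + κ b + 1 := by rw [H.habe]; simp
  have hz1 : z = κ a * p := by rw [hp]; linear_combination -z * ha1
  have hz2 : z + 1 = κ e * (p + h) := by
    rw [hp, hh]; linear_combination -(z + 1) * he1 - κ e * κ a⁻¹ * z * two'
  have h1 : 1 = (κ b + 1) * p + κ e * h := by
    linear_combination hz2 - hz1 + p * habe + (1 - z - 1 + κ a * p) * two' - (1 - z - 1 + κ a * p) * two'
  have hp1 : v p ≤ 1 := by rw [hp]; exact val_mul_le_right v (H.triv.le_one _) hz
  have hκ2 : v (p ^ 2 ^ i + κ b⁻¹ ^ 2 ^ i) < 1 := by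
    have e1 : p ^ 2 ^ i + κ b⁻¹ ^ 2 ^ i = (κ (a⁻¹ ^ 2 ^ i) * z ^ (2 ^ i + 1) + κ (b⁻¹ ^ 2 ^ i) +
      κ (e⁻¹ ^ 2 ^ i) * (z + 1) ^ (2 ^ i + 1)) - (z + 1) * h ^ 2 ^ i := by
      have e2 : κ (e⁻¹ ^ 2 ^ i) * (z + 1) ^ (2 ^ i + 1) = (z + 1) * (p ^ 2 ^ i + h ^ 2 ^ i) := by
        have e3 : κ e⁻¹ * (z + 1) = p + h := by
          rw [hz2]; linear_combination (p + h) * he1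
        rw [map_pow, pow_succ, ← mul_assoc, ← mul_pow, e3, add_pow_char_pow, mul_comm]
      have e4 : κ (a⁻¹ ^ 2 ^ i) * z ^ (2 ^ i + 1) = z * p ^ 2 ^ i := by
        rw [map_pow, pow_succ, ← mul_assoc, ← mul_pow, ← hp, mul_comm]
      rw [e2, e4, map_pow]
      linear_combination -z * p ^ 2 ^ i * two'
    rw [e1]
    refine Valuation.map_sub_lt _ hκ ?_
    rw [map_mul, map_pow]
    calc v (z + 1) * v h ^ 2 ^ i ≤ 1 * v h ^ 2 ^ i := by
          gcongr; exact Valuation.map_add_le _ hz (by simp)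
      _ = v h ^ 2 ^ i := one_mul _
      _ < 1 := pow_lt_one' hlt (by positivity)
  rw [← add_pow_char_pow, map_pow] at hκ2
  have hκ3 : v (p + κ b⁻¹) < 1 := by
    by_contra hc
    rw [not_lt] at hc
    exact absurd hκ2 (not_lt.mpr (one_le_pow_of_one_le' hc _))
  have hfin : v (κ b⁻¹) < 1 := by
    have : κ b⁻¹ = (κ b + 1) * (p + κ b⁻¹) + κ e * h := by
      linear_combination h1 - hb1 - two'
    rw [this]
    refine Valuation.map_add_lt _ ?_ ?_
    · exact val_mul_lt_right v (Valuation.map_add_le _ (H.triv.le_one _) (by simp)) hκ3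
    · exact val_mul_lt_right v (H.triv.le_one _) hlt
  exact inv_ne_zero H.b0 (H.triv.eq_zero hfin)

/-- Type III : derivative -/
lemma SP.typeIII_Fx (H : SP v κ i ℓ a b e t) (hA : cA i a e = 0) (hB : cA i b e = 0) {X : Ω}
    (hX1 : v X < 1) (h0 : Fh (2 ^ i * ℓ + 1) (κ a + X) (κ b + t) = 0) :
    v ((κ a + X) ^ (2 ^ i * ℓ) + (κ a + X + (κ b + t) + 1) ^ (2 ^ i * ℓ)) = v t ^ 2 ^ i := by
  have hr := H.r2
  have hXt := H.typeIII_X_le hA hB hX1 h0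
  have hw : κ a + X + (κ b + t) + 1 = κ e + (X + t) := by
    rw [H.habe]; simp only [map_add, map_one]; ring
  rw [Fx_eq, hw, map_pow]
  congr 1
  obtain ⟨R, hR, h⟩ := Fx_expand H.triv H.hℓ H.ha H.he H.ht1.le hXt
    (Valuation.map_add_le v hXt le_rfl)
  rw [h]
  obtain ⟨z, hz⟩ : ∃ z, z = X / t := ⟨_, rfl⟩
  have hX : X = z * t := by rw [hz, div_mul_cancel₀ _ H.ht0]
  have hvz : v z ≤ 1 := by
    rw [hz, map_div₀]
    exact div_le_one_of_le₀ hXt zero_le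
  have hkey := H.key_h hvz (by
    obtain ⟨R', hR', h'⟩ := H.expand2 H.ht1.le hXt le_rfl
    rw [h0, hA, hB, map_zero] at h'
    obtain ⟨Q, hQ⟩ : ∃ Q, Q = κ (a⁻¹ ^ 2 ^ i) * z ^ (2 ^ i + 1) + κ (b⁻¹ ^ 2 ^ i) +
      κ (e⁻¹ ^ 2 ^ i) * (z + 1) ^ (2 ^ i + 1) := ⟨_, rfl⟩
    rw [← hQ]
    have e1 : Q * t ^ (2 ^ i + 1) = - R' := by
      have e2 : X + t = (z + 1) * t := by rw [hX]; ring
      rw [e2, hX] at h'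
      rw [hQ]
      simp only [mul_pow] at h'
      linear_combination -h'
    by_contra hc
    rw [not_lt] at hc
    have e3 := congrArg v e1
    rw [Valuation.map_neg, map_mul, map_pow] at e3
    have : v t ^ (2 ^ i + 1) ≤ v t ^ (2 * 2 ^ i) := by
      calc v t ^ (2 ^ i + 1) = 1 * v t ^ (2 ^ i + 1) := (one_mul _).symm
        _ ≤ v Q * v t ^ (2 ^ i + 1) := by gcongr
        _ ≤ _ := by rw [e3]; exact hR'
    rw [val_pow_anti H.vt0 H.ht1] at this
    omega)
  have e1 : κ a⁻¹ * X + κ e⁻¹ * (X + t) = (κ a⁻¹ * z + κ e⁻¹ * (z + 1)) * t := by rw [hX]; ring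
  rw [e1, val_add_eq, map_mul, hkey, one_mul]
  rw [map_mul, hkey, one_mul]
  refine lt_of_le_of_lt hR ?_
  conv_rhs => rw [← pow_one (v t)]
  exact (val_pow_anti_lt H.vt0 H.ht1).mpr (by omega)
end Loc3


section Loc4
variable {k Ω Γ : Type*} [Field k] [Field Ω] [CharP k 2] [CharP Ω 2]
  [LinearOrderedCommGroupWithZero Γ]
variable {v : Valuation Ω Γ} {κ : k →+* Ω} {i ℓ : ℕ} {a b e : k} {t : Ω}

lemma SP.hw (H : SP v κ i ℓ a b e t) (X : Ω) : κ a + X + (κ b + t) + 1 = κ e + (X + t) := by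
  rw [H.habe]; simp only [map_add, map_one]; ring

/-- Type III : differences of roots -/
lemma SP.typeIII_diff (H : SP v κ i ℓ a b e t) (hA : cA i a e = 0) (hB : cA i b e = 0) {X X' : Ω}
    (hX1 : v X < 1) (h0 : Fh (2 ^ i * ℓ + 1) (κ a + X) (κ b + t) = 0)
    (hX1' : v X' < 1) (h0' : Fh (2 ^ i * ℓ + 1) (κ a + X') (κ b + t) = 0) (hne : X ≠ X') :
    v (X - X') = v t := by
  have : Fact (Nat.Prime 2) := ⟨Nat.prime_two⟩
  have two' : (2 : Ω) = 0 := CharTwo.two_eq_zero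
  have hr := H.r2
  have hXt := H.typeIII_X_le hA hB hX1 h0
  have hXt' := H.typeIII_X_le hA hB hX1' h0'
  have hFx := H.typeIII_Fx hA hB hX1 h0
  have hWt : v (X + t) ≤ v t := Valuation.map_add_le v hXt le_rfl
  have hWt' : v (X' + t) ≤ v t := Valuation.map_add_le v hXt' le_rfl
  rw [H.hw, Fx_eq] at hFx
  rw [Fh_eq, H.hw] at h0 h0'
  obtain ⟨c1, hc1, h1⟩ := gdiff H.triv H.hℓ H.ha H.ht1.le (x := κ a + X) (x' := κ a + X')
    (by simpa using hXt) (by simpa using hXt')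
  obtain ⟨c2, hc2, h2⟩ := gdiff H.triv H.hℓ H.he H.ht1.le (x := κ e + (X + t))
    (x' := κ e + (X' + t)) (by simpa using hWt) (by simpa using hWt')
  obtain ⟨p, hp⟩ : ∃ p, p = (κ a + X) ^ ℓ - 1 := ⟨_, rfl⟩
  obtain ⟨p', hp'⟩ : ∃ p, p = (κ a + X') ^ ℓ - 1 := ⟨_, rfl⟩
  obtain ⟨s, hs⟩ : ∃ p, p = (κ e + (X + t)) ^ ℓ - 1 := ⟨_, rfl⟩
  obtain ⟨s', hs'⟩ : ∃ p, p = (κ e + (X' + t)) ^ ℓ - 1 := ⟨_, rfl⟩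
  rw [← hp, ← hs] at hFx h0
  rw [← hp', ← hs'] at h0'
  have h1' : p - p' = (X - X') * (κ a⁻¹ + c1) := by rw [hp, hp']; linear_combination h1
  have h2' : s - s' = (X - X') * (κ e⁻¹ + c2) := by rw [hs, hs']; linear_combination h2
  obtain ⟨K, hK⟩ : ∃ K, K = (κ a + X') * (κ a⁻¹ + c1) ^ 2 ^ i +
    (κ e + (X' + t)) * (κ e⁻¹ + c2) ^ 2 ^ i := ⟨_, rfl⟩
  have hvK : v K ≤ v t := by
    have hle : ∀ (c : k) (z : Ω), v z ≤ v t → v (κ c + z) ≤ 1 := fun c z hz =>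
      Valuation.map_add_le _ (H.triv.le_one c) (hz.trans H.ht1.le)
    have e1 : v ((κ a + X') * (κ a⁻¹ + c1) ^ 2 ^ i - κ a * κ a⁻¹ ^ 2 ^ i) ≤ v t := by
      refine val_approx_mul v (hle _ _ hXt') ?_ (by simpa using hXt') ?_
      · rw [map_pow]; exact pow_le_one' (H.triv.le_one _) _
      · exact val_approx_pow v (hle _ _ hc1) (H.triv.le_one _) (by simpa using hc1) _
    have e2 : v ((κ e + (X' + t)) * (κ e⁻¹ + c2) ^ 2 ^ i - κ e * κ e⁻¹ ^ 2 ^ i) ≤ v t := by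
      refine val_approx_mul v (hle _ _ hWt') ?_ (by simpa using hWt') ?_
      · rw [map_pow]; exact pow_le_one' (H.triv.le_one _) _
      · exact val_approx_pow v (hle _ _ hc2) (H.triv.le_one _) (by simpa using hc2) _
    have := Valuation.map_add_le _ e1 e2
    have e3 : κ a * κ a⁻¹ ^ 2 ^ i + κ e * κ e⁻¹ ^ 2 ^ i = 0 := by
      have := congrArg κ hA
      simpa [cA] using this
    convert this using 2
    rw [hK]; linear_combination e3
  have hmain : (X - X') * (p + s) ^ 2 ^ i + (X - X') ^ 2 ^ i * K = 0 := by
    have f1 : (p - p') ^ 2 ^ i = p ^ 2 ^ i - p' ^ 2 ^ i := by rw [sub_pow_char_pow]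
    have f2 : (s - s') ^ 2 ^ i = s ^ 2 ^ i - s' ^ 2 ^ i := by rw [sub_pow_char_pow]
    rw [h1', mul_pow] at f1
    rw [h2', mul_pow] at f2
    rw [add_pow_char_pow, hK]
    linear_combination (κ a + X') * f1 + (κ e + (X' + t)) * f2 + h0 - h0'
  have hΔ0 : v (X - X') ≠ 0 := by rw [Valuation.ne_zero_iff]; exact sub_ne_zero.mpr hne
  refine le_antisymm (Valuation.map_sub_le v hXt hXt') ?_
  have g1 : (X - X') * (p + s) ^ 2 ^ i = - ((X - X') ^ 2 ^ i * K) := by linear_combination hmain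
  have g2 := congrArg v g1
  rw [Valuation.map_neg, map_mul, hFx, map_mul, map_pow] at g2
  have e2 : ∀ z : Γ, z ^ 2 ^ i = z * z ^ (2 ^ i - 1) := by
    intro z; rw [← pow_succ', Nat.sub_add_cancel (by omega)]
  have g3 : (v (X - X') * v t) * v t ^ (2 ^ i - 1) ≤ (v (X - X') * v t) * v (X - X') ^ (2 ^ i - 1) := by
    rw [mul_assoc, ← e2, g2, e2 (v (X - X')), mul_assoc, mul_assoc, mul_comm (v t)]
    gcongr
  have g4 := le_of_mul_le_mul_left g3 (zero_lt_iff.mpr (mul_ne_zero hΔ0 H.vt0))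
  rwa [val_pow_le_iff (by omega)] at g4

/-- the coefficient `κ` -/
def cK (i : ℕ) (a b e μ : k) : k :=
  a⁻¹ ^ 2 ^ i * μ ^ (2 ^ i + 1) + b⁻¹ ^ 2 ^ i + e⁻¹ ^ 2 ^ i * (μ + 1) ^ (2 ^ i + 1)

/-- the coefficient `h` -/
def cH (a e μ : k) : k := a⁻¹ * μ + e⁻¹ * (μ + 1)

lemma SP.cH_ne (H : SP v κ i ℓ a b e t) {μ : k} (hK : cK i a b e μ = 0) : cH a e μ ≠ 0 := by
  intro h
  have h1 := H.key_h (z := κ μ) (H.triv.le_one _) (by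
    have := congrArg κ hK
    simp only [cK, map_add, map_mul, map_pow, map_one, map_zero] at this ⊢
    rw [this]; simp)
  have := congrArg κ h
  simp only [cH, map_add, map_mul, map_one, map_zero] at this
  rw [this] at h1
  simp at h1

lemma SP.iii_expand (H : SP v κ i ℓ a b e t) (hA : cA i a e ≠ 0) {μ : k}
    (hμ : cA i a e * μ ^ 2 ^ i = cA i b e) {L : Ω} (hL : v L ≤ v t) :
    ∃ A' R, v A' = 1 ∧ v R ≤ v t ^ (2 * 2 ^ i) ∧
      Fh (2 ^ i * ℓ + 1) (κ a + (κ μ * t + L)) (κ b + t) = A' * L ^ 2 ^ i +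
        κ (cK i a b e μ) * t ^ (2 ^ i + 1) + κ (cH a e μ) ^ 2 ^ i * (L * t ^ 2 ^ i) + R := by
  have : Fact (Nat.Prime 2) := ⟨Nat.prime_two⟩
  have two' : (2 : Ω) = 0 := CharTwo.two_eq_zero
  have hX : v (κ μ * t + L) ≤ v t :=
    Valuation.map_add_le _ (val_mul_le_right v (H.triv.le_one _) le_rfl) hL
  obtain ⟨R, hR, h⟩ := H.expand2 H.ht1.le hX le_rfl
  obtain ⟨X, hXd⟩ : ∃ X, X = κ μ * t + L := ⟨_, rfl⟩
  rw [← hXd] at hX h ⊢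
  refine ⟨κ (cA i a e) + (κ (a⁻¹ ^ 2 ^ i) * X + κ (e⁻¹ ^ 2 ^ i) * (X + t)), R, ?_, hR, ?_⟩
  · rw [val_add_eq, H.triv _ hA]
    rw [H.triv _ hA]
    refine lt_of_le_of_lt (Valuation.map_add_le _ ?_ ?_) H.ht1
    · exact val_mul_le_right v (H.triv.le_one _) hX
    · exact val_mul_le_right v (H.triv.le_one _) (Valuation.map_add_le _ hX le_rfl)
  · rw [h]
    have e1 : X ^ 2 ^ i = κ μ ^ 2 ^ i * t ^ 2 ^ i + L ^ 2 ^ i := by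
      rw [hXd, add_pow_char_pow, mul_pow]
    have e2 : (X + t) ^ 2 ^ i = (κ μ + 1) ^ 2 ^ i * t ^ 2 ^ i + L ^ 2 ^ i := by
      rw [add_pow_char_pow, e1, add_pow_char_pow, one_pow]; ring
    have e3 : κ (cA i b e) = κ (cA i a e) * κ μ ^ 2 ^ i := by rw [← hμ]; simp
    have e4 : κ (cH a e μ) ^ 2 ^ i = κ a⁻¹ ^ 2 ^ i * κ μ ^ 2 ^ i +
        κ e⁻¹ ^ 2 ^ i * (κ μ + 1) ^ 2 ^ i := by
      simp only [cH, map_add, map_mul, map_one]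
      rw [add_pow_char_pow, mul_pow, mul_pow]
    have e5 : κ (cK i a b e μ) = κ a⁻¹ ^ 2 ^ i * (κ μ ^ 2 ^ i * κ μ) + κ b⁻¹ ^ 2 ^ i +
        κ e⁻¹ ^ 2 ^ i * ((κ μ + 1) ^ 2 ^ i * (κ μ + 1)) := by
      simp only [cK, map_add, map_mul, map_pow, map_one, pow_succ]
    rw [e3, e4, e5, pow_succ X, pow_succ (X + t), e1, e2, pow_succ t, map_pow, map_pow, map_pow,
      hXd]
    linear_combination κ (cA i a e) * κ μ ^ 2 ^ i * t ^ 2 ^ i * two'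

lemma SP.iii_L (H : SP v κ i ℓ a b e t) (hA : cA i a e ≠ 0) {μ : k}
    (hμ : cA i a e * μ ^ 2 ^ i = cA i b e) {X : Ω} (hX1 : v X < 1)
    (h0 : Fh (2 ^ i * ℓ + 1) (κ a + X) (κ b + t) = 0) : v (X - κ μ * t) < v t := by
  have : Fact (Nat.Prime 2) := ⟨Nat.prime_two⟩
  have two' : (2 : Ω) = 0 := CharTwo.two_eq_zero
  have hr := H.r2
  have hXt := H.X_le hA hX1 h0
  obtain ⟨R, hR, h⟩ := H.expand1 H.ht1.le hXt le_rfl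
  rw [h0] at h
  have e3 : κ (cA i b e) = κ (cA i a e) * κ μ ^ 2 ^ i := by rw [← hμ]; simp
  have e1 : κ (cA i a e) * (X - κ μ * t) ^ 2 ^ i = -R := by
    rw [sub_pow_char_pow, mul_pow]
    rw [e3] at h
    linear_combination -h - κ (cA i a e) * κ μ ^ 2 ^ i * t ^ 2 ^ i * two'
  have e2 := congrArg v e1
  rw [map_mul, H.triv _ hA, one_mul, Valuation.map_neg, map_pow] at e2
  by_contra hc
  rw [not_lt] at hc
  have h3 := (pow_le_pow_left' hc (2 ^ i)).trans (e2.le.trans hR)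
  rw [val_pow_anti H.vt0 H.ht1] at h3
  omega

/-- type II (iii), `κ ≠ 0` -/
lemma SP.iii_K (H : SP v κ i ℓ a b e t) (hA : cA i a e ≠ 0) {μ : k}
    (hμ : cA i a e * μ ^ 2 ^ i = cA i b e) (hK : cK i a b e μ ≠ 0) {X : Ω} (hX1 : v X < 1)
    (h0 : Fh (2 ^ i * ℓ + 1) (κ a + X) (κ b + t) = 0) :
    v (X - κ μ * t) ^ 2 ^ i = v t ^ (2 ^ i + 1) := by
  have hr := H.r2
  have hL := H.iii_L hA hμ hX1 h0
  obtain ⟨A', R, hA', hR, h⟩ := H.iii_expand hA hμ hL.le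
  have e1 : κ μ * t + (X - κ μ * t) = X := by ring
  rw [e1, h0, add_assoc] at h
  have hv : v (κ (cK i a b e μ) * t ^ (2 ^ i + 1)) = v t ^ (2 ^ i + 1) := by
    rw [map_mul, H.triv _ hK, one_mul, map_pow]
  have h2 := val_dom2 v h.symm (Or.inr ?_)
  · rwa [map_mul, hA', one_mul, map_pow, hv] at h2
  · rw [hv]
    refine Valuation.map_add_lt _ ?_ ?_
    · rw [← map_pow]
      refine val_mul_lt_right v (H.triv.le_one _) ?_
      rw [map_mul, map_pow, pow_succ, mul_comm]
      exact mul_lt_mul_of_pos_left hL (pow_pos (zero_lt_iff.mpr H.vt0) _)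
    · exact lt_of_le_of_lt hR ((val_pow_anti_lt H.vt0 H.ht1).mpr (by omega))

lemma SP.iii_K_val (H : SP v κ i ℓ a b e t) (hA : cA i a e ≠ 0) {μ : k}
    (hμ : cA i a e * μ ^ 2 ^ i = cA i b e) (hK : cK i a b e μ ≠ 0) :
    v (Fh (2 ^ i * ℓ + 1) (κ a + κ μ * t) (κ b + t)) = v t ^ (2 ^ i + 1) := by
  have hr := H.r2
  obtain ⟨A', R, hA', hR, h⟩ := H.iii_expand hA hμ (L := 0) (by simp)
  rw [zero_pow (by omega), add_zero, zero_mul, mul_zero, mul_zero, zero_add, add_zero] at h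
  have hv : v (κ (cK i a b e μ) * t ^ (2 ^ i + 1)) = v t ^ (2 ^ i + 1) := by
    rw [map_mul, H.triv _ hK, one_mul, map_pow]
  rw [h, val_add_eq, hv]
  rw [hv]
  exact lt_of_le_of_lt hR ((val_pow_anti_lt H.vt0 H.ht1).mpr (by omega))

/-- type II (iii), `κ = 0`, dichotomy -/
lemma SP.iii_AB (H : SP v κ i ℓ a b e t) (hA : cA i a e ≠ 0) {μ : k}
    (hμ : cA i a e * μ ^ 2 ^ i = cA i b e) (hK : cK i a b e μ = 0) {X : Ω} (hX1 : v X < 1)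
    (h0 : Fh (2 ^ i * ℓ + 1) (κ a + X) (κ b + t) = 0) :
    v (X - κ μ * t) ≤ v t ^ 2 ^ i ∨
      (v t ^ 2 ^ i < v (X - κ μ * t) ∧ v (X - κ μ * t) ^ (2 ^ i - 1) = v t ^ 2 ^ i) := by
  have hr := H.r2
  have hL := H.iii_L hA hμ hX1 h0
  rcases le_or_gt (v (X - κ μ * t)) (v t ^ 2 ^ i) with hle | hlt
  · exact Or.inl hle
  · refine Or.inr ⟨hlt, ?_⟩
    obtain ⟨A', R, hA', hR, h⟩ := H.iii_expand hA hμ hL.le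
    have e1 : κ μ * t + (X - κ μ * t) = X := by ring
    rw [e1, h0, hK, map_zero, zero_mul, add_zero] at h
    have hv : v (κ (cH a e μ) ^ 2 ^ i * ((X - κ μ * t) * t ^ 2 ^ i)) =
        v (X - κ μ * t) * v t ^ 2 ^ i := by
      rw [map_mul, map_pow, H.triv _ (H.cH_ne hK), one_pow, one_mul, map_mul, map_pow]
    have h2 := val_dom2 v h.symm (Or.inr ?_)
    · rw [map_mul, hA', one_mul, map_pow, hv] at h2
      have e2 : ∀ z : Γ, z ^ 2 ^ i = z * z ^ (2 ^ i - 1) := by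
        intro z; rw [← pow_succ', Nat.sub_add_cancel (by omega)]
      rw [e2 (v (X - κ μ * t))] at h2
      exact mul_left_cancel₀ (lt_of_le_of_lt zero_le hlt).ne' h2
    · rw [hv]
      refine lt_of_le_of_lt hR ?_
      rw [two_mul, pow_add]
      exact mul_lt_mul_of_pos_right hlt (pow_pos (zero_lt_iff.mpr H.vt0) _)

lemma SP.iii_Fx (H : SP v κ i ℓ a b e t) (hA : cA i a e ≠ 0) {μ : k}
    (hμ : cA i a e * μ ^ 2 ^ i = cA i b e) (hK : cK i a b e μ = 0) {X : Ω} (hX1 : v X < 1)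
    (h0 : Fh (2 ^ i * ℓ + 1) (κ a + X) (κ b + t) = 0) :
    v ((κ a + X) ^ (2 ^ i * ℓ) + (κ a + X + (κ b + t) + 1) ^ (2 ^ i * ℓ)) = v t ^ 2 ^ i := by
  have hr := H.r2
  have hL := H.iii_L hA hμ hX1 h0
  have hXt := H.X_le hA hX1 h0
  rw [Fx_eq, H.hw, map_pow]
  congr 1
  obtain ⟨R, hR, h⟩ := Fx_expand H.triv H.hℓ H.ha H.he H.ht1.le hXt
    (Valuation.map_add_le v hXt le_rfl)
  have e1 : κ a⁻¹ * X + κ e⁻¹ * (X + t) + R = κ (cH a e μ) * t +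
      ((κ a⁻¹ + κ e⁻¹) * (X - κ μ * t) + R) := by
    simp only [cH, map_add, map_mul, map_one]; ring
  have hv : v (κ (cH a e μ) * t) = v t := by rw [map_mul, H.triv _ (H.cH_ne hK), one_mul]
  rw [h, e1, val_add_eq, hv]
  rw [hv]
  refine Valuation.map_add_lt _ ?_ ?_
  · refine val_mul_lt_right v ?_ hL
    exact Valuation.map_add_le _ (H.triv.le_one _) (H.triv.le_one _)
  · refine lt_of_le_of_lt hR ?_
    conv_rhs => rw [← pow_one (v t)]
    exact (val_pow_anti_lt H.vt0 H.ht1).mpr (by omega)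

lemma cK_ne_r2 (ha0 : a ≠ 0) (hb0 : b ≠ 0) (he0 : e ≠ 0) (habe : e = a + b + 1) {μ : k}
    (hμ : cA 1 a e * μ ^ 2 ^ 1 = cA 1 b e) (ha1 : a ≠ 1) (hab : a ≠ b) : cK 1 a b e μ ≠ 0 := by
  intro hK
  have two : (2 : k) = 0 := CharTwo.two_eq_zero
  simp only [cA, cK, pow_one] at hμ hK
  obtain ⟨α, hα⟩ : ∃ α, α = a⁻¹ := ⟨_, rfl⟩
  obtain ⟨β, hβ⟩ : ∃ β, β = b⁻¹ := ⟨_, rfl⟩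
  obtain ⟨ε, hε⟩ : ∃ ε, ε = e⁻¹ := ⟨_, rfl⟩
  rw [← hα, ← hε, ← hβ] at hμ hK
  have a1 : a * α = 1 := by rw [hα]; exact mul_inv_cancel₀ ha0
  have b1 : b * β = 1 := by rw [hβ]; exact mul_inv_cancel₀ hb0
  have e1 : e * ε = 1 := by rw [hε]; exact mul_inv_cancel₀ he0
  obtain ⟨p, hp⟩ : ∃ p, p = α * μ := ⟨_, rfl⟩
  obtain ⟨s, hs⟩ : ∃ s, s = ε * (μ + 1) := ⟨_, rfl⟩
  have hap : a * p = μ := by rw [hp]; linear_combination μ * a1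
  have hes : e * s = μ + 1 := by rw [hs]; linear_combination (μ + 1) * e1
  have E1 : a * p + b * β + e * s = 0 := by rw [hap, hes, b1]; linear_combination (μ + 1) * two
  have E2 : a * p ^ 2 + b * β ^ 2 + e * s ^ 2 = 0 := by
    have hμ' : α * μ ^ 2 + ε * μ ^ 2 + β + ε = 0 := by
      linear_combination hμ + (β * b1) + (ε * e1) - (α * μ^2 * a1) - (ε * μ^2 * e1) + two * (β + ε)
    calc a * p ^ 2 + b * β ^ 2 + e * s ^ 2 = (a * p) * p + (b * β) * β + (e * s) * s := by ring
      _ = μ * (α * μ) + β + (μ + 1) * (ε * (μ + 1)) := by rw [hap, hes, b1, ← hp, ← hs]; ring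
      _ = 0 := by linear_combination hμ' + ε * μ * two
  have E3 : a * p ^ 3 + b * β ^ 3 + e * s ^ 3 = 0 := by
    calc a * p ^ 3 + b * β ^ 3 + e * s ^ 3
        = (a * p) * p ^ 2 + (b * β) * β ^ 2 + (e * s) * s ^ 2 := by ring
      _ = 0 := by rw [hap, hes, b1, hp, hs]; linear_combination hK
  have hβ0 : β ≠ 0 := by rw [hβ]; exact inv_ne_zero hb0
  have P1 : b * β * ((β - p) * (β - s)) = 0 := by
    linear_combination E3 - (p + s) * E2 + p * s * E1
  rw [b1, one_mul, mul_eq_zero] at P1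
  rcases P1 with h | h
  · have hpβ : p = β := (sub_eq_zero.mp h).symm
    have P2 : e * (s * (s - β)) = 0 := by
      have := E2
      rw [hpβ] at this E1
      linear_combination this - β * E1
    rw [mul_eq_zero, mul_eq_zero] at P2
    rcases P2 with h2 | h2 | h2
    · exact he0 h2
    · rw [h2, mul_zero] at hes
      have hμ1 : μ = 1 := (CharTwo.add_eq_zero.mp hes.symm)
      rw [hμ1, mul_one] at hp
      apply hab
      have : α = β := by rw [← hp, hpβ]
      rw [hα, hβ] at this
      exact inv_injective this
    · have hsβ : s = β := sub_eq_zero.mp h2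
      rw [hpβ, hsβ] at E1
      apply hβ0
      rw [habe] at E1
      linear_combination E1 - (a + b) * β * two
  · have hsβ : s = β := (sub_eq_zero.mp h).symm
    have P2 : a * (p * (p - β)) = 0 := by
      have := E2
      rw [hsβ] at this E1
      linear_combination this - β * E1
    rw [mul_eq_zero, mul_eq_zero] at P2
    rcases P2 with h2 | h2 | h2
    · exact ha0 h2
    · rw [h2, mul_zero] at hap
      rw [← hap, zero_add, mul_one] at hs
      apply ha1
      have : ε = β := by rw [← hs, hsβ]
      rw [hε, hβ] at this
      have := inv_injective this
      rw [habe] at this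
      have : a + 1 = 0 := by linear_combination this
      exact CharTwo.add_eq_zero.mp this
    · have hpβ : p = β := sub_eq_zero.mp h2
      rw [hpβ, hsβ] at E1
      apply hβ0
      rw [habe] at E1
      linear_combination E1 - (a + b) * β * two
end Loc4


section Loc5
variable {k Ω Γ β : Type*} [Field k] [Field Ω] [CharP k 2] [CharP Ω 2]
  [LinearOrderedCommGroupWithZero Γ] [DecidableEq Ω] [DecidableEq β] [DecidableEq k]

/-- local system of roots at a finite place -/
structure LS (v : Valuation Ω Γ) (κ : k →+* Ω) (i ℓ : ℕ) (b : k) (t : Ω)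
    (S1 S : Finset Ω) (comp : Ω → β) (w : Ω → Ω → ℕ) : Prop where
  triv : TrivOn v κ
  hi : 1 ≤ i
  hℓ : Odd ℓ
  ht0 : t ≠ 0
  ht1 : v t < 1
  hroot : ∀ ρ ∈ S1, Fh (2 ^ i * ℓ + 1) ρ (κ b + t) = 0
  hsub : S ⊆ S1
  h1 : (1 : Ω) ∈ S1
  hy : κ b + t ∈ S1
  h1' : (1 : Ω) ∉ S
  hy' : κ b + t ∉ S
  hintg : ∀ ρ ∈ S1, v ρ ≤ 1
  hprod : ∀ c : Ω, (κ b + t + 1) * ∏ ρ ∈ S1, (c - ρ) = Fh (2 ^ i * ℓ + 1) c (κ b + t)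
  hder : ∀ ρ ∈ S1, (κ b + t + 1) * ∏ ρ' ∈ S1.erase ρ, (ρ - ρ') =
    ρ ^ (2 ^ i * ℓ) + (ρ + (κ b + t) + 1) ^ (2 ^ i * ℓ)
  hcent : ∀ u a μ, (∃ n : ℕ, ∏ ρ ∈ S with comp ρ = u, v (κ a + κ μ * t - ρ) = v t ^ n) ∨
    ∏ ρ ∈ S with comp ρ = u, v (κ a + κ μ * t - ρ) = 0
  hw0 : ∀ ρ ∈ S, ∀ ρ' ∈ S, comp ρ = comp ρ' → w ρ ρ' = 0
  hw2 : ∀ ρ ρ', w ρ ρ' ≤ 2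
  hws : ∀ N ⊆ S, ∑ ρ ∈ N, ∑ ρ' ∈ N, w ρ ρ' ≤ N.card ^ 2

variable {v : Valuation Ω Γ} {κ : k →+* Ω} {i ℓ : ℕ} {b : k} {t : Ω}
    {S1 S : Finset Ω} {comp : Ω → β} {w : Ω → Ω → ℕ}

lemma LS.vt0 (H : LS v κ i ℓ b t S1 S comp w) : v t ≠ 0 := by simpa using H.ht0

lemma LS.r2 (H : LS v κ i ℓ b t S1 S comp w) : 2 ≤ 2 ^ i := by
  calc 2 = 2 ^ 1 := rfl
    _ ≤ 2 ^ i := Nat.pow_le_pow_right (by norm_num) H.hi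

lemma LS.vy1 (H : LS v κ i ℓ b t S1 S comp w) : v (κ b + t + 1) = if b = 1 then v t else 1 := by
  split_ifs with hb
  · congr 1
    rw [hb, map_one]
    linear_combination (CharTwo.two_eq_zero : (2 : Ω) = 0)
  · have e1 : κ b + t + 1 = κ (b + 1) + t := by rw [map_add, map_one]; ring
    have hb1 : b + 1 ≠ 0 := fun h => hb (CharTwo.add_eq_zero.mp h)
    rw [e1, val_add_eq, H.triv _ hb1]
    rw [H.triv _ hb1]; exact H.ht1

lemma LS.vy1_le (H : LS v κ i ℓ b t S1 S comp w) : v (κ b + t + 1) ≤ 1 := by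
  rw [H.vy1]; split_ifs
  · exact H.ht1.le
  · exact le_rfl

/-- far factors are units -/
lemma LS.far (H : LS v κ i ℓ b t S1 S comp w) {a : k} {c ρ : Ω} (hc : v (c - κ a) < 1)
    (hρ : ρ ∈ S1) (hf : ¬ v (ρ - κ a) < 1) : v (c - ρ) = 1 := by
  have h1 : v (ρ - κ a) = 1 :=
    le_antisymm (Valuation.map_sub_le v (H.hintg ρ hρ) (H.triv.le_one a)) (not_lt.mp hf)
  have : c - ρ = -(ρ - κ a) + (c - κ a) := by ring
  rw [this, val_add_eq, Valuation.map_neg, h1]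
  rwa [Valuation.map_neg, h1]

lemma LS.near_prod (H : LS v κ i ℓ b t S1 S comp w) {a : k} {c : Ω} (hc : v (c - κ a) < 1)
    {Q : Finset Ω} (hQ : Q ⊆ S1) :
    ∏ ρ ∈ Q with v (ρ - κ a) < 1, v (c - ρ) = ∏ ρ ∈ Q, v (c - ρ) := by
  rw [Finset.prod_filter]
  refine Finset.prod_congr rfl fun ρ hρ => ?_
  split_ifs with h
  · rfl
  · exact (H.far hc (hQ hρ) h).symm

lemma LS.near_le (H : LS v κ i ℓ b t S1 S comp w) {a : k} {c ρ : Ω} (hc : v (c - κ a) < 1)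
    (hρ : v (ρ - κ a) < 1) : v (c - ρ) < 1 := by
  have : c - ρ = (c - κ a) - (ρ - κ a) := by ring
  rw [this]
  exact Valuation.map_sub_lt _ hc hρ

lemma LS.all_le (H : LS v κ i ℓ b t S1 S comp w) {a : k} {c ρ : Ω} (hc : v (c - κ a) < 1)
    (hρ : ρ ∈ S1) : v (c - ρ) ≤ 1 := by
  by_cases h : v (ρ - κ a) < 1
  · exact (H.near_le hc h).le
  · exact (H.far hc hρ h).le

lemma LS.prod_val (H : LS v κ i ℓ b t S1 S comp w) (c : Ω) :
    v (κ b + t + 1) * ∏ ρ ∈ S1, v (c - ρ) = v (Fh (2 ^ i * ℓ + 1) c (κ b + t)) := by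
  rw [← H.hprod, map_mul, map_prod]

lemma LS.der_val (H : LS v κ i ℓ b t S1 S comp w) {a : k} {ρ : Ω} (hρ : ρ ∈ S1)
    (hn : v (ρ - κ a) < 1) :
    v (κ b + t + 1) * ∏ ρ' ∈ (S1.filter (fun ρ => v (ρ - κ a) < 1)).erase ρ, v (ρ - ρ') =
    v (ρ ^ (2 ^ i * ℓ) + (ρ + (κ b + t) + 1) ^ (2 ^ i * ℓ)) := by
  rw [← H.hder ρ hρ, map_mul, map_prod, ← H.near_prod hn (Finset.erase_subset ρ S1),
    Finset.filter_erase]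

/-- center of the form a + μ t is near a -/
lemma LS.cent_near (H : LS v κ i ℓ b t S1 S comp w) (a μ : k) : v (κ a + κ μ * t - κ a) < 1 := by
  rw [add_sub_cancel_left]
  exact val_mul_lt_right v (H.triv.le_one _) H.ht1

/-- single component criterion -/
lemma LS.single (H : LS v κ i ℓ b t S1 S comp w) (a μ : k) (n : ℕ)
    (h1 : ∀ ρ ∈ S, v (ρ - κ a) < 1 →
      ∏ ρ' ∈ S with comp ρ' = comp ρ, v (κ a + κ μ * t - ρ') ≤ v t ^ n)
    (h2 : v (κ b + t + 1) * v t ^ (2 * n) < v (Fh (2 ^ i * ℓ + 1) (κ a + κ μ * t) (κ b + t)))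
    {ρ ρ' : Ω} (hρ : ρ ∈ S) (hn : v (ρ - κ a) < 1) (hρ' : ρ' ∈ S) (hn' : v (ρ' - κ a) < 1) :
    comp ρ = comp ρ' := by
  by_contra hne
  have hc := H.cent_near a μ
  refine absurd h2 (not_lt.mpr ?_)
  rw [← H.prod_val]
  refine mul_le_mul' le_rfl ?_
  have hd : Disjoint (S.filter (fun x => comp x = comp ρ)) (S.filter (fun x => comp x = comp ρ')) := by
    rw [Finset.disjoint_filter]
    intro x _ hx hx'
    exact hne (hx.symm.trans hx')
  have hsub : (S.filter (fun x => comp x = comp ρ)) ∪ (S.filter (fun x => comp x = comp ρ')) ⊆ S1 :=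
    Finset.union_subset ((Finset.filter_subset _ _).trans H.hsub)
      ((Finset.filter_subset _ _).trans H.hsub)
  rw [← Finset.prod_sdiff hsub, Finset.prod_union hd, two_mul, pow_add]
  calc _ ≤ 1 * (v t ^ n * v t ^ n) := by
        refine mul_le_mul' ?_ (mul_le_mul' (h1 ρ hρ hn) (h1 ρ' hρ' hn'))
        refine Finset.prod_le_one' fun x hx => ?_
        exact H.all_le hc (Finset.mem_sdiff.mp hx).1
    _ = _ := one_mul _

/-- product over a component is `< 1` if there is a near root -/
lemma LS.comp_lt (H : LS v κ i ℓ b t S1 S comp w) (a μ : k) {ρ : Ω} (hρ : ρ ∈ S)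
    (hn : v (ρ - κ a) < 1) :
    ∏ ρ' ∈ S with comp ρ' = comp ρ, v (κ a + κ μ * t - ρ') < 1 := by
  have hc := H.cent_near a μ
  have hm : ρ ∈ S.filter (fun x => comp x = comp ρ) := by simp [hρ]
  rw [← Finset.mul_prod_erase _ _ hm]
  calc _ ≤ v (κ a + κ μ * t - ρ) * 1 := by
        refine mul_le_mul' le_rfl (Finset.prod_le_one' fun x hx => ?_)
        exact H.all_le hc (H.hsub (Finset.mem_filter.mp (Finset.mem_of_mem_erase hx)).1)
    _ < 1 := by rw [mul_one]; exact H.near_le hc hn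

lemma LS.comp_le1 (H : LS v κ i ℓ b t S1 S comp w) (a μ : k) {ρ : Ω} (hρ : ρ ∈ S)
    (hn : v (ρ - κ a) < 1) :
    ∏ ρ' ∈ S with comp ρ' = comp ρ, v (κ a + κ μ * t - ρ') ≤ v t ^ 1 := by
  have := H.comp_lt a μ hρ hn
  rcases H.hcent (comp ρ) a μ with ⟨n, hn⟩ | h
  · rw [hn] at this ⊢
    rw [← pow_zero (v t), val_pow_anti_lt H.vt0 H.ht1] at this
    rw [val_pow_anti H.vt0 H.ht1]
    omega
  · rw [h]; exact zero_le

/-- product over a component when all near roots have the same fractional distance to center -/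
lemma LS.comp_card (H : LS v κ i ℓ b t S1 S comp w) (a μ : k) (u : β) {m n : ℕ} (hm : m ≠ 0)
    (hall : ∀ ρ ∈ S, comp ρ = u → v (ρ - κ a) < 1 → v (κ a + κ μ * t - ρ) ^ m = v t ^ n) :
    ∃ s : ℕ, ∏ ρ' ∈ S with comp ρ' = u, v (κ a + κ μ * t - ρ') = v t ^ s ∧
      n * ((S.filter (fun ρ => comp ρ = u)).filter (fun ρ => v (ρ - κ a) < 1)).card = s * m := by
  have hc := H.cent_near a μ
  have hsub : S.filter (fun ρ => comp ρ = u) ⊆ S1 := (Finset.filter_subset _ _).trans H.hsub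
  have hpw : (∏ ρ' ∈ S with comp ρ' = u, v (κ a + κ μ * t - ρ')) ^ m =
      v t ^ (n * ((S.filter (fun ρ => comp ρ = u)).filter (fun ρ => v (ρ - κ a) < 1)).card) := by
    rw [← H.near_prod hc hsub, ← Finset.prod_pow, pow_mul, ← Finset.prod_const]
    refine Finset.prod_congr rfl fun ρ hρ => ?_
    rw [Finset.mem_filter, Finset.mem_filter] at hρ
    exact hall ρ hρ.1.1 hρ.1.2 hρ.2
  rcases H.hcent u a μ with ⟨s, hs⟩ | h
  · refine ⟨s, hs, ?_⟩
    rw [hs, ← pow_mul, val_pow_anti_eq H.vt0 H.ht1] at hpw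
    exact hpw.symm
  · rw [h, zero_pow hm] at hpw
    exact absurd hpw.symm (pow_ne_zero _ H.vt0)

lemma LS.comp_le (H : LS v κ i ℓ b t S1 S comp w) (a μ : k) {m n : ℕ} (hm : m ≠ 0)
    (hmn : Nat.Coprime m n)
    (hall : ∀ ρ ∈ S, v (ρ - κ a) < 1 → v (κ a + κ μ * t - ρ) ^ m = v t ^ n)
    {ρ : Ω} (hρ : ρ ∈ S) (hn : v (ρ - κ a) < 1) :
    ∏ ρ' ∈ S with comp ρ' = comp ρ, v (κ a + κ μ * t - ρ') ≤ v t ^ n := by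
  obtain ⟨s, hs, hs2⟩ := H.comp_card a μ (comp ρ) hm (fun ρ hρ _ hn => hall ρ hρ hn)
  rw [hs, val_pow_anti H.vt0 H.ht1]
  have hlt := H.comp_lt a μ hρ hn
  rw [hs, ← pow_zero (v t), val_pow_anti_lt H.vt0 H.ht1] at hlt
  have hdvd : n ∣ s := by
    have : n ∣ s * m := ⟨_, hs2.symm⟩
    exact (Nat.Coprime.symm hmn).dvd_of_dvd_mul_right this
  exact Nat.le_of_dvd hlt hdvd

/-- if single component near a, the contribution is trivial -/
lemma LS.contrib_single (H : LS v κ i ℓ b t S1 S comp w) (a : k)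
    (hs : ∀ ρ ∈ S, v (ρ - κ a) < 1 → ∀ ρ' ∈ S, v (ρ' - κ a) < 1 → comp ρ = comp ρ') :
    ∏ ρ ∈ S with v (ρ - κ a) < 1, ∏ ρ' ∈ S with v (ρ' - κ a) < 1, v (ρ - ρ') ^ w ρ ρ' = 1 := by
  refine Finset.prod_eq_one fun ρ hρ => Finset.prod_eq_one fun ρ' hρ' => ?_
  rw [Finset.mem_filter] at hρ hρ'
  rw [H.hw0 ρ hρ.1 ρ' hρ'.1 (hs ρ hρ.1 hρ.2 ρ' hρ'.1 hρ'.2), pow_zero]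
end Loc5


section Loc6
variable {k Ω Γ β : Type*} [Field k] [Field Ω] [CharP k 2] [CharP Ω 2]
  [LinearOrderedCommGroupWithZero Γ] [DecidableEq Ω] [DecidableEq β] [DecidableEq k]
variable {v : Valuation Ω Γ} {κ : k →+* Ω} {i ℓ : ℕ} {b : k} {t : Ω}
    {S1 S : Finset Ω} {comp : Ω → β} {w : Ω → Ω → ℕ}

lemma taylor_pow (v : Valuation Ω Γ) {x t : Ω} (hx : v x ≤ 1) (ht : v t ≤ 1) (n : ℕ) :
    ∃ G, v G ≤ 1 ∧ (x + t) ^ n = x ^ n + n * x ^ (n - 1) * t + G * t ^ 2 := by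
  obtain ⟨⟨K, hK⟩, h⟩ := Polynomial.powAddExpansion (⟨x, hx⟩ : v.integer) (⟨t, ht⟩ : v.integer) n
  refine ⟨K, hK, ?_⟩
  have := congrArg (Subtype.val) h
  push_cast at this
  exact this

lemma LS.sp (H : LS v κ i ℓ b t S1 S comp w) {a e : k} (ha : a ^ ℓ = 1) (hb : b ^ ℓ = 1)
    (he : e ^ ℓ = 1) (habe : e = a + b + 1) : SP v κ i ℓ a b e t :=
  { triv := H.triv, hi := H.hi, hℓ := H.hℓ, ha := ha, hb := hb, he := he, habe := habe,
    ht0 := H.ht0, ht1 := H.ht1 }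

lemma LS.rt (H : LS v κ i ℓ b t S1 S comp w) (a : k) {ρ : Ω} (hρ : ρ ∈ S1) :
    Fh (2 ^ i * ℓ + 1) (κ a + (ρ - κ a)) (κ b + t) = 0 := by
  rw [add_sub_cancel]; exact H.hroot ρ hρ

lemma LS.vyb (H : LS v κ i ℓ b t S1 S comp w) : v (κ b + t) ≤ 1 :=
  Valuation.map_add_le _ (H.triv.le_one b) H.ht1.le

/-- expansion of Fh at `(a, b + t)`. -/
lemma LS.fh_lin (H : LS v κ i ℓ b t S1 S comp w) (a : k) :
    ∃ G, v G ≤ 1 ∧ Fh (2 ^ i * ℓ + 1) (κ a) (κ b + t) = κ (Fh (2 ^ i * ℓ + 1) a b) +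
      κ (b ^ (2 ^ i * ℓ) + (a + b + 1) ^ (2 ^ i * ℓ)) * t + G * t ^ 2 := by
  obtain ⟨G1, hG1, h1⟩ := taylor_pow v (H.triv.le_one b) H.ht1.le (2 ^ i * ℓ + 1)
  obtain ⟨G2, hG2, h2⟩ := taylor_pow v (H.triv.le_one (a + b + 1)) H.ht1.le (2 ^ i * ℓ + 1)
  refine ⟨G1 + G2, Valuation.map_add_le _ hG1 hG2, ?_⟩
  have h3 : κ a + (κ b + t) + 1 = κ (a + b + 1) + t := by simp only [map_add, map_one]; ring
  have h4 : ((2 ^ i * ℓ + 1 : ℕ) : Ω) = 1 := by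
    have : (2 : Ω) = 0 := CharTwo.two_eq_zero
    push_cast
    rw [this, zero_pow (by have := H.hi; omega)]; ring
  unfold Fh
  rw [h3, h1, h2, h4]
  simp only [map_add, map_pow, map_one, add_tsub_cancel_right]
  ring

lemma pow_two_pow_inj {x y : k} {i : ℕ} (h : x ^ 2 ^ i = y ^ 2 ^ i) : x = y := by
  have : Fact (Nat.Prime 2) := ⟨Nat.prime_two⟩
  exact iterateFrobenius_inj k 2 i (by simpa [iterateFrobenius_def] using h)

lemma LS.nonsing (H : LS v κ i ℓ b t S1 S comp w) (a : k)
    (hns : ¬ (a ^ ℓ = 1 ∧ b ^ ℓ = 1 ∧ (a + b + 1) ^ ℓ = 1)) :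
    ∀ ρ ∈ S, v (ρ - κ a) < 1 → ∀ ρ' ∈ S, v (ρ' - κ a) < 1 → comp ρ = comp ρ' := by
  intro ρ hρ hn ρ' hρ' hn'
  have hr := H.r2
  have h2 : (2 : k) = 0 := CharTwo.two_eq_zero
  obtain ⟨G, hG, hexp⟩ := H.fh_lin a
  have hGt : v (G * t ^ 2) < v t := by
    have := val_mul_le v hG (le_refl (v (t ^ 2)))
    rw [map_pow, one_mul] at this
    refine lt_of_le_of_lt this ?_
    have := (val_pow_anti_lt H.vt0 H.ht1 (m := 2) (n := 1)).mpr (by norm_num)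
    simpa using this
  by_cases hF : Fh (2 ^ i * ℓ + 1) a b = 0
  · by_cases hy : b ^ (2 ^ i * ℓ) + (a + b + 1) ^ (2 ^ i * ℓ) = 0
    · by_cases hx : a ^ (2 ^ i * ℓ) + (a + b + 1) ^ (2 ^ i * ℓ) = 0
      · exfalso
        have hc : a ^ (2 ^ i * ℓ) = 1 := by
          unfold Fh at hF
          rw [pow_succ, pow_succ, pow_succ] at hF
          linear_combination hx - (hF - a * hx - b * hy)
        have he : (a + b + 1) ^ (2 ^ i * ℓ) = 1 := by linear_combination hx - hc - h2
        have hb : b ^ (2 ^ i * ℓ) = 1 := by linear_combination hy - he - h2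
        have key : ∀ x : k, x ^ (2 ^ i * ℓ) = 1 → x ^ ℓ = 1 := by
          intro x hx
          rw [mul_comm, pow_mul] at hx
          exact pow_two_pow_inj (i := i) (by rw [hx, one_pow])
        exact hns ⟨key _ hc, key _ hb, key _ he⟩
      · have hb1 : b ≠ 1 := by
          rintro rfl
          have : a + 1 + 1 = a := by linear_combination h2
          rw [this] at hx
          exact hx (CharTwo.add_self_eq_zero _)
        have hval : v (ρ ^ (2 ^ i * ℓ) + (ρ + (κ b + t) + 1) ^ (2 ^ i * ℓ)) = 1 := by
          have hρ1 := H.hintg ρ (H.hsub hρ)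
          have hM : v (ρ - κ a) ≤ max (v (ρ - κ a)) (v t) := le_max_left _ _
          have hM1 : max (v (ρ - κ a)) (v t) < 1 := max_lt hn H.ht1
          have e1 := val_approx_pow v hρ1 (H.triv.le_one a) hM (2 ^ i * ℓ)
          have e2 := val_approx_pow v (x := ρ + (κ b + t) + 1) (x' := κ (a + b + 1))
            (M := max (v (ρ - κ a)) (v t))
            (Valuation.map_add_le _ (Valuation.map_add_le _ hρ1 H.vyb) (by simp))
            (H.triv.le_one _) (by
              have : ρ + (κ b + t) + 1 - κ (a + b + 1) = (ρ - κ a) + t := by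
                simp only [map_add, map_one]; ring
              rw [this]; exact Valuation.map_add _ _ _) (2 ^ i * ℓ)
          have e3 : ρ ^ (2 ^ i * ℓ) + (ρ + (κ b + t) + 1) ^ (2 ^ i * ℓ) =
            κ (a ^ (2 ^ i * ℓ) + (a + b + 1) ^ (2 ^ i * ℓ)) +
            ((ρ ^ (2 ^ i * ℓ) - κ a ^ (2 ^ i * ℓ)) +
              ((ρ + (κ b + t) + 1) ^ (2 ^ i * ℓ) - κ (a + b + 1) ^ (2 ^ i * ℓ))) := by
            rw [map_add, map_pow, map_pow]; ring
          rw [e3, val_add_eq, H.triv _ hx]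
          rw [H.triv _ hx]
          exact lt_of_le_of_lt (Valuation.map_add_le _ e1 e2) hM1
        have hd := H.der_val (H.hsub hρ) hn
        rw [hval, H.vy1, if_neg hb1, one_mul] at hd
        by_contra hne
        have hne' : ρ' ≠ ρ := fun h => hne (by rw [h])
        have hm : ρ' ∈ (S1.filter (fun ρ => v (ρ - κ a) < 1)).erase ρ := by
          simp [hne', H.hsub hρ', hn']
        rw [← Finset.mul_prod_erase _ _ hm] at hd
        refine absurd hd (ne_of_lt ?_)
        calc _ ≤ v (ρ - ρ') * 1 := by
              refine mul_le_mul' le_rfl (Finset.prod_le_one' fun x hx => ?_)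
              have := Finset.mem_of_mem_erase (Finset.mem_of_mem_erase hx)
              exact H.all_le hn (Finset.mem_filter.mp this).1
          _ < 1 := by rw [mul_one]; exact H.near_le hn hn'
    · refine H.single a 0 1 (fun ρ hρ hn => H.comp_le1 a 0 hρ hn) ?_ hρ hn hρ' hn'
      refine lt_of_le_of_lt (mul_le_mul' H.vy1_le le_rfl) ?_
      rw [map_zero, zero_mul, add_zero, hexp, hF, map_zero, zero_add, one_mul, val_add_eq]
      · rw [map_mul, H.triv _ hy, one_mul]
        have := (val_pow_anti_lt H.vt0 H.ht1 (m := 2) (n := 1)).mpr (by norm_num)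
        simpa using this
      · rw [map_mul v (κ _), H.triv _ hy, one_mul]; exact hGt
  · refine H.single a 0 1 (fun ρ hρ hn => H.comp_le1 a 0 hρ hn) ?_ hρ hn hρ' hn'
    refine lt_of_le_of_lt (mul_le_mul' H.vy1_le le_rfl) ?_
    rw [map_zero, zero_mul, add_zero, hexp, add_assoc, one_mul, val_add_eq]
    · rw [H.triv _ hF]
      have := (val_pow_anti_lt H.vt0 H.ht1 (m := 2) (n := 0)).mpr (by norm_num)
      simpa using this
    · rw [H.triv _ hF]
      exact lt_of_le_of_lt (Valuation.map_add_le _ (val_mul_le_right v (H.triv.le_one _) le_rfl)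
        hGt.le) H.ht1

/-- type II points are unibranch for all purposes -/
lemma LS.typeII (H : LS v κ i ℓ b t S1 S comp w) {a e : k} (P : SP v κ i ℓ a b e t)
    (h : cA i a e = 0 ∧ cA i b e ≠ 0 ∨ ∃ μ, cA i a e ≠ 0 ∧ cA i a e * μ ^ 2 ^ i = cA i b e ∧
      cK i a b e μ ≠ 0) :
    ∀ ρ ∈ S, v (ρ - κ a) < 1 → ∀ ρ' ∈ S, v (ρ' - κ a) < 1 → comp ρ = comp ρ' := by
  intro ρ hρ hn ρ' hρ' hn'
  have hr := H.r2
  have hlt := fun m n => (val_pow_anti_lt H.vt0 H.ht1 (m := m) (n := n)).mpr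
  rcases h with ⟨hA, hB⟩ | ⟨μ, hA, hμ, hK⟩
  · have hc : ∀ ρ, v (κ a + κ 0 * t - ρ) = v (ρ - κ a) := by
      intro ρ; rw [map_zero, zero_mul, add_zero, Valuation.map_sub_swap]
    have hv : v (Fh (2 ^ i * ℓ + 1) (κ a + κ 0 * t) (κ b + t)) = v t ^ 2 ^ i := by
      rw [map_zero, zero_mul, add_zero]; exact P.val_at_zero hB
    by_cases hb : b = 1
    · refine H.single a 0 (2 ^ i - 1) (fun ρ hρ hn => H.comp_le a 0 (m := 2 ^ i) (by positivity)
        ?_ (fun ρ hρ hn => ?_) hρ hn) ?_ hρ hn hρ' hn'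
      · have : 2 ^ i = (2 ^ i - 1) + 1 := by omega
        rw [this]; simp
      · rw [hc]
        exact P.typeIIb1 hb hB hn (H.rt a (H.hsub hρ))
      · rw [H.vy1, if_pos hb, hv, ← pow_succ']
        exact hlt _ _ (by omega)
    · refine H.single a 0 (2 ^ i) (fun ρ hρ hn => H.comp_le a 0 (m := 2 ^ i + 1) (by positivity)
        ?_ (fun ρ hρ hn => ?_) hρ hn) ?_ hρ hn hρ' hn'
      · simp
      · rw [hc]
        exact P.typeIIi hA hB (fun h => hb (P.ea_iff.mp h)) hn (H.rt a (H.hsub hρ))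
      · rw [H.vy1, if_neg hb, hv, one_mul]
        exact hlt _ _ (by omega)
  · refine H.single a μ (2 ^ i + 1) (fun ρ hρ hn => H.comp_le a μ (m := 2 ^ i) (by positivity)
        ?_ (fun ρ hρ hn => ?_) hρ hn) ?_ hρ hn hρ' hn'
    · simp
    · have : v (κ a + κ μ * t - ρ) = v (ρ - κ a - κ μ * t) := by
        rw [Valuation.map_sub_swap]; congr 1; ring
      rw [this]
      exact P.iii_K hA hμ hK hn (H.rt a (H.hsub hρ))
    · rw [P.iii_K_val hA hμ hK]
      refine lt_of_le_of_lt (mul_le_mul' H.vy1_le le_rfl) ?_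
      rw [one_mul]
      exact hlt _ _ (by omega)

/-- if all near differences are equal to `v t`. -/
lemma LS.contrib_eq (H : LS v κ i ℓ b t S1 S comp w) (a : k) (M : ℕ)
    (hd : ∀ ρ ∈ S, v (ρ - κ a) < 1 → ∀ ρ' ∈ S, v (ρ' - κ a) < 1 → ρ ≠ ρ' → v (ρ - ρ') = v t)
    (hM : (S.filter (fun ρ => v (ρ - κ a) < 1)).card ≤ M) :
    v t ^ M ^ 2 ≤
    ∏ ρ ∈ S with v (ρ - κ a) < 1, ∏ ρ' ∈ S with v (ρ' - κ a) < 1, v (ρ - ρ') ^ w ρ ρ' := by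
  have : ∏ ρ ∈ S with v (ρ - κ a) < 1, ∏ ρ' ∈ S with v (ρ' - κ a) < 1, v (ρ - ρ') ^ w ρ ρ' =
    v t ^ ∑ ρ ∈ S with v (ρ - κ a) < 1, ∑ ρ' ∈ S with v (ρ' - κ a) < 1, w ρ ρ' := by
    rw [← Finset.prod_pow_eq_pow_sum]
    refine Finset.prod_congr rfl fun ρ hρ => ?_
    rw [← Finset.prod_pow_eq_pow_sum]
    refine Finset.prod_congr rfl fun ρ' hρ' => ?_
    rw [Finset.mem_filter] at hρ hρ'
    by_cases h : ρ = ρ'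
    · subst h
      rw [H.hw0 ρ hρ.1 ρ hρ.1 rfl, pow_zero, pow_zero]
    · rw [hd ρ hρ.1 hρ.2 ρ' hρ'.1 hρ'.2 h]
  rw [this, val_pow_anti H.vt0 H.ht1]
  refine (H.hws _ (Finset.filter_subset _ _)).trans (Nat.pow_le_pow_left hM 2)

lemma LS.one_near (H : LS v κ i ℓ b t S1 S comp w) {a : k} (ha : a = 1) : v ((1 : Ω) - κ a) < 1 := by
  simp [ha]

lemma LS.y_near (H : LS v κ i ℓ b t S1 S comp w) {a : k} (ha : a = b) : v (κ b + t - κ a) < 1 := by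
  rw [ha, add_sub_cancel_left]; exact H.ht1

lemma LS.y_ne (H : LS v κ i ℓ b t S1 S comp w) : κ b + t ≠ 1 := by
  intro h
  have h1 : κ (b - 1) = - t := by rw [map_sub, map_one]; linear_combination h
  have h2 : b - 1 = 0 := H.triv.eq_zero (by rw [h1, Valuation.map_neg]; exact H.ht1)
  rw [h2, map_zero] at h1
  exact H.ht0 (by simpa using h1.symm)

lemma LS.typeIII (H : LS v κ i ℓ b t S1 S comp w) {a e : k} (P : SP v κ i ℓ a b e t)
    (hA : cA i a e = 0) (hB : cA i b e = 0) :
    v t ^ (if b = 1 then (if a = 1 then (2 ^ i - 2) ^ 2 else (2 ^ i) ^ 2) else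
      if a = 1 ∨ a = b then (2 ^ i) ^ 2 else (2 ^ i + 1) ^ 2) ≤
    ∏ ρ ∈ S with v (ρ - κ a) < 1, ∏ ρ' ∈ S with v (ρ' - κ a) < 1, v (ρ - ρ') ^ w ρ ρ' := by
  have hr := H.r2
  set N := S.filter (fun ρ => v (ρ - κ a) < 1) with hN
  set N1 := S1.filter (fun ρ => v (ρ - κ a) < 1) with hN1
  have hNN : N ⊆ N1 := Finset.filter_subset_filter _ H.hsub
  have hd : ∀ ρ ∈ S1, v (ρ - κ a) < 1 → ∀ ρ' ∈ S1, v (ρ' - κ a) < 1 → ρ ≠ ρ' →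
      v (ρ - ρ') = v t := by
    intro ρ hρ hn ρ' hρ' hn' hne
    have := P.typeIII_diff hA hB hn (H.rt a hρ) hn' (H.rt a hρ') (fun h => hne (by simpa using h))
    simpa using this
  have hcard : N1.card ≤ (if b = 1 then 2 ^ i else 2 ^ i + 1) := by
    rcases N1.eq_empty_or_nonempty with h | ⟨ρ, hρ⟩
    · rw [h]; simp
    · have hρ' := Finset.mem_filter.mp hρ
      have h1 := H.der_val hρ'.1 hρ'.2
      have h2 := P.typeIII_Fx hA hB hρ'.2 (H.rt a hρ'.1)
      rw [add_sub_cancel] at h2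
      rw [h2, Finset.prod_congr rfl (g := fun _ => v t), Finset.prod_const,
        Finset.card_erase_of_mem hρ, H.vy1] at h1
      · have hpos : 0 < N1.card := Finset.card_pos.mpr ⟨ρ, hρ⟩
        split_ifs at h1 ⊢ with hb
        · rw [← pow_succ', val_pow_anti_eq H.vt0 H.ht1] at h1
          change N1.card - 1 + 1 = _ at h1
          omega
        · rw [one_mul, val_pow_anti_eq H.vt0 H.ht1] at h1
          change N1.card - 1 = _ at h1
          omega
      · intro x hx
        have hx1 := Finset.mem_filter.mp (Finset.mem_of_mem_erase hx)
        exact hd ρ hρ'.1 hρ'.2 x hx1.1 hx1.2 (Finset.ne_of_mem_erase hx).symm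
  have fin := H.contrib_eq a
  have hdS : ∀ ρ ∈ S, v (ρ - κ a) < 1 → ∀ ρ' ∈ S, v (ρ' - κ a) < 1 → ρ ≠ ρ' → v (ρ - ρ') = v t :=
    fun ρ hρ hn ρ' hρ' hn' hne => hd ρ (H.hsub hρ) hn ρ' (H.hsub hρ') hn' hne
  have h1N : (1 : Ω) ∉ N := fun h => H.h1' (Finset.mem_filter.mp h).1
  have hyN : κ b + t ∉ N := fun h => H.hy' (Finset.mem_filter.mp h).1
  split_ifs with hb ha ha
  · refine fin _ hdS ?_
    rw [if_pos hb] at hcard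
    have : insert (1 : Ω) (insert (κ b + t) N) ⊆ N1 := by
      refine Finset.insert_subset (Finset.mem_filter.mpr ⟨H.h1, H.one_near ha⟩)
        (Finset.insert_subset (Finset.mem_filter.mpr ⟨H.hy, H.y_near (by rw [ha, hb])⟩) hNN)
    have := Finset.card_le_card this
    rw [Finset.card_insert_of_notMem, Finset.card_insert_of_notMem hyN] at this
    · change N.card ≤ _
      omega
    · rw [Finset.mem_insert]
      rintro (h | h)
      · exact H.y_ne h.symm
      · exact h1N h
  · rw [if_pos hb] at hcard
    exact fin _ hdS ((Finset.card_le_card hNN).trans hcard)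
  · rw [if_neg hb] at hcard
    refine fin _ hdS ?_
    change N.card ≤ _
    rcases ha with ha | ha
    · have : _ ≤ N1.card := Finset.card_le_card (Finset.insert_subset
        (Finset.mem_filter.mpr ⟨H.h1, H.one_near ha⟩) hNN)
      rw [Finset.card_insert_of_notMem h1N] at this
      omega
    · have : _ ≤ N1.card := Finset.card_le_card (Finset.insert_subset
        (Finset.mem_filter.mpr ⟨H.hy, H.y_near ha⟩) hNN)
      rw [Finset.card_insert_of_notMem hyN] at this
      omega
  · rw [if_neg hb] at hcard
    exact fin _ hdS ((Finset.card_le_card hNN).trans hcard)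
end Loc6


section Loc7
variable {k Ω Γ β : Type*} [Field k] [Field Ω] [CharP k 2] [CharP Ω 2]
  [LinearOrderedCommGroupWithZero Γ] [DecidableEq Ω] [DecidableEq β] [DecidableEq k]
variable {v : Valuation Ω Γ} {κ : k →+* Ω} {i ℓ : ℕ} {b : k} {t : Ω}
    {S1 S : Finset Ω} {comp : Ω → β} {w : Ω → Ω → ℕ}

/-- contribution when all near roots but one lie in one component -/
lemma LS.contrib_star (H : LS v κ i ℓ b t S1 S comp w) (a : k) {ρA : Ω} (hρA : ρA ∈ S)
    (hnA : v (ρA - κ a) < 1)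
    (hs : ∀ ρ ∈ S, v (ρ - κ a) < 1 → ρ ≠ ρA → ∀ ρ' ∈ S, v (ρ' - κ a) < 1 → ρ' ≠ ρA →
      comp ρ = comp ρ') {M : ℕ}
    (hM : v t ^ M ≤ ∏ ρ' ∈ (S1.filter (fun ρ => v (ρ - κ a) < 1)).erase ρA, v (ρA - ρ')) :
    v t ^ (4 * M) ≤
    ∏ ρ ∈ S with v (ρ - κ a) < 1, ∏ ρ' ∈ S with v (ρ' - κ a) < 1, v (ρ - ρ') ^ w ρ ρ' := by
  set N := S.filter (fun ρ => v (ρ - κ a) < 1) with hN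
  have hmem : ρA ∈ N := Finset.mem_filter.mpr ⟨hρA, hnA⟩
  have hle : ∀ ρ ∈ N, ∀ ρ' ∈ N, v (ρ - ρ') ≤ 1 := by
    intro ρ hρ ρ' hρ'
    exact H.all_le (Finset.mem_filter.mp hρ).2 (H.hsub (Finset.mem_filter.mp hρ').1)
  have hM' : v t ^ M ≤ ∏ ρ' ∈ N.erase ρA, v (ρA - ρ') := by
    refine hM.trans ?_
    refine Finset.prod_le_prod_of_subset_of_le_one' (Finset.erase_subset_erase _
      (Finset.filter_subset_filter _ H.hsub)) ?_
    intro ρ hρ _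
    exact H.all_le hnA (Finset.mem_filter.mp (Finset.mem_of_mem_erase hρ)).1
  have hpw : ∀ ρ ∈ N, ∀ ρ' ∈ N, v (ρ - ρ') ^ 2 ≤ v (ρ - ρ') ^ w ρ ρ' := by
    intro ρ hρ ρ' hρ'
    exact pow_le_pow_right_of_le_one' (hle ρ hρ ρ' hρ') (H.hw2 ρ ρ')
  rw [← Finset.mul_prod_erase _ _ hmem]
  have e4 : v t ^ (4 * M) = (v t ^ M) ^ 2 * (v t ^ M) ^ 2 := by
    rw [← pow_mul, ← pow_add]; congr 1; ring
  rw [e4]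
  refine mul_le_mul' ?_ ?_
  · rw [← Finset.mul_prod_erase _ _ hmem, H.hw0 ρA hρA ρA hρA rfl, pow_zero, one_mul]
    refine (pow_le_pow_left' hM' 2).trans ?_
    rw [← Finset.prod_pow]
    exact Finset.prod_le_prod' fun ρ hρ => hpw _ hmem _ (Finset.mem_of_mem_erase hρ)
  · refine (pow_le_pow_left' hM' 2).trans ?_
    rw [← Finset.prod_pow]
    refine Finset.prod_le_prod' fun ρ hρ => ?_
    have hρN := Finset.mem_of_mem_erase hρ
    have hρne := Finset.ne_of_mem_erase hρ
    rw [← Finset.mul_prod_erase _ _ hmem, Valuation.map_sub_swap]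
    rw [Finset.prod_eq_one (s := N.erase ρA), mul_one]
    · exact hpw _ hρN _ hmem
    · intro ρ' hρ'
      have h1 := Finset.mem_filter.mp hρN
      have h2 := Finset.mem_filter.mp (Finset.mem_of_mem_erase hρ')
      rw [H.hw0 ρ h1.1 ρ' h2.1 (hs ρ h1.1 h1.2 hρne ρ' h2.1 h2.2 (Finset.ne_of_mem_erase hρ')),
        pow_zero]

lemma LS.kzero (H : LS v κ i ℓ b t S1 S comp w) {a e : k} (P : SP v κ i ℓ a b e t) {μ : k}
    (hA : cA i a e ≠ 0) (hμ : cA i a e * μ ^ 2 ^ i = cA i b e) (hK : cK i a b e μ = 0) :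
    v t ^ (if i = 1 then 0 else 4 * 2 ^ i) ≤
    ∏ ρ ∈ S with v (ρ - κ a) < 1, ∏ ρ' ∈ S with v (ρ' - κ a) < 1, v (ρ - ρ') ^ w ρ ρ' := by
  have hr := H.r2
  have hb1 : b ≠ 1 := by
    intro h
    have := P.ea h
    apply hA
    rw [this]; exact CharTwo.add_self_eq_zero _
  set N1 := S1.filter (fun ρ => v (ρ - κ a) < 1) with hN1
  have hD : ∀ ρ ∈ N1, ∏ ρ' ∈ N1.erase ρ, v (ρ - ρ') = v t ^ 2 ^ i := by
    intro ρ hρ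
    have hρ' := Finset.mem_filter.mp hρ
    have h1 := H.der_val hρ'.1 hρ'.2
    have h2 := P.iii_Fx hA hμ hK hρ'.2 (H.rt a hρ'.1)
    rw [add_sub_cancel] at h2
    rw [H.vy1, if_neg hb1, one_mul, h2] at h1
    exact h1
  have hAB : ∀ ρ ∈ N1, v (ρ - κ a - κ μ * t) ≤ v t ^ 2 ^ i ∨
      (v t ^ 2 ^ i < v (ρ - κ a - κ μ * t) ∧ v (ρ - κ a - κ μ * t) ^ (2 ^ i - 1) = v t ^ 2 ^ i) := by
    intro ρ hρ
    have hρ' := Finset.mem_filter.mp hρ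
    exact P.iii_AB hA hμ hK hρ'.2 (H.rt a hρ'.1)
  have hle : ∀ ρ ∈ N1, ∀ ρ' ∈ N1, v (ρ - ρ') < 1 := by
    intro ρ hρ ρ' hρ'
    exact H.near_le (Finset.mem_filter.mp hρ).2 (Finset.mem_filter.mp hρ').2
  have hdL : ∀ ρ ρ', v (ρ - ρ') ≤ max (v (ρ - κ a - κ μ * t)) (v (ρ' - κ a - κ μ * t)) := by
    intro ρ ρ'
    have : ρ - ρ' = (ρ - κ a - κ μ * t) - (ρ' - κ a - κ μ * t) := by ring
    rw [this]; exact Valuation.map_sub _ _ _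
  have htwo : ∀ ρ ∈ N1, ∀ ρ' ∈ N1, ρ ≠ ρ' → v (ρ - ρ') ≤ v t ^ 2 ^ i → ∀ ρ'' ∈ N1, ρ'' = ρ ∨ ρ'' = ρ' := by
    intro ρ hρ ρ' hρ' hne hv ρ'' hρ''
    by_contra hcon
    push Not at hcon
    have h1 := hD ρ hρ
    rw [← Finset.mul_prod_erase _ _ (Finset.mem_erase.mpr ⟨hne.symm, hρ'⟩),
      ← Finset.mul_prod_erase _ _ (Finset.mem_erase.mpr ⟨hcon.2, Finset.mem_erase.mpr ⟨hcon.1, hρ''⟩⟩)] at h1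
    refine absurd h1 (ne_of_lt ?_)
    have hle1 : ∏ x ∈ ((N1.erase ρ).erase ρ').erase ρ'', v (ρ - x) ≤ 1 :=
      Finset.prod_le_one' fun x hx => (hle ρ hρ x (Finset.mem_of_mem_erase
        (Finset.mem_of_mem_erase (Finset.mem_of_mem_erase hx)))).le
    have hlt : v (ρ - ρ'') * ∏ x ∈ ((N1.erase ρ).erase ρ').erase ρ'', v (ρ - x) < 1 :=
      lt_of_le_of_lt (mul_le_mul' le_rfl hle1) (by rw [mul_one]; exact hle ρ hρ ρ'' hρ'')
    have hpos : 0 < v t ^ 2 ^ i := zero_lt_iff.mpr (pow_ne_zero _ H.vt0)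
    calc _ ≤ v t ^ 2 ^ i * (v (ρ - ρ'') * ∏ x ∈ ((N1.erase ρ).erase ρ').erase ρ'', v (ρ - x)) :=
          mul_le_mul' hv le_rfl
      _ < v t ^ 2 ^ i * 1 := by
          exact (mul_lt_mul_iff_right₀ hpos).mpr hlt
      _ = _ := mul_one _
  have hSN : ∀ ρ ∈ S, v (ρ - κ a) < 1 → ρ ∈ N1 := fun ρ hρ hn =>
    Finset.mem_filter.mpr ⟨H.hsub hρ, hn⟩
  by_cases hi1 : i = 1
  · rw [if_pos hi1, pow_zero]
    rw [H.contrib_single]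
    intro ρ hρ hn ρ' hρ' hn'
    by_contra hne
    have hne' : ρ ≠ ρ' := fun h => hne (by rw [h])
    have hLle : ∀ ρ ∈ N1, v (ρ - κ a - κ μ * t) ≤ v t ^ 2 ^ i := by
      intro ρ hρ
      rcases hAB ρ hρ with h | h
      · exact h
      · subst hi1
        simpa using h.2.le
    have hor : a = 1 ∨ a = b := by
      by_contra hcon
      push Not at hcon
      subst hi1
      exact cK_ne_r2 P.a0 P.b0 P.e0 P.habe hμ hcon.1 hcon.2 hK
    have h3 := htwo ρ (hSN ρ hρ hn) ρ' (hSN ρ' hρ' hn') hne' ((hdL _ _).trans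
      (max_le (hLle _ (hSN ρ hρ hn)) (hLle _ (hSN ρ' hρ' hn'))))
    rcases hor with h | h
    · rcases h3 1 (Finset.mem_filter.mpr ⟨H.h1, H.one_near h⟩) with h4 | h4
      · exact H.h1' (h4 ▸ hρ)
      · exact H.h1' (h4 ▸ hρ')
    · rcases h3 (κ b + t) (Finset.mem_filter.mpr ⟨H.hy, H.y_near h⟩) with h4 | h4
      · exact H.hy' (h4 ▸ hρ)
      · exact H.hy' (h4 ▸ hρ')
  rw [if_neg hi1]
  have hr4 : 4 ≤ 2 ^ i := by
    calc 4 = 2 ^ 2 := rfl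
      _ ≤ 2 ^ i := Nat.pow_le_pow_right (by norm_num) (by have := H.hi; omega)
  by_cases hall : ∀ ρ ∈ S, v (ρ - κ a) < 1 → ∀ ρ' ∈ S, v (ρ' - κ a) < 1 → comp ρ = comp ρ'
  · rw [H.contrib_single a hall]
    exact pow_le_one' H.ht1.le _
  have hLp : ∀ ρ ∈ N1, v (ρ - κ a - κ μ * t) ^ (2 ^ i - 1) ≤ v t ^ 2 ^ i := by
    intro ρ hρ
    rcases hAB ρ hρ with h | h
    · refine (pow_le_pow_left' h _).trans ?_
      rw [← pow_mul, val_pow_anti H.vt0 H.ht1]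
      exact Nat.le_mul_of_pos_right _ (by omega)
    · exact h.2.le
  have hcard : N1.card ≤ 2 ^ i := by
    rcases N1.eq_empty_or_nonempty with h | ⟨ρ, hρ⟩
    · rw [h]; simp
    have h1 := congrArg (· ^ (2 ^ i - 1)) (hD ρ hρ)
    simp only [← Finset.prod_pow] at h1
    have h2 : ∏ ρ' ∈ N1.erase ρ, v (ρ - ρ') ^ (2 ^ i - 1) ≤ ∏ ρ' ∈ N1.erase ρ, v t ^ 2 ^ i := by
      refine Finset.prod_le_prod' fun ρ' hρ' => ?_
      rcases max_cases (v (ρ - κ a - κ μ * t)) (v (ρ' - κ a - κ μ * t)) with h | h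
      · refine (pow_le_pow_left' (h.1 ▸ hdL ρ ρ') _).trans (hLp ρ hρ)
      · refine (pow_le_pow_left' (h.1 ▸ hdL ρ ρ') _).trans (hLp ρ' (Finset.mem_of_mem_erase hρ'))
    rw [h1, Finset.prod_const, Finset.card_erase_of_mem hρ, ← pow_mul, ← pow_mul,
      val_pow_anti H.vt0 H.ht1] at h2
    have := Nat.le_of_mul_le_mul_left h2 (by omega)
    omega
  have hbig : ∀ ρ0 ∈ S, v (ρ0 - κ a) < 1 →
      (∀ ρ ∈ S, comp ρ = comp ρ0 → v (ρ - κ a) < 1 → ¬ v (ρ - κ a - κ μ * t) ≤ v t ^ 2 ^ i) →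
      2 ^ i - 1 ≤ ((S.filter (fun ρ => comp ρ = comp ρ0)).filter (fun ρ => v (ρ - κ a) < 1)).card := by
    intro ρ0 hρ0 hn0 hB
    obtain ⟨s, -, hs⟩ := H.comp_card a μ (comp ρ0) (m := 2 ^ i - 1) (n := 2 ^ i) (by omega) (by
      intro ρ hρ hc hn
      have : v (κ a + κ μ * t - ρ) = v (ρ - κ a - κ μ * t) := by
        rw [Valuation.map_sub_swap]; congr 1; ring
      rw [this]
      rcases hAB ρ (hSN ρ hρ hn) with h | h
      · exact absurd h (hB ρ hρ hc hn)
      · exact h.2)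
    refine Nat.le_of_dvd (Finset.card_pos.mpr ⟨ρ0, by simp [hρ0, hn0]⟩) ?_
    have hcop : Nat.Coprime (2 ^ i - 1) (2 ^ i) := by
      have : 2 ^ i = (2 ^ i - 1) + 1 := by omega
      rw [this]; simp
    exact hcop.dvd_of_dvd_mul_left ⟨s, by rw [hs]; ring⟩
  set N := S.filter (fun ρ => v (ρ - κ a) < 1) with hN
  have hNN : N.card ≤ 2 ^ i := (Finset.card_le_card (Finset.filter_subset_filter _ H.hsub)).trans hcard
  push Not at hall
  obtain ⟨ρ1, hρ1, hn1, ρ2, hρ2, hn2, hne⟩ := hall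
  have hdisj : ∀ ρ1 ρ2, comp ρ1 ≠ comp ρ2 →
      ((S.filter (fun ρ => comp ρ = comp ρ1)).filter (fun ρ => v (ρ - κ a) < 1)).card +
      ((S.filter (fun ρ => comp ρ = comp ρ2)).filter (fun ρ => v (ρ - κ a) < 1)).card ≤ N.card := by
    intro ρ1 ρ2 hne
    rw [← Finset.card_union_of_disjoint]
    · apply Finset.card_le_card
      intro x hx
      simp only [Finset.mem_union, Finset.mem_filter, hN] at hx ⊢
      tauto
    · rw [Finset.disjoint_left]
      intro x hx hx'
      simp only [Finset.mem_filter] at hx hx'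
      exact hne (hx.1.2.symm.trans hx'.1.2)
  have hexA : ∃ ρA ∈ S, v (ρA - κ a) < 1 ∧ v (ρA - κ a - κ μ * t) ≤ v t ^ 2 ^ i := by
    by_contra hcon
    push Not at hcon
    have h1 := hbig ρ1 hρ1 hn1 (fun ρ hρ _ hn => not_le.mpr (hcon ρ hρ hn))
    have h2 := hbig ρ2 hρ2 hn2 (fun ρ hρ _ hn => not_le.mpr (hcon ρ hρ hn))
    have := hdisj ρ1 ρ2 hne
    omega
  obtain ⟨ρA, hρA, hnA, hvA⟩ := hexA
  refine H.contrib_star a hρA hnA ?_ (hD ρA (hSN ρA hρA hnA)).ge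
  by_cases hA2 : ∃ ρA' ∈ S, v (ρA' - κ a) < 1 ∧ v (ρA' - κ a - κ μ * t) ≤ v t ^ 2 ^ i ∧ ρA' ≠ ρA
  · obtain ⟨ρA', hρA', hnA', hvA', hneA⟩ := hA2
    have h3 := htwo ρA (hSN _ hρA hnA) ρA' (hSN _ hρA' hnA') hneA.symm ((hdL _ _).trans (max_le hvA hvA'))
    intro ρ hρ hn hne ρ' hρ' hn' hne'
    rw [(h3 ρ (hSN ρ hρ hn)).resolve_left hne, (h3 ρ' (hSN ρ' hρ' hn')).resolve_left hne']
  · push Not at hA2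
    have hother : ∃ ρ' ∈ S, v (ρ' - κ a) < 1 ∧ comp ρ' ≠ comp ρA := by
      by_contra hcon
      push Not at hcon
      exact hne ((hcon ρ1 hρ1 hn1).trans (hcon ρ2 hρ2 hn2).symm)
    obtain ⟨ρ0, hρ0, hn0, hc0⟩ := hother
    have h1 := hbig ρ0 hρ0 hn0 (fun ρ hρ hc hn hv => by
      have := hA2 ρ hρ hn hv
      rw [this] at hc
      exact hc0 hc.symm)
    have key : ∀ ρ ∈ S, v (ρ - κ a) < 1 → ρ ≠ ρA → comp ρ = comp ρ0 := by
      intro ρ hρ hn hneA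
      by_contra hcne
      have : insert ρ (insert ρA ((S.filter (fun ρ => comp ρ = comp ρ0)).filter (fun ρ => v (ρ - κ a) < 1))) ⊆ N := by
        intro x hx
        simp only [Finset.mem_insert, Finset.mem_filter, hN] at hx ⊢
        rcases hx with rfl | rfl | hx
        · exact ⟨hρ, hn⟩
        · exact ⟨hρA, hnA⟩
        · exact ⟨hx.1.1, hx.2⟩
      have := Finset.card_le_card this
      rw [Finset.card_insert_of_notMem, Finset.card_insert_of_notMem] at this
      · omega
      · simp only [Finset.mem_filter]
        intro h; exact hc0 h.1.2.symm
      · simp only [Finset.mem_insert, Finset.mem_filter]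
        rintro (h | h)
        · exact hneA h
        · exact hcne h.1.2
    intro ρ hρ hn hne ρ' hρ' hn' hne'
    rw [key ρ hρ hn hne, key ρ' hρ' hn' hne']

open Classical in
/-- local bound -/
noncomputable def cAB (i ℓ : ℕ) (a b : k) : ℕ :=
  if a ^ ℓ = 1 ∧ b ^ ℓ = 1 ∧ (a + b + 1) ^ ℓ = 1 then
    (if cA i a (a + b + 1) = 0 ∧ cA i b (a + b + 1) = 0 then
      (if b = 1 then (if a = 1 then (2 ^ i - 2) ^ 2 else (2 ^ i) ^ 2) else
        if a = 1 ∨ a = b then (2 ^ i) ^ 2 else (2 ^ i + 1) ^ 2)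
    else if b = 1 ∨ i = 1 then 0 else 4 * 2 ^ i)
  else 0

theorem LS.localBd [IsAlgClosed k] (H : LS v κ i ℓ b t S1 S comp w) (a : k) :
    v t ^ cAB i ℓ a b ≤
    ∏ ρ ∈ S with v (ρ - κ a) < 1, ∏ ρ' ∈ S with v (ρ' - κ a) < 1, v (ρ - ρ') ^ w ρ ρ' := by
  unfold cAB
  by_cases h : a ^ ℓ = 1 ∧ b ^ ℓ = 1 ∧ (a + b + 1) ^ ℓ = 1
  · rw [if_pos h]
    have P := H.sp h.1 h.2.1 h.2.2 rfl
    by_cases h3 : cA i a (a + b + 1) = 0 ∧ cA i b (a + b + 1) = 0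
    · rw [if_pos h3]
      convert H.typeIII P h3.1 h3.2
    · rw [if_neg h3]
      by_cases hA : cA i a (a + b + 1) = 0
      · have hB : cA i b (a + b + 1) ≠ 0 := fun h => h3 ⟨hA, h⟩
        rw [H.contrib_single a (H.typeII P (Or.inl ⟨hA, hB⟩))]
        exact pow_le_one' H.ht1.le _
      · obtain ⟨μ, hμ⟩ := IsAlgClosed.exists_pow_nat_eq (cA i b (a + b + 1) / cA i a (a + b + 1))
          (n := 2 ^ i) (by positivity)
        have hμ' : cA i a (a + b + 1) * μ ^ 2 ^ i = cA i b (a + b + 1) := by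
          rw [hμ]; field_simp
        by_cases hK : cK i a b (a + b + 1) μ = 0
        · have hb1 : b ≠ 1 := by
            intro h
            have := P.ea h
            apply hA
            rw [this]; exact CharTwo.add_self_eq_zero _
          have := H.kzero P hA hμ' hK
          simpa [hb1] using this
        · rw [H.contrib_single a (H.typeII P (Or.inr ⟨μ, hA, hμ', hK⟩))]
          exact pow_le_one' H.ht1.le _
  · rw [if_neg h, pow_zero, H.contrib_single a (H.nonsing a h)]
end Loc7


section Count
variable {k : Type*} [Field k] [CharP k 2]

open Classical in
/-- roots of unity -/
noncomputable def mu (k : Type*) [Field k] (n : ℕ) : Finset k := nthRootsFinset n (1 : k)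

lemma mem_mu {n : ℕ} (hn : 0 < n) {x : k} : x ∈ mu k n ↔ x ^ n = 1 := by
  unfold mu
  exact mem_nthRootsFinset hn (1 : k)

lemma card_mu (n : ℕ) : (mu k n).card ≤ n := by
  classical
  unfold mu
  rw [nthRootsFinset_def]
  exact (Multiset.toFinset_card_le _).trans (card_nthRoots n 1)

open Classical in
/-- admissible -/
noncomputable def adm (n : ℕ) (b : k) : Finset k := (mu k n).filter (fun a => a + b + 1 ∈ mu k n)

lemma even_adm (n : ℕ) {b : k} (hb : b ≠ 1) : Even (adm n b).card := by
  classical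
  have h2 : (2 : k) = 0 := CharTwo.two_eq_zero
  have : ∑ a ∈ adm n b, (1 : ZMod 2) = 0 := by
    refine Finset.sum_involution (fun a _ => a + b + 1) ?_ ?_ ?_ ?_
    · intro a ha; decide
    · intro a ha _ h
      apply hb
      have : a + b + 1 = a := h
      linear_combination this - h2
    · intro a ha
      simp only [adm, Finset.mem_filter] at ha ⊢
      refine ⟨ha.2, ?_⟩
      have : a + b + 1 + b + 1 = a := by linear_combination (b + 1) * h2
      rw [this]; exact ha.1
    · intro a ha
      change a + b + 1 + b + 1 = a
      linear_combination (b + 1) * h2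
  rw [Finset.sum_const, nsmul_eq_mul, mul_one] at this
  rw [even_iff_two_dvd]
  exact (ZMod.natCast_eq_zero_iff _ _).mp this

lemma card_adm {n : ℕ} (hn : Odd n) {b : k} (hb : b ≠ 1) : (adm n b).card ≤ n - 1 := by
  classical
  have h1 : (adm n b).card ≤ n := (Finset.card_le_card (Finset.filter_subset _ _)).trans (card_mu n)
  obtain ⟨c, hc⟩ := even_adm n hb
  obtain ⟨m, hm⟩ := hn
  omega

lemma mu_gcd {i ℓ : ℕ} {x : k} (h0 : x ≠ 0) (h1 : x ^ ℓ = 1) (h2 : x ^ 2 ^ i = x) :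
    x ^ Nat.gcd ℓ (2 ^ i - 1) = 1 := by
  refine pow_gcd_eq_one.mpr ⟨h1, ?_⟩
  have : x ^ (2 ^ i - 1) * x = 1 * x := by
    rw [← pow_succ, Nat.sub_add_cancel Nat.one_le_two_pow, h2, one_mul]
  exact mul_right_cancel₀ h0 this

open Classical in
lemma sum_b1 {i ℓ : ℕ} (hi : 1 ≤ i) (hℓ : Odd ℓ) :
    ∑ a ∈ mu k ℓ, cAB i ℓ a 1 ≤ (2 ^ i - 2) ^ 2 + (Nat.gcd ℓ (2 ^ i - 1) - 1) * (2 ^ i) ^ 2 := by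
  have hℓ0 : 0 < ℓ := hℓ.pos
  set g := Nat.gcd ℓ (2 ^ i - 1) with hg
  have hg0 : 0 < g := Nat.gcd_pos_of_pos_left _ hℓ0
  have hsub : mu k g ⊆ mu k ℓ := by
    intro x hx
    rw [mem_mu hg0] at hx
    rw [mem_mu hℓ0]
    obtain ⟨c, hc⟩ := Nat.gcd_dvd_left ℓ (2 ^ i - 1)
    change ℓ = g * c at hc
    rw [hc, pow_mul, hx, one_pow]
  have h1m : (1 : k) ∈ mu k g := by rw [mem_mu hg0, one_pow]
  calc ∑ a ∈ mu k ℓ, cAB i ℓ a 1 ≤ ∑ a ∈ mu k ℓ,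
        (if a ∈ mu k g then (if a = 1 then (2 ^ i - 2) ^ 2 else (2 ^ i) ^ 2) else 0) := by
        refine Finset.sum_le_sum fun a ha => ?_
        rw [mem_mu hℓ0] at ha
        unfold cAB
        have e1 : a + 1 + 1 = a := by linear_combination (CharTwo.two_eq_zero : (2 : k) = 0)
        have ha0 : a ≠ 0 := ne_zero_of_pow_odd hℓ ha
        rw [e1, if_pos ⟨ha, one_pow _, ha⟩]
        by_cases hc : cA i a a = 0 ∧ cA i 1 a = 0
        · rw [if_pos hc, if_pos rfl]
          have := typeIII_pow ha0 one_ne_zero ha0 e1.symm hc.1 hc.2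
          rw [if_pos ((mem_mu hg0).mpr (mu_gcd ha0 ha this.1))]
        · rw [if_neg hc, if_pos (Or.inl rfl)]
          exact Nat.zero_le _
    _ = ∑ a ∈ mu k g, (if a = 1 then (2 ^ i - 2) ^ 2 else (2 ^ i) ^ 2) := by
        rw [← Finset.sum_filter]
        congr 1
        ext x
        simp only [Finset.mem_filter]
        exact ⟨fun h => h.2, fun h => ⟨hsub h, h⟩⟩
    _ ≤ _ := by
        rw [← Finset.add_sum_erase _ _ h1m, if_pos rfl]
        refine Nat.add_le_add_left ?_ _
        rw [Finset.sum_congr rfl (g := fun _ => (2 ^ i) ^ 2)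
          (fun x hx => if_neg (Finset.ne_of_mem_erase hx)), Finset.sum_const, smul_eq_mul,
          Finset.card_erase_of_mem h1m]
        exact Nat.mul_le_mul_right _ (Nat.sub_le_sub_right (card_mu g) 1)

open Classical in
lemma sum_b {i ℓ : ℕ} (hi : 1 ≤ i) (hℓ : Odd ℓ) {b : k} (hb1 : b ≠ 1) (hb : b ^ ℓ = 1) :
    ∑ a ∈ mu k ℓ, cAB i ℓ a b ≤
      (if b ∈ mu k (Nat.gcd ℓ (2 ^ i - 1)) then
        2 * (2 ^ i) ^ 2 + (Nat.gcd ℓ (2 ^ i - 1) - 3) * (2 ^ i + 1) ^ 2 else 0) +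
      (ℓ - 1) * (if i = 1 ∨ ℓ ∣ 2 ^ i - 1 then 0 else 4 * 2 ^ i) := by
  have hℓ0 : 0 < ℓ := hℓ.pos
  set g := Nat.gcd ℓ (2 ^ i - 1) with hg
  set Z := (if i = 1 ∨ ℓ ∣ 2 ^ i - 1 then 0 else 4 * 2 ^ i) with hZ
  have hg0 : 0 < g := Nat.gcd_pos_of_pos_left _ hℓ0
  have hgodd : Odd g := Odd.of_dvd_nat hℓ (Nat.gcd_dvd_left _ _)
  have hsub : mu k g ⊆ mu k ℓ := by
    intro x hx
    rw [mem_mu hg0] at hx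
    rw [mem_mu hℓ0]
    obtain ⟨c, hc⟩ := Nat.gcd_dvd_left ℓ (2 ^ i - 1)
    change ℓ = g * c at hc
    rw [hc, pow_mul, hx, one_pow]
  have hpt : ∀ a ∈ mu k ℓ, cAB i ℓ a b ≤
      (if a ∈ adm g b then (if b ∈ mu k g then (if a = 1 ∨ a = b then (2 ^ i) ^ 2 else (2 ^ i + 1) ^ 2)
        else 0) else 0) + (if a ∈ adm ℓ b then Z else 0) := by
    intro a ha
    have ha' := (mem_mu hℓ0).mp ha
    unfold cAB
    by_cases h : a ^ ℓ = 1 ∧ b ^ ℓ = 1 ∧ (a + b + 1) ^ ℓ = 1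
    · rw [if_pos h]
      have ha0 : a ≠ 0 := ne_zero_of_pow_odd hℓ ha'
      have hb0 : b ≠ 0 := ne_zero_of_pow_odd hℓ hb
      have he0 : a + b + 1 ≠ 0 := ne_zero_of_pow_odd hℓ h.2.2
      have hadm : a ∈ adm ℓ b := Finset.mem_filter.mpr ⟨ha, (mem_mu hℓ0).mpr h.2.2⟩
      by_cases hc : cA i a (a + b + 1) = 0 ∧ cA i b (a + b + 1) = 0
      · rw [if_pos hc, if_neg hb1]
        have h3 := typeIII_pow ha0 hb0 he0 rfl hc.1 hc.2
        have h4 : a ∈ adm g b := Finset.mem_filter.mpr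
          ⟨(mem_mu hg0).mpr (mu_gcd ha0 ha' h3.1), (mem_mu hg0).mpr (mu_gcd he0 h.2.2 h3.2.2)⟩
        rw [if_pos h4, if_pos ((mem_mu hg0).mpr (mu_gcd hb0 hb h3.2.1))]
        exact Nat.le_add_right _ _
      · rw [if_neg hc, if_pos hadm]
        refine le_trans ?_ (Nat.le_add_left _ _)
        by_cases hi1 : i = 1
        · rw [if_pos (Or.inr hi1)]; exact Nat.zero_le _
        · rw [if_neg (not_or.mpr ⟨hb1, hi1⟩), hZ]
          by_cases hd : ℓ ∣ 2 ^ i - 1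
          · exfalso
            apply hc
            have key : ∀ x : k, x ^ ℓ = 1 → x ≠ 0 → x * x⁻¹ ^ 2 ^ i = 1 := by
              intro x hx h0
              obtain ⟨c, hcc⟩ := hd
              have e : 2 ^ i = ℓ * c + 1 := by
                have := Nat.one_le_two_pow (n := i); omega
              rw [e, pow_succ, pow_mul, inv_pow, hx]
              field_simp
              simp
            unfold cA
            rw [key a ha' ha0, key b hb hb0, key _ h.2.2 he0]
            exact ⟨CharTwo.add_self_eq_zero _, CharTwo.add_self_eq_zero _⟩
          · rw [if_neg (not_or.mpr ⟨hi1, hd⟩)]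
    · rw [if_neg h]; exact Nat.zero_le _
  refine (Finset.sum_le_sum hpt).trans ?_
  rw [Finset.sum_add_distrib]
  refine Nat.add_le_add ?_ ?_
  · rw [← Finset.sum_filter]
    have : (mu k ℓ).filter (fun a => a ∈ adm g b) = adm g b := by
      ext x
      simp only [Finset.mem_filter]
      exact ⟨fun h => h.2, fun h => ⟨hsub (Finset.mem_filter.mp h).1, h⟩⟩
    rw [this]
    by_cases hbg : b ∈ mu k g
    · simp only [if_pos hbg]
      have e1 : (1 : k) + b + 1 = b := by linear_combination (CharTwo.two_eq_zero : (2 : k) = 0)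
      have e2 : b + b + 1 = 1 := by linear_combination b * (CharTwo.two_eq_zero : (2 : k) = 0)
      have h1m : (1 : k) ∈ mu k g := by rw [mem_mu hg0, one_pow]
      have h1 : (1 : k) ∈ adm g b := Finset.mem_filter.mpr ⟨h1m, by rw [e1]; exact hbg⟩
      have h2 : b ∈ (adm g b).erase 1 := Finset.mem_erase.mpr ⟨hb1, Finset.mem_filter.mpr
        ⟨hbg, by rw [e2]; exact h1m⟩⟩
      rw [← Finset.add_sum_erase _ _ h1, ← Finset.add_sum_erase _ _ h2, if_pos (Or.inl rfl),
        if_pos (Or.inr rfl), ← add_assoc, ← two_mul]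
      refine Nat.add_le_add_left ?_ _
      rw [Finset.sum_congr rfl (g := fun _ => (2 ^ i + 1) ^ 2), Finset.sum_const, smul_eq_mul,
        Finset.card_erase_of_mem h2, Finset.card_erase_of_mem h1]
      · refine Nat.mul_le_mul_right _ ?_
        have := card_adm hgodd hb1
        omega
      · intro x hx
        rw [if_neg]
        rintro (h | h)
        · exact Finset.ne_of_mem_erase (Finset.mem_of_mem_erase hx) h
        · exact Finset.ne_of_mem_erase hx h
    · simp [hbg]
  · rw [← Finset.sum_filter]
    have : (mu k ℓ).filter (fun a => a ∈ adm ℓ b) = adm ℓ b := by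
      ext x
      simp only [Finset.mem_filter]
      exact ⟨fun h => h.2, fun h => ⟨(Finset.mem_filter.mp h).1, h⟩⟩
    rw [this, Finset.sum_const, smul_eq_mul]
    exact Nat.mul_le_mul_right _ (card_adm hℓ hb1)

open Classical in
lemma sum_all {i ℓ : ℕ} (hi : 1 ≤ i) (hℓ : Odd ℓ) :
    ∑ b ∈ mu k ℓ, ∑ a ∈ mu k ℓ, cAB i ℓ a b ≤
      (2 ^ i - 2) ^ 2 + (Nat.gcd ℓ (2 ^ i - 1) - 1) * (2 ^ i) ^ 2 +
      ((Nat.gcd ℓ (2 ^ i - 1) - 1) *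
        (2 * (2 ^ i) ^ 2 + (Nat.gcd ℓ (2 ^ i - 1) - 3) * (2 ^ i + 1) ^ 2) +
      (ℓ - 1) * ((ℓ - 1) * (if i = 1 ∨ ℓ ∣ 2 ^ i - 1 then 0 else 4 * 2 ^ i))) := by
  have hℓ0 : 0 < ℓ := hℓ.pos
  set g := Nat.gcd ℓ (2 ^ i - 1) with hg
  have hg0 : 0 < g := Nat.gcd_pos_of_pos_left _ hℓ0
  have h1 : (1 : k) ∈ mu k ℓ := by rw [mem_mu hℓ0, one_pow]
  have h1g : (1 : k) ∈ mu k g := by rw [mem_mu hg0, one_pow]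
  rw [← Finset.add_sum_erase _ _ h1]
  refine Nat.add_le_add (sum_b1 hi hℓ) ?_
  refine (Finset.sum_le_sum fun b hb => sum_b hi hℓ (Finset.ne_of_mem_erase hb)
    ((mem_mu hℓ0).mp (Finset.mem_of_mem_erase hb))).trans ?_
  rw [Finset.sum_add_distrib]
  refine Nat.add_le_add ?_ ?_
  · rw [← Finset.sum_filter, Finset.sum_const, smul_eq_mul]
    refine Nat.mul_le_mul_right _ ?_
    have hs : ((mu k ℓ).erase 1).filter (fun b => b ∈ mu k g) ⊆ (mu k g).erase 1 := by
      intro x hx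
      rw [Finset.mem_filter, Finset.mem_erase] at hx
      exact Finset.mem_erase.mpr ⟨hx.1.1, hx.2⟩
    refine (Finset.card_le_card hs).trans ?_
    rw [Finset.card_erase_of_mem h1g]
    exact Nat.sub_le_sub_right (card_mu g) 1
  · rw [Finset.sum_const, smul_eq_mul, Finset.card_erase_of_mem h1]
    exact Nat.mul_le_mul_right _ (Nat.sub_le_sub_right (card_mu ℓ) 1)

lemma arith1 {r ℓ : ℤ} (hℓ : 3 ≤ ℓ) (h : 3 * ℓ + 1 ≤ r) :
    (r - 2) ^ 2 + (ℓ - 1) * r ^ 2 + (ℓ - 1) * (2 * r ^ 2 + (ℓ - 3) * (r + 1) ^ 2) < (r * ℓ - 2) ^ 2 := by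
  have h1 : (ℓ - 3) * (2 * r + 1) * 3 ≤ (r - 10) * (2 * r + 1) := by
    nlinarith
  have h2 : 0 < r ^ 2 - 4 * r - (ℓ - 3) * (2 * r + 1) := by nlinarith
  have h3 : 0 < (ℓ - 1) * (r ^ 2 - 4 * r - (ℓ - 3) * (2 * r + 1)) := mul_pos (by linarith) h2
  nlinarith

lemma arith2 {r ℓ : ℤ} (hℓ : 3 ≤ ℓ) (h : 4 ≤ r) :
    (r - 2) ^ 2 + (ℓ - 1) * ((ℓ - 1) * (4 * r)) < (r * ℓ - 2) ^ 2 := by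
  have h3 : 0 < r * (ℓ - 1) * ((r - 4) * ℓ + r) :=
    mul_pos (mul_pos (by linarith) (by linarith)) (by nlinarith)
  nlinarith

lemma arith3 {r ℓ g : ℤ} (hg : 3 ≤ g) (hℓ : 3 * g ≤ ℓ) (h : 8 ≤ r) :
    (r - 2) ^ 2 + (g - 1) * r ^ 2 + ((g - 1) * (2 * r ^ 2 + (g - 3) * (r + 1) ^ 2) +
      (ℓ - 1) * ((ℓ - 1) * (4 * r))) < (r * ℓ - 2) ^ 2 := by
  have e : (r * ℓ - 2) ^ 2 - (r - 2) ^ 2 - (ℓ - 1) * ((ℓ - 1) * (4 * r)) =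
    r * (ℓ - 1) * ((r - 4) * ℓ + r) := by ring
  have h1 : r * (ℓ + 2) ≤ 2 * ((r - 4) * ℓ + r) := by nlinarith
  have h2 : (r + 1) ^ 2 ≤ 2 * r ^ 2 := by nlinarith
  have h3 : (g - 1) * ((g - 3) * (r + 1) ^ 2) ≤ (g - 1) * ((g - 3) * (2 * r ^ 2)) :=
    mul_le_mul_of_nonneg_left (mul_le_mul_of_nonneg_left h2 (by linarith)) (by linarith)
  have h4 : r * (ℓ - 1) * (r * (ℓ + 2)) ≤ r * (ℓ - 1) * (2 * ((r - 4) * ℓ + r)) :=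
    mul_le_mul_of_nonneg_left h1 (mul_nonneg (by linarith) (by linarith))
  have h5 : 2 * (3 * (g - 1) + (g - 1) * (2 * (g - 3))) < (ℓ - 1) * (ℓ + 2) := by nlinarith
  have h6 := mul_lt_mul_of_pos_left h5 (show 0 < r ^ 2 by positivity)
  nlinarith

lemma arith4 {ℓ : ℤ} (hℓ : 9 ≤ ℓ) :
    ((4:ℤ) - 2) ^ 2 + (3 - 1) * 4 ^ 2 + ((3 - 1) * (2 * 4 ^ 2 + (3 - 3) * (4 + 1) ^ 2) +
      (ℓ - 1) * ((ℓ - 1) * (4 * 4))) < (4 * ℓ - 2) ^ 2 := by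
  nlinarith

open Classical in
theorem sum_lt {i ℓ : ℕ} (hi : 1 ≤ i) (hℓ : Odd ℓ) (h3 : 3 ≤ ℓ) (hne : ℓ ≠ 2 ^ i - 1) :
    ∑ b ∈ mu k ℓ, ∑ a ∈ mu k ℓ, cAB i ℓ a b < (2 ^ i * ℓ - 2) ^ 2 := by
  refine lt_of_le_of_lt (sum_all hi hℓ) ?_
  have hr2 : 2 ≤ 2 ^ i := by
    calc 2 = 2 ^ 1 := rfl
      _ ≤ 2 ^ i := Nat.pow_le_pow_right (by norm_num) hi
  set g := Nat.gcd ℓ (2 ^ i - 1) with hg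
  have hg0 : 0 < g := Nat.gcd_pos_of_pos_left _ hℓ.pos
  have hgodd : Odd g := Odd.of_dvd_nat hℓ (Nat.gcd_dvd_left _ _)
  have hrodd : Odd (2 ^ i - 1) := by
    refine Nat.Even.sub_odd (by omega) ?_ odd_one
    exact (Nat.even_pow.mpr ⟨even_two, by omega⟩)
  have hrl : 2 ≤ 2 ^ i * ℓ := by nlinarith
  by_cases hd : ℓ ∣ 2 ^ i - 1
  · have hgl : g = ℓ := Nat.gcd_eq_left hd
    rw [if_pos (Or.inr hd), hgl]
    obtain ⟨m, hm⟩ := hd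
    have hmodd : Odd m := by
      rw [hm] at hrodd
      exact (Nat.odd_mul.mp hrodd).2
    have hm3 : 3 ≤ m := by
      obtain ⟨c, hc⟩ := hmodd
      rcases Nat.eq_zero_or_pos c with h | h
      · exfalso; apply hne; rw [hm, hc, h]; ring
      · omega
    have hr : 3 * ℓ + 1 ≤ 2 ^ i := by nlinarith [Nat.sub_add_cancel (show 1 ≤ 2 ^ i by omega)]
    have := arith1 (r := (2 : ℤ) ^ i) (ℓ := ℓ) (by exact_mod_cast h3) (by exact_mod_cast hr)
    zify [hr2, hrl, h3, show 1 ≤ ℓ by omega]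
    linarith
  · have hgl : g ≠ ℓ := fun h => hd (h ▸ Nat.gcd_dvd_right _ _)
    obtain ⟨m, hm⟩ := Nat.gcd_dvd_left ℓ (2 ^ i - 1)
    change ℓ = g * m at hm
    have hm3 : 3 ≤ m := by
      have hmodd : Odd m := by
        rw [hm] at hℓ
        exact (Nat.odd_mul.mp hℓ).2
      obtain ⟨c, hc⟩ := hmodd
      rcases Nat.eq_zero_or_pos c with h | h
      · exfalso; apply hgl; rw [hm, hc, h]; ring
      · omega
    have h3g : 3 * g ≤ ℓ := by rw [hm]; nlinarith
    by_cases hi1 : i = 1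
    · have hg1 : g = 1 := by rw [hg, hi1]; norm_num
      rw [if_pos (Or.inl hi1), hg1, hi1]
      have : 0 < 2 ^ 1 * ℓ - 2 := by omega
      have := pow_pos this 2
      simpa only [pow_one, Nat.sub_self, ne_eq, OfNat.ofNat_ne_zero, not_false_eq_true, zero_pow, zero_mul, mul_zero, add_zero] using this
    · rw [if_neg (not_or.mpr ⟨hi1, hd⟩)]
      have hr4 : 4 ≤ 2 ^ i := by
        calc 4 = 2 ^ 2 := rfl
          _ ≤ 2 ^ i := Nat.pow_le_pow_right (by norm_num) (by omega)
      by_cases hg1 : g = 1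
      · rw [hg1]
        have := arith2 (r := (2 : ℤ) ^ i) (ℓ := ℓ) (by exact_mod_cast h3) (by exact_mod_cast hr4)
        simp only [Nat.sub_self, zero_mul, zero_add, add_zero]
        zify [hr2, hrl, h3, show 1 ≤ ℓ by omega]
        linarith
      · have hg3 : 3 ≤ g := by
          obtain ⟨c, hc⟩ := hgodd
          omega
        by_cases hi2 : i = 2
        · have : g = 3 := by
            have h : g ∣ 2 ^ i - 1 := Nat.gcd_dvd_right _ _
            rw [hi2] at h
            have := Nat.le_of_dvd (by norm_num) h
            omega
          rw [this, hi2]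
          have := arith4 (ℓ := ℓ) (by omega)
          zify [show 2 ≤ 2 ^ 2 * ℓ by omega, show 1 ≤ ℓ by omega]
          norm_num at this ⊢
          linarith
        · have hr8 : 8 ≤ 2 ^ i := by
            calc 8 = 2 ^ 3 := rfl
              _ ≤ 2 ^ i := Nat.pow_le_pow_right (by norm_num) (by omega)
          have := arith3 (r := (2 : ℤ) ^ i) (ℓ := ℓ) (g := g) (by exact_mod_cast hg3)
            (by exact_mod_cast h3g) (by exact_mod_cast hr8)
          zify [hr2, hrl, h3, hg3, show 1 ≤ ℓ by omega, show 1 ≤ g by omega]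
          linarith
end Count


section FOne
variable {k : Type*} [Field k]

/-- the dehomogenised polynomial divided by `y + 1` -/
noncomputable def F1 (k : Type*) [Field k] (d : ℕ) : k[X][X] :=
  (∑ j ∈ Finset.range d, (X + C (X + 1)) ^ j * X ^ (d - 1 - j)) + C (∑ j ∈ Finset.range d, X ^ j)

lemma F1_mul [CharP k 2] (d : ℕ) :
    F1 k d * C (X + 1) = (X + C (X + 1)) ^ d + X ^ d + C (X ^ d + 1) := by
  have h2 : (2 : k[X]) = 0 := CharTwo.two_eq_zero
  have h2' : (2 : k[X][X]) = 0 := CharTwo.two_eq_zero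
  have h1 := Commute.geom_sum₂_mul (Commute.all (X + C (X + 1) : k[X][X]) X) d
  have h3 : (∑ j ∈ Finset.range d, (X : k[X]) ^ j) * (X - 1) = X ^ d - 1 := geom_sum_mul X d
  rw [add_sub_cancel_left] at h1
  unfold F1
  rw [add_mul, h1, ← C_mul]
  have h4 : (∑ j ∈ Finset.range d, (X : k[X]) ^ j) * (X + 1) = X ^ d + 1 := by
    linear_combination h3 + h2 * (∑ j ∈ Finset.range d, (X : k[X]) ^ j) - h2
  rw [h4]
  linear_combination - X ^ d * h2'

lemma F1_wtle (d : ℕ) : wtle (d - 1) (F1 k d) := by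
  have hX : wtle 1 (X : k[X][X]) := wtle_X
  have hA : wtle 1 (X + C (X + 1) : k[X][X]) := by
    rw [C_add, C_1]
    exact hX.add (wtle_CX.add (wtle_one.mono (by omega)))
  unfold F1
  refine wtle.add (wtle_sum _ _ fun j hj => ?_) ?_
  · have := (hA.pow j).mul (hX.pow (d - 1 - j))
    refine this.mono ?_
    have := Finset.mem_range.mp hj
    omega
  · rw [map_sum]
    refine wtle_sum _ _ fun j hj => ?_
    rw [C_pow]
    refine (wtle_CX.pow j).mono ?_
    have := Finset.mem_range.mp hj
    omega

lemma F1_coeff [CharP k 2] {d : ℕ} (hd : Odd d) (hd1 : 1 < d) : (F1 k d).coeff (d - 1) = 1 := by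
  unfold F1
  rw [coeff_add, finsetSum_coeff, coeff_C, if_neg (by omega), add_zero]
  rw [Finset.sum_congr rfl (g := fun _ => (1 : k[X]))]
  · rw [Finset.sum_const, Finset.card_range, nsmul_eq_mul, mul_one]
    obtain ⟨m, rfl⟩ := hd
    have : (2 : k[X]) = 0 := CharTwo.two_eq_zero
    push_cast
    rw [this]; ring
  · intro j hj
    have hj' := Finset.mem_range.mp hj
    have hm : ((X + C (X + 1) : k[X][X]) ^ j * X ^ (d - 1 - j)).Monic :=
      ((monic_X_add_C _).pow _).mul (monic_X_pow _)
    have hn : ((X + C (X + 1) : k[X][X]) ^ j * X ^ (d - 1 - j)).natDegree = d - 1 := by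
      rw [Monic.natDegree_mul ((monic_X_add_C _).pow _) (monic_X_pow _),
        (monic_X_add_C _).natDegree_pow, natDegree_X_add_C, natDegree_X_pow]
      omega
    have h5 := hm.coeff_natDegree
    rwa [hn] at h5

lemma F1_monic [CharP k 2] {d : ℕ} (hd : Odd d) (hd1 : 1 < d) : (F1 k d).Monic :=
  monic_of_natDegree_le_of_coeff_eq_one (d - 1) (F1_wtle d).natDegree_le (F1_coeff hd hd1)

lemma F1_natDegree [CharP k 2] {d : ℕ} (hd : Odd d) (hd1 : 1 < d) : (F1 k d).natDegree = d - 1 := by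
  refine le_antisymm (F1_wtle d).natDegree_le (le_natDegree_of_ne_zero ?_)
  rw [F1_coeff hd hd1]; exact one_ne_zero

/-- coefficientwise Frobenius -/
noncomputable def sig (k : Type*) [Field k] [CharP k 2] : k[X][X] →+* k[X][X] :=
  mapRingHom (mapRingHom (frobenius k 2))

lemma sig_F1 [CharP k 2] (d : ℕ) : sig k (F1 k d) = F1 k d := by
  unfold sig F1
  simp only [map_add, map_sum, map_mul, map_pow, map_one]
  simp only [coe_mapRingHom, map_X, map_C, Polynomial.map_add, Polynomial.map_one]

variable {Ω : Type*} [Field Ω] [CharP Ω 2] [Algebra k[X] Ω]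

lemma F1_eval [CharP k 2] (d : ℕ) (c : Ω) :
    (algebraMap k[X] Ω X + 1) * aeval c (F1 k d) = Fh d c (algebraMap k[X] Ω X) := by
  have := congrArg (aeval c) (F1_mul (k := k) d)
  simp only [map_mul, map_add, map_pow, aeval_C, aeval_X, map_one] at this
  rw [mul_comm, this]
  unfold Fh
  ring

lemma F1_der [CharP k 2] {d : ℕ} (hd : Odd d) (c : Ω) :
    (algebraMap k[X] Ω X + 1) * aeval c (derivative (F1 k d)) =
      c ^ (d - 1) + (c + algebraMap k[X] Ω X + 1) ^ (d - 1) := by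
  have := congrArg (fun p => aeval c (derivative p)) (F1_mul (k := k) d)
  have hd1 : ((d : ℕ) : Ω) = 1 := by
    obtain ⟨m, rfl⟩ := hd
    have : (2 : Ω) = 0 := CharTwo.two_eq_zero
    push_cast
    rw [this]; ring
  simp only [derivative_mul, derivative_add, derivative_pow, derivative_C, derivative_X, derivative_one, map_mul, map_add, map_pow, aeval_C, aeval_X, map_one, map_zero, map_natCast, hd1] at this
  rw [mul_comm]
  linear_combination this

lemma F1_der_ne [CharP k 2] [IsAlgClosed k] [FaithfulSMul k[X] Ω] {i ℓ : ℕ} (hi : 1 ≤ i) (hℓ : Odd ℓ)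
    {ρ : Ω} (h0 : Fh (2 ^ i * ℓ + 1) ρ (algebraMap k[X] Ω X) = 0) :
    ρ ^ (2 ^ i * ℓ) + (ρ + algebraMap k[X] Ω X + 1) ^ (2 ^ i * ℓ) ≠ 0 := by
  intro h
  set Y := algebraMap k[X] Ω X with hY
  have hinj := FaithfulSMul.algebraMap_injective k[X] Ω
  have h2 : (2 : Ω) = 0 := CharTwo.two_eq_zero
  have hY1 : Y + 1 ≠ 0 := by
    intro h
    have : algebraMap k[X] Ω (X + C 1) = 0 := by rw [map_add, C_1, map_one]; exact h
    exact X_add_C_ne_zero (1 : k) (hinj (by rw [this, map_zero]))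
  have hd0 : ℓ ≠ 0 := hℓ.pos.ne'
  rw [Fx_eq] at h
  have h := pow_eq_zero_iff (n := 2 ^ i) (by positivity) |>.mp h
  have hpw : (ρ + Y + 1) ^ ℓ = ρ ^ ℓ := by linear_combination h + h2 - h2 * ρ ^ ℓ
  have hρ0 : ρ ≠ 0 := by
    rintro rfl
    rw [zero_pow hd0] at hpw
    have := pow_eq_zero_iff hd0 |>.mp hpw
    exact hY1 (by simpa using this)
  obtain ⟨z, hz⟩ : ∃ z : k, algebraMap k[X] Ω (C z) = (ρ + Y + 1) / ρ := by
    have hs : (X ^ ℓ - 1 : k[X]).Splits := IsAlgClosed.splits _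
    have hs2 := hs.map ((algebraMap k[X] Ω).comp C)
    have hr := hs.roots_map ((algebraMap k[X] Ω).comp C)
    have hne : (X ^ ℓ - 1 : Polynomial Ω) ≠ 0 := X_pow_sub_C_ne_zero hℓ.pos (1 : Ω)
    have hm : (ρ + Y + 1) / ρ ∈ ((X ^ ℓ - 1 : k[X]).map ((algebraMap k[X] Ω).comp C)).roots := by
      rw [mem_roots']
      simp only [Polynomial.map_sub, Polynomial.map_pow, map_X, Polynomial.map_one]
      refine ⟨hne, ?_⟩
      simp only [IsRoot, eval_sub, eval_pow, eval_X, eval_one, div_pow, hpw]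
      rw [div_self (pow_ne_zero _ hρ0), sub_self]
    rw [hr, Multiset.mem_map] at hm
    obtain ⟨z, -, hz⟩ := hm
    exact ⟨z, hz⟩
  have hw : ρ + Y + 1 = algebraMap k[X] Ω (C z) * ρ := by rw [hz]; field_simp
  have hz1 : z - 1 ≠ 0 := by
    intro h
    have : z = 1 := by linear_combination h
    rw [this, C_1, map_one, one_mul] at hw
    exact hY1 (by linear_combination hw)
  have hη : algebraMap k[X] Ω (C (z - 1)⁻¹) * algebraMap k[X] Ω (C (z - 1)) = 1 := by
    rw [← map_mul, ← C_mul, inv_mul_cancel₀ hz1, C_1, map_one]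
  have hρ : ρ = algebraMap k[X] Ω (C (z - 1)⁻¹) * (Y + 1) := by
    have : Y + 1 = algebraMap k[X] Ω (C (z - 1)) * ρ := by
      rw [C_sub, map_sub, C_1, map_one]; linear_combination hw
    rw [this, ← mul_assoc, hη, one_mul]
  have hw' : (ρ + Y + 1) ^ (2 ^ i * ℓ) = ρ ^ (2 ^ i * ℓ) := by
    rw [mul_comm, pow_mul, hpw, ← pow_mul]
  have hfin : algebraMap k[X] Ω (C (((z - 1)⁻¹) ^ (2 ^ i * ℓ)) * (X + 1) ^ (2 ^ i * ℓ + 1)) =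
      algebraMap k[X] Ω (X ^ (2 ^ i * ℓ + 1) + 1) := by
    simp only [map_mul, map_add, map_pow, map_one, ← hY]
    unfold Fh at h0
    rw [pow_succ ρ, pow_succ (ρ + Y + 1), hw'] at h0
    have h5 : ρ ^ (2 ^ i * ℓ) = algebraMap k[X] Ω (C (z - 1)⁻¹) ^ (2 ^ i * ℓ) * (Y + 1) ^ (2 ^ i * ℓ) := by
      rw [← mul_pow, ← hρ]
    rw [pow_succ (Y + 1), ← mul_assoc, ← h5]
    linear_combination h0 - h2 * (ρ ^ (2 ^ i * ℓ) * ρ) - h2 * (Y ^ (2 ^ i * ℓ + 1) + 1)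
  have := congrArg (fun p : k[X] => eval 1 (derivative p)) (hinj hfin)
  have h2k : (2 : k) = 0 := CharTwo.two_eq_zero
  have h11 : (1 : k) + 1 = 0 := by linear_combination h2k
  have hne : 2 ^ i * ℓ ≠ 0 := by positivity
  simp [derivative_pow, h11, hne] at this
  rw [h2k, zero_pow (by omega)] at this
  simp at this
end FOne


section Glob
variable {k : Type*} [Field k] [IsAlgClosed k] [CharP k 2]
variable {Ω : Type*} [Field Ω] [IsAlgClosed Ω] [CharP Ω 2] [Algebra k[X] Ω] [FaithfulSMul k[X] Ω]

open Classical in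
/-- all roots -/
noncomputable def rts (k Ω : Type*) [Field k] [Field Ω] [Algebra k[X] Ω] (d : ℕ) : Finset Ω :=
  ((F1 k d).map (algebraMap k[X] Ω)).roots.toFinset

open Classical in
/-- roots other than the trivial ones -/
noncomputable def rts0 (k Ω : Type*) [Field k] [Field Ω] [Algebra k[X] Ω] (d : ℕ) : Finset Ω :=
  ((rts k Ω d).erase 1).erase (algebraMap k[X] Ω X)

variable {i ℓ : ℕ}

lemma d_odd (hi : 1 ≤ i) : Odd (2 ^ i * ℓ + 1) := by
  refine Even.add_one (Even.mul_right ?_ _)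
  exact (Nat.even_pow.mpr ⟨even_two, by omega⟩)

lemma d_gt (hℓ : Odd ℓ) : 1 < 2 ^ i * ℓ + 1 := by
  have := Nat.mul_pos (pow_pos (show 0 < 2 by norm_num) i) hℓ.pos
  omega

lemma F1_map_ne (hi : 1 ≤ i) (hℓ : Odd ℓ) :
    (F1 k (2 ^ i * ℓ + 1)).map (algebraMap k[X] Ω) ≠ 0 :=
  ((F1_monic (d_odd hi) (d_gt hℓ)).map _).ne_zero

lemma mem_rts (hi : 1 ≤ i) (hℓ : Odd ℓ) {ρ : Ω} :
    ρ ∈ rts k Ω (2 ^ i * ℓ + 1) ↔ aeval ρ (F1 k (2 ^ i * ℓ + 1)) = 0 := by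
  classical
  unfold rts
  rw [Multiset.mem_toFinset, mem_roots (F1_map_ne hi hℓ), IsRoot, eval_map_algebraMap]

lemma Y_ne_one : algebraMap k[X] Ω X + 1 ≠ 0 := by
  intro h
  have hinj := FaithfulSMul.algebraMap_injective k[X] Ω
  have : algebraMap k[X] Ω (X + C 1) = 0 := by rw [map_add, C_1, map_one]; exact h
  exact X_add_C_ne_zero (1 : k) (hinj (by rw [this, map_zero]))

lemma mem_rts_iff (hi : 1 ≤ i) (hℓ : Odd ℓ) {ρ : Ω} :
    ρ ∈ rts k Ω (2 ^ i * ℓ + 1) ↔ Fh (2 ^ i * ℓ + 1) ρ (algebraMap k[X] Ω X) = 0 := by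
  rw [mem_rts hi hℓ, ← F1_eval]
  simp [Y_ne_one]

lemma rts_nodup (hi : 1 ≤ i) (hℓ : Odd ℓ) :
    ((F1 k (2 ^ i * ℓ + 1)).map (algebraMap k[X] Ω)).roots.Nodup := by
  classical
  rw [Multiset.nodup_iff_count_le_one]
  intro ρ
  rw [count_roots]
  by_contra hc
  push Not at hc
  obtain ⟨h2, h1⟩ := (one_lt_rootMultiplicity_iff_isRoot (F1_map_ne hi hℓ)).mp hc
  rw [IsRoot, derivative_map, eval_map_algebraMap] at h1
  rw [IsRoot, eval_map_algebraMap] at h2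
  have h3 := F1_der (k := k) (d_odd (ℓ := ℓ) hi) ρ
  rw [h1, mul_zero, Nat.add_sub_cancel] at h3
  refine F1_der_ne hi hℓ ?_ h3.symm
  rw [← F1_eval, h2, mul_zero]

lemma prod_nodup {p : Polynomial Ω} (hm : p.Monic) (hn : p.roots.Nodup) [DecidableEq Ω] :
    p = ∏ ρ ∈ p.roots.toFinset, (X - C ρ) := by
  have h := (IsAlgClosed.splits p).eq_prod_roots_of_monic hm
  conv_lhs => rw [h]
  rw [Finset.prod_eq_multiset_prod, Multiset.toFinset_val, Multiset.dedup_eq_self.mpr hn]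

lemma F1_prod (hi : 1 ≤ i) (hℓ : Odd ℓ) :
    (F1 k (2 ^ i * ℓ + 1)).map (algebraMap k[X] Ω) =
      ∏ ρ ∈ rts k Ω (2 ^ i * ℓ + 1), (X - C ρ) := by
  classical
  have := prod_nodup ((F1_monic (d_odd (ℓ := ℓ) hi) (d_gt hℓ)).map (algebraMap k[X] Ω)) (rts_nodup hi hℓ)
  unfold rts
  convert this

lemma one_mem_rts (hi : 1 ≤ i) (hℓ : Odd ℓ) : (1 : Ω) ∈ rts k Ω (2 ^ i * ℓ + 1) := by
  rw [mem_rts_iff hi hℓ]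
  unfold Fh
  have h2 : (2 : Ω) = 0 := CharTwo.two_eq_zero
  have : (1 : Ω) + algebraMap k[X] Ω X + 1 = algebraMap k[X] Ω X := by linear_combination h2
  rw [this, one_pow]
  linear_combination (1 + algebraMap k[X] Ω X ^ (2 ^ i * ℓ + 1)) * h2

lemma Y_mem_rts (hi : 1 ≤ i) (hℓ : Odd ℓ) :
    algebraMap k[X] Ω X ∈ rts k Ω (2 ^ i * ℓ + 1) := by
  rw [mem_rts_iff hi hℓ]
  unfold Fh
  have h2 : (2 : Ω) = 0 := CharTwo.two_eq_zero
  have : algebraMap k[X] Ω X + algebraMap k[X] Ω X + 1 = 1 := by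
    linear_combination algebraMap k[X] Ω X * h2
  rw [this, one_pow]
  linear_combination (1 + algebraMap k[X] Ω X ^ (2 ^ i * ℓ + 1)) * h2

lemma Y_ne_one' : algebraMap k[X] Ω X ≠ 1 := fun h => by
  refine Y_ne_one (k := k) (Ω := Ω) ?_
  rw [h]; exact CharTwo.add_self_eq_zero _

lemma card_rts (hi : 1 ≤ i) (hℓ : Odd ℓ) : (rts k Ω (2 ^ i * ℓ + 1)).card = 2 ^ i * ℓ := by
  have := congrArg natDegree (F1_prod (k := k) (Ω := Ω) hi hℓ)
  rw [natDegree_prod_of_monic _ _ (fun ρ _ => monic_X_sub_C ρ),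
    (F1_monic (d_odd (ℓ := ℓ) hi) (d_gt hℓ)).natDegree_map,
    F1_natDegree (d_odd hi) (d_gt hℓ)] at this
  simpa using this.symm

lemma card_rts0 (hi : 1 ≤ i) (hℓ : Odd ℓ) : (rts0 k Ω (2 ^ i * ℓ + 1)).card = 2 ^ i * ℓ - 2 := by
  classical
  unfold rts0
  rw [Finset.card_erase_of_mem, Finset.card_erase_of_mem (one_mem_rts hi hℓ), card_rts hi hℓ]
  · omega
  · exact Finset.mem_erase.mpr ⟨Y_ne_one', Y_mem_rts hi hℓ⟩

lemma rts_prod (hi : 1 ≤ i) (hℓ : Odd ℓ) (c : Ω) :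
    (algebraMap k[X] Ω X + 1) * ∏ ρ ∈ rts k Ω (2 ^ i * ℓ + 1), (c - ρ) =
      Fh (2 ^ i * ℓ + 1) c (algebraMap k[X] Ω X) := by
  rw [← F1_eval, ← eval_map_algebraMap, F1_prod hi hℓ, eval_prod]
  simp

lemma rts_der [DecidableEq Ω] (hi : 1 ≤ i) (hℓ : Odd ℓ) {ρ : Ω} (hρ : ρ ∈ rts k Ω (2 ^ i * ℓ + 1)) :
    (algebraMap k[X] Ω X + 1) * ∏ ρ' ∈ (rts k Ω (2 ^ i * ℓ + 1)).erase ρ, (ρ - ρ') =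
      ρ ^ (2 ^ i * ℓ) + (ρ + algebraMap k[X] Ω X + 1) ^ (2 ^ i * ℓ) := by
  have h := F1_der (k := k) (d_odd (ℓ := ℓ) hi) ρ
  rw [Nat.add_sub_cancel] at h
  rw [← h, ← eval_map_algebraMap, ← derivative_map, F1_prod hi hℓ,
    ← Finset.mul_prod_erase _ _ hρ, derivative_mul]
  simp [eval_prod]

end Glob


section Comps
variable {k : Type*} [Field k] [IsAlgClosed k] [CharP k 2]
variable {Ω : Type*} [Field Ω] [IsAlgClosed Ω] [CharP Ω 2] [Algebra k[X] Ω] [FaithfulSMul k[X] Ω]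
variable {i ℓ : ℕ}

lemma rts_int (hi : 1 ≤ i) (hℓ : Odd ℓ) {ρ : Ω} (hρ : ρ ∈ rts k Ω (2 ^ i * ℓ + 1)) :
    IsIntegral k[X] ρ :=
  ⟨_, F1_monic (d_odd hi) (d_gt hℓ), (mem_rts hi hℓ).mp hρ⟩

lemma minpoly_eq_of_irr {u : k[X][X]} (hm : u.Monic) (hu : Irreducible u) {ρ : Ω}
    (h : aeval ρ u = 0) : minpoly k[X] ρ = u := by
  have hintg : IsIntegral k[X] ρ := ⟨u, hm, h⟩
  have hd := minpoly.isIntegrallyClosed_dvd hintg h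
  have ha := (minpoly.irreducible hintg).associated_of_dvd hu hd
  exact eq_of_monic_of_associated (minpoly.monic hintg) hm ha

lemma irr_prod [DecidableEq k[X][X]] (hi : 1 ≤ i) (hℓ : Odd ℓ) {u : k[X][X]} (hm : u.Monic) (hu : Irreducible u)
    (hd : u ∣ F1 k (2 ^ i * ℓ + 1)) :
    u.map (algebraMap k[X] Ω) =
      ∏ ρ ∈ rts k Ω (2 ^ i * ℓ + 1) with minpoly k[X] ρ = u, (X - C ρ) := by
  classical
  have hle := Polynomial.roots.le_of_dvd (F1_map_ne (k := k) (Ω := Ω) hi hℓ) (Polynomial.map_dvd (algebraMap k[X] Ω) hd)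
  have hn := Multiset.nodup_of_le hle (rts_nodup hi hℓ)
  rw [prod_nodup (hm.map (algebraMap k[X] Ω)) hn]
  refine Finset.prod_congr ?_ fun _ _ => rfl
  ext ρ
  rw [Multiset.mem_toFinset, mem_roots (hm.map _).ne_zero, IsRoot, eval_map_algebraMap, Finset.mem_filter]
  constructor
  · intro h
    refine ⟨(mem_rts hi hℓ).mpr ?_, minpoly_eq_of_irr hm hu h⟩
    obtain ⟨w, hw⟩ := hd
    rw [hw, map_mul, h, zero_mul]
  · rintro ⟨h1, rfl⟩
    exact minpoly.aeval _ _

/-- components -/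
def IsCmp (d : ℕ) (u : k[X][X]) : Prop :=
  u.Monic ∧ Irreducible u ∧ u ∣ F1 k d ∧ u ≠ X - C 1 ∧ u ≠ X - C X

lemma aeval_lin (a : k[X]) : aeval (algebraMap k[X] Ω a) (X - C a : k[X][X]) = 0 := by
  rw [map_sub, aeval_X, aeval_C, sub_self]

lemma IsCmp.not_one {d : ℕ} {u : k[X][X]} (h : IsCmp d u) {a : k[X]} (ha : u ≠ X - C a) :
    minpoly k[X] (algebraMap k[X] Ω a) ≠ u := by
  intro h1
  apply ha
  rw [← h1]
  exact minpoly_eq_of_irr (monic_X_sub_C _) (irreducible_X_sub_C _) (aeval_lin a)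

lemma IsCmp.of_mem (hi : 1 ≤ i) (hℓ : Odd ℓ) {ρ : Ω} (h : ρ ∈ rts0 k Ω (2 ^ i * ℓ + 1)) :
    IsCmp (2 ^ i * ℓ + 1) (minpoly k[X] ρ) := by
  classical
  unfold rts0 at h
  rw [Finset.mem_erase, Finset.mem_erase] at h
  obtain ⟨hY, h1, hr⟩ := h
  have hintg := rts_int hi hℓ hr
  refine ⟨minpoly.monic hintg, minpoly.irreducible hintg,
    minpoly.isIntegrallyClosed_dvd hintg ((mem_rts hi hℓ).mp hr), fun h => h1 ?_, fun h => hY ?_⟩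
  · have := minpoly.aeval k[X] ρ
    rw [h, map_sub, aeval_X, aeval_C, map_one] at this
    linear_combination this
  · have := minpoly.aeval k[X] ρ
    rw [h, map_sub, aeval_X, aeval_C] at this
    linear_combination this

lemma IsCmp.prod [DecidableEq k[X][X]] (hi : 1 ≤ i) (hℓ : Odd ℓ) {u : k[X][X]} (h : IsCmp (2 ^ i * ℓ + 1) u) :
    u.map (algebraMap k[X] Ω) =
      ∏ ρ ∈ rts0 k Ω (2 ^ i * ℓ + 1) with minpoly k[X] ρ = u, (X - C ρ) := by
  classical
  rw [irr_prod hi hℓ h.1 h.2.1 h.2.2.1]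
  refine Finset.prod_congr ?_ fun _ _ => rfl
  ext ρ
  unfold rts0
  simp only [Finset.mem_filter, Finset.mem_erase]
  have h1 := h.not_one (Ω := Ω) h.2.2.2.1
  have h2 := h.not_one (Ω := Ω) h.2.2.2.2
  rw [map_one] at h1
  constructor
  · rintro ⟨ha, hb⟩
    refine ⟨⟨?_, ?_, ha⟩, hb⟩
    · rintro rfl; exact h2 hb
    · rintro rfl; exact h1 hb
  · rintro ⟨⟨-, -, ha⟩, hb⟩
    exact ⟨ha, hb⟩

lemma IsCmp.card [DecidableEq k[X][X]] (Ω : Type*) [Field Ω] [IsAlgClosed Ω] [CharP Ω 2] [Algebra k[X] Ω] [FaithfulSMul k[X] Ω]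
    (hi : 1 ≤ i) (hℓ : Odd ℓ) {u : k[X][X]} (h : IsCmp (2 ^ i * ℓ + 1) u) :
    ((rts0 k Ω (2 ^ i * ℓ + 1)).filter (fun ρ => minpoly k[X] ρ = u)).card = u.natDegree := by
  have := congrArg natDegree (h.prod (Ω := Ω) hi hℓ)
  rw [natDegree_prod_of_monic _ _ (fun ρ _ => monic_X_sub_C ρ), h.1.natDegree_map] at this
  simpa using this.symm

lemma IsCmp.pos {d : ℕ} {u : k[X][X]} (h : IsCmp d u) : 0 < u.natDegree := by
  rcases Nat.eq_zero_or_pos u.natDegree with h0 | h0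
  · exact absurd (h.1.natDegree_eq_zero.mp h0 ▸ isUnit_one) h.2.1.1
  · exact h0

lemma IsCmp.wt (hi : 1 ≤ i) (hℓ : Odd ℓ) {u : k[X][X]} (h : IsCmp (2 ^ i * ℓ + 1) u) : wtle u.natDegree u := by
  obtain ⟨v, hv⟩ := h.2.2.1
  have hF := F1_monic (k := k) (d_odd (ℓ := ℓ) hi) (d_gt hℓ)
  refine wtle_factor hv h.1 ?_ ?_
  · exact h.1.of_mul_monic_left (hv ▸ hF)
  · rw [F1_natDegree (d_odd hi) (d_gt hℓ)]; exact F1_wtle _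

/-- sig as an equivalence -/
noncomputable def sigE (k : Type*) [Field k] [IsAlgClosed k] [CharP k 2] : k[X][X] ≃+* k[X][X] :=
  mapEquiv (mapEquiv (frobeniusEquiv k 2))

lemma sigE_apply (p : k[X][X]) : sigE k p = sig k p := by
  ext m n
  simp [sigE, sig, mapEquiv]

lemma sig_coeff (p : k[X][X]) (m n : ℕ) : ((sig k p).coeff m).coeff n = ((p.coeff m).coeff n) ^ 2 := by
  simp [sig, frobenius_def]

lemma sig_inj : Function.Injective (sig k) := by
  intro p q h
  rw [← sigE_apply, ← sigE_apply] at h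
  exact (sigE k).injective h

lemma sig_monic {u : k[X][X]} (h : u.Monic) : (sig k u).Monic := by
  unfold sig; exact h.map _

lemma sig_natDegree {u : k[X][X]} (h : u.Monic) : (sig k u).natDegree = u.natDegree := by
  unfold sig; exact h.natDegree_map _

lemma IsCmp.sigma {d : ℕ} {u : k[X][X]} (h : IsCmp d u) : IsCmp d (sig k u) := by
  obtain ⟨h1, h2, h3, h4, h5⟩ := h
  refine ⟨sig_monic h1, ?_, ?_, fun h => h4 (sig_inj ?_), fun h => h5 (sig_inj ?_)⟩
  · rw [← sigE_apply]
    exact (MulEquiv.irreducible_iff (sigE k).toMulEquiv).mpr h2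
  · have := map_dvd (sig k) h3
    rwa [sig_F1] at this
  · rw [h]; simp [_root_.sig]
  · rw [h]; simp [_root_.sig]

lemma cmp_resultant [DecidableEq k[X][X]] (hi : 1 ≤ i) (hℓ : Odd ℓ) {u u' : k[X][X]}
    (h : IsCmp (2 ^ i * ℓ + 1) u) (h' : IsCmp (2 ^ i * ℓ + 1) u') :
    ∃ g : k[X], algebraMap k[X] Ω g =
      ∏ ρ ∈ rts0 k Ω (2 ^ i * ℓ + 1) with minpoly k[X] ρ = u,
        ∏ ρ' ∈ rts0 k Ω (2 ^ i * ℓ + 1) with minpoly k[X] ρ' = u', (ρ - ρ') := by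
  classical
  refine ⟨resultant u u' u.natDegree u'.natDegree, ?_⟩
  rw [← resultant_map_map, ← h.1.natDegree_map (algebraMap k[X] Ω), resultant_eq_prod_eval _ _ _ _ (IsAlgClosed.splits _),
    (h.1.map _).leadingCoeff, one_pow, one_mul]
  · rw [h.prod (Ω := Ω) hi hℓ, h'.prod (Ω := Ω) hi hℓ, roots_prod_X_sub_C]
    change (∏ ρ ∈ _, _) = _
    refine Finset.prod_congr rfl fun ρ _ => ?_
    simp [eval_prod]
  · rw [h'.1.natDegree_map]
end Comps


section Weights
variable {k : Type*} [Field k] [IsAlgClosed k] [CharP k 2]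
variable {Ω : Type*} [Field Ω] [IsAlgClosed Ω] [CharP Ω 2] [Algebra k[X] Ω] [FaithfulSMul k[X] Ω]
variable {i ℓ : ℕ}

open Classical in
/-- weights -/
noncomputable def WW (Ω : Type*) [Field Ω] [Algebra k[X] Ω] (ρ ρ' : Ω) : ℕ :=
  if minpoly k[X] ρ = minpoly k[X] ρ' then 0 else
    1 + if minpoly k[X] ρ' = sig k (minpoly k[X] ρ) then 1 else 0

lemma WW_le (ρ ρ' : Ω) : WW (k := k) Ω ρ ρ' ≤ 2 := by
  unfold WW
  split_ifs <;> omega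

lemma WW_zero {ρ ρ' : Ω} (h : minpoly k[X] ρ = minpoly k[X] ρ') : WW (k := k) Ω ρ ρ' = 0 := by
  unfold WW
  rw [if_pos h]

lemma WW_row [DecidableEq k[X][X]] (hi : 1 ≤ i) (hℓ : Odd ℓ)
    (hns : ∀ u : k[X][X], IsCmp (2 ^ i * ℓ + 1) u → sig k u ≠ u)
    {N : Finset Ω} (hN : N ⊆ rts0 k Ω (2 ^ i * ℓ + 1)) {ρ : Ω} (hρ : ρ ∈ N) :
    (∑ ρ' ∈ N, WW (k := k) Ω ρ ρ') + (N.filter (fun ρ' => minpoly k[X] ρ' = minpoly k[X] ρ)).card =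
      N.card + (N.filter (fun ρ' => minpoly k[X] ρ' = sig k (minpoly k[X] ρ))).card := by
  rw [Finset.card_filter, Finset.card_filter, Finset.card_eq_sum_ones, ← Finset.sum_add_distrib,
    ← Finset.sum_add_distrib]
  refine Finset.sum_congr rfl fun ρ' _ => ?_
  have h := hns _ (IsCmp.of_mem hi hℓ (hN hρ))
  unfold WW
  by_cases h1 : minpoly k[X] ρ = minpoly k[X] ρ'
  · rw [if_pos h1, if_pos h1.symm, if_neg (by rw [← h1]; exact h.symm)]
  · rw [if_neg h1, if_neg (Ne.symm h1)]
    split_ifs <;> rfl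

lemma fib_sum {α β : Type*} [DecidableEq β] (N : Finset α) (c : α → β) (f : β → ℕ) :
    ∑ ρ ∈ N, f (c ρ) = ∑ u ∈ N.image c, (N.filter (fun ρ => c ρ = u)).card * f u := by
  rw [← Finset.sum_fiberwise_of_maps_to (t := N.image c) (g := c) (fun x hx => Finset.mem_image_of_mem c hx)]
  refine Finset.sum_congr rfl fun u _ => ?_
  rw [Finset.sum_congr rfl (g := fun _ => f u)]
  · rw [Finset.sum_const, smul_eq_mul]
  · intro x hx
    rw [(Finset.mem_filter.mp hx).2]

lemma amgm {α β : Type*} [DecidableEq β] (N : Finset α) (c : α → β) (σ : β → β)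
    (hσ : Function.Injective σ) :
    ∑ ρ ∈ N, (N.filter (fun ρ' => c ρ' = σ (c ρ))).card ≤
      ∑ ρ ∈ N, (N.filter (fun ρ' => c ρ' = c ρ)).card := by
  rw [fib_sum N c (fun u => (N.filter (fun ρ' => c ρ' = σ u)).card),
    fib_sum N c (fun u => (N.filter (fun ρ' => c ρ' = u)).card)]
  set n : β → ℕ := fun u => (N.filter (fun ρ' => c ρ' = u)).card with hn
  change ∑ u ∈ N.image c, n u * n (σ u) ≤ ∑ u ∈ N.image c, n u * n u
  have h1 : ∑ u ∈ N.image c, n (σ u) * n (σ u) ≤ ∑ u ∈ N.image c, n u * n u := by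
    rw [← Finset.sum_image (s := N.image c) (g := σ) (f := fun u => n u * n u) (fun x _ y _ h => hσ h)]
    rw [← Finset.sum_inter_add_sum_sdiff ((N.image c).image σ) (N.image c)]
    have h0 : ∑ u ∈ (N.image c).image σ \ N.image c, n u * n u = 0 := by
      refine Finset.sum_eq_zero fun u hu => ?_
      have : n u = 0 := by
        rw [hn, Finset.card_eq_zero, Finset.filter_eq_empty_iff]
        intro x hx hxu
        exact (Finset.mem_sdiff.mp hu).2 (hxu ▸ Finset.mem_image_of_mem c hx)
      rw [this, mul_zero]
    rw [h0, add_zero]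
    exact Finset.sum_le_sum_of_subset Finset.inter_subset_right
  have h2 : ∑ u ∈ N.image c, 2 * (n u * n (σ u)) ≤ ∑ u ∈ N.image c, (n u * n u + n (σ u) * n (σ u)) := by
    refine Finset.sum_le_sum fun u _ => ?_
    nlinarith [two_mul_le_add_sq (n u) (n (σ u))]
  rw [← Finset.mul_sum, Finset.sum_add_distrib] at h2
  omega

lemma WW_sum (hi : 1 ≤ i) (hℓ : Odd ℓ)
    (hns : ∀ u : k[X][X], IsCmp (2 ^ i * ℓ + 1) u → sig k u ≠ u)
    {N : Finset Ω} (hN : N ⊆ rts0 k Ω (2 ^ i * ℓ + 1)) :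
    ∑ ρ ∈ N, ∑ ρ' ∈ N, WW (k := k) Ω ρ ρ' ≤ N.card ^ 2 := by
  classical
  have h1 := Finset.sum_congr (rfl : N = N) fun ρ hρ => WW_row hi hℓ hns hN hρ
  rw [Finset.sum_add_distrib, Finset.sum_add_distrib, Finset.sum_const, smul_eq_mul] at h1
  have h2 := amgm N (minpoly k[X]) (sig k) sig_inj
  rw [sq]
  omega

lemma WW_total (hi : 1 ≤ i) (hℓ : Odd ℓ)
    (hns : ∀ u : k[X][X], IsCmp (2 ^ i * ℓ + 1) u → sig k u ≠ u) :
    ∑ ρ ∈ rts0 k Ω (2 ^ i * ℓ + 1), ∑ ρ' ∈ rts0 k Ω (2 ^ i * ℓ + 1), WW (k := k) Ω ρ ρ' =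
      (2 ^ i * ℓ - 2) ^ 2 := by
  classical
  have h1 := Finset.sum_congr (rfl : rts0 k Ω (2 ^ i * ℓ + 1) = _) fun ρ hρ => WW_row hi hℓ hns (Finset.Subset.refl _) hρ
  rw [Finset.sum_add_distrib, Finset.sum_add_distrib, Finset.sum_const, smul_eq_mul, card_rts0 hi hℓ] at h1
  have h2 := Finset.sum_congr (rfl : rts0 k Ω (2 ^ i * ℓ + 1) = _) fun ρ hρ =>
    ((IsCmp.of_mem hi hℓ hρ).card Ω hi hℓ).trans
      ((sig_natDegree (IsCmp.of_mem hi hℓ hρ).1).symm.trans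
      ((IsCmp.of_mem hi hℓ hρ).sigma.card Ω hi hℓ).symm)
  rw [sq]
  omega

lemma prod_range (hi : 1 ≤ i) (hℓ : Odd ℓ) :
    ∃ g : k[X], g ≠ 0 ∧ algebraMap k[X] Ω g =
      ∏ ρ ∈ rts0 k Ω (2 ^ i * ℓ + 1), ∏ ρ' ∈ rts0 k Ω (2 ^ i * ℓ + 1),
        (ρ - ρ') ^ WW (k := k) Ω ρ ρ' := by
  classical
  set S := rts0 k Ω (2 ^ i * ℓ + 1) with hS
  have hne : ∏ ρ ∈ S, ∏ ρ' ∈ S, (ρ - ρ') ^ WW (k := k) Ω ρ ρ' ≠ 0 := by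
    refine Finset.prod_ne_zero_iff.mpr fun ρ _ => Finset.prod_ne_zero_iff.mpr fun ρ' _ => ?_
    by_cases h : ρ = ρ'
    · rw [WW_zero (by rw [h]), pow_zero]; exact one_ne_zero
    · exact pow_ne_zero _ (sub_ne_zero.mpr h)
  suffices h : ∏ ρ ∈ S, ∏ ρ' ∈ S, (ρ - ρ') ^ WW (k := k) Ω ρ ρ' ∈ (algebraMap k[X] Ω).range by
    obtain ⟨g, hg⟩ := h
    refine ⟨g, ?_, hg⟩
    rintro rfl
    rw [map_zero] at hg
    exact hne hg.symm
  set c : Ω → k[X][X] := minpoly k[X] with hc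
  set U := S.image c with hU
  have hm : ∀ x ∈ S, c x ∈ U := fun x hx => Finset.mem_image_of_mem c hx
  rw [← Finset.prod_fiberwise_of_maps_to (t := U) (g := c) hm]
  refine Subring.prod_mem _ fun u hu => ?_
  rw [Finset.prod_congr rfl (g := fun ρ => ∏ u' ∈ U, ∏ ρ' ∈ S with c ρ' = u', (ρ - ρ') ^ WW (k := k) Ω ρ ρ')
    (fun ρ _ => (Finset.prod_fiberwise_of_maps_to (t := U) (g := c) hm _).symm)]
  rw [Finset.prod_comm]
  refine Subring.prod_mem _ fun u' hu' => ?_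
  obtain ⟨r, hr, rfl⟩ := Finset.mem_image.mp hu
  obtain ⟨r', hr', rfl⟩ := Finset.mem_image.mp hu'
  have : ∏ ρ ∈ S with c ρ = c r, ∏ ρ' ∈ S with c ρ' = c r', (ρ - ρ') ^ WW (k := k) Ω ρ ρ' =
      (∏ ρ ∈ S with c ρ = c r, ∏ ρ' ∈ S with c ρ' = c r', (ρ - ρ')) ^ WW (k := k) Ω r r' := by
    rw [← Finset.prod_pow]
    refine Finset.prod_congr rfl fun ρ hρ => ?_
    rw [← Finset.prod_pow]
    refine Finset.prod_congr rfl fun ρ' hρ' => ?_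
    congr 1
    unfold WW
    change (if c ρ = c ρ' then _ else _) = (if c r = c r' then _ else _)
    rw [(Finset.mem_filter.mp hρ).2, (Finset.mem_filter.mp hρ').2]
    have e1 : minpoly k[X] ρ = minpoly k[X] r := (Finset.mem_filter.mp hρ).2
    have e2 : minpoly k[X] ρ' = minpoly k[X] r' := (Finset.mem_filter.mp hρ').2
    rw [e1, e2]
  rw [this]
  refine Subring.pow_mem _ ?_ _
  obtain ⟨g, hg⟩ := cmp_resultant (Ω := Ω) hi hℓ (IsCmp.of_mem hi hℓ hr) (IsCmp.of_mem hi hℓ hr')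
  exact ⟨g, hg⟩
end Weights


section Places
variable {k : Type*} [Field k] [IsAlgClosed k] [CharP k 2]
variable {Ω : Type*} [Field Ω] [CharP Ω 2] {Γ : Type*} [LinearOrderedCommGroupWithZero Γ]
variable {v : Valuation Ω Γ} {κ : k →+* Ω}

lemma val_root_le {p : Polynomial Ω} (hp : p.Monic) (hc : ∀ j, v (p.coeff j) ≤ 1) {ρ : Ω}
    (hρ : p.eval ρ = 0) : v ρ ≤ 1 := by
  by_contra h
  push Not at h
  rw [eval_eq_sum_range, Finset.sum_range_succ, hp.coeff_natDegree, one_mul, add_comm] at hρ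
  refine val_dom0 (v := v) hρ ?_
  have h0 : v ρ ≠ 0 := (lt_trans zero_lt_one h).ne'
  rw [map_pow]
  refine Valuation.map_sum_lt v (pow_ne_zero _ h0) fun j hj => ?_
  have hj := Finset.mem_range.mp hj
  refine lt_of_le_of_lt (val_mul_le_right v (hc j) (le_of_eq (map_pow v _ _))) ?_
  exact pow_lt_pow_right₀ h hj

lemma val_multiset_lt (s : Multiset k) (ρ : Ω) (hκ : TrivOn v κ) (hρ : v ρ ≤ 1)
    (h : v ((s.map fun a => ρ - κ a).prod) < 1) : ∃ a ∈ s, v (ρ - κ a) < 1 := by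
  induction s using Multiset.induction with
  | empty => simp at h
  | cons a s ih =>
    by_cases ha : v (ρ - κ a) < 1
    · exact ⟨a, Multiset.mem_cons_self _ _, ha⟩
    · have h1 : v (ρ - κ a) = 1 := le_antisymm (Valuation.map_sub_le v hρ (hκ.le_one a)) (not_lt.mp ha)
      rw [Multiset.map_cons, Multiset.prod_cons, map_mul, h1, one_mul] at h
      obtain ⟨b, hb, hb'⟩ := ih h
      exact ⟨b, Multiset.mem_cons_of_mem hb, hb'⟩

lemma exists_residue (hκ : TrivOn v κ) {p : Polynomial Ω} (hp : p.Monic) (q : ℕ → k)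
    (hq : ∀ j, v (p.coeff j - κ (q j)) < 1) {ρ : Ω}
    (hρ : p.eval ρ = 0) : v ρ ≤ 1 ∧ ∃ a, v (ρ - κ a) < 1 := by
  have hle : v ρ ≤ 1 := by
    refine val_root_le hp (fun j => ?_) hρ
    have : p.coeff j = (p.coeff j - κ (q j)) + κ (q j) := by ring
    rw [this]
    exact Valuation.map_add_le v (hq j).le (hκ.le_one _)
  refine ⟨hle, ?_⟩
  set Q : k[X] := ∑ j ∈ Finset.range (p.natDegree + 1), C (q j) * X ^ j with hQ
  have hqn : q p.natDegree = 1 := by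
    have := hq p.natDegree
    rw [hp.coeff_natDegree, ← map_one κ, ← map_sub] at this
    have := hκ.eq_zero this
    linear_combination -this
  have hQc : ∀ j, Q.coeff j = if j < p.natDegree + 1 then q j else 0 := by
    intro j
    rw [hQ, finsetSum_coeff]
    simp only [coeff_C_mul, coeff_X_pow]
    simp
  have hQm : Q.Monic := by
    refine monic_of_natDegree_le_of_coeff_eq_one p.natDegree ?_ ?_
    · rw [natDegree_le_iff_coeff_eq_zero]
      intro j hj
      rw [hQc, if_neg (by omega)]
    · rw [hQc, if_pos (by omega), hqn]
  have hev : v (eval₂ κ ρ Q) < 1 := by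
    have h1 : eval₂ κ ρ Q = ∑ j ∈ Finset.range (p.natDegree + 1), κ (q j) * ρ ^ j := by
      rw [hQ, eval₂_finsetSum]
      simp
    have h2 : eval₂ κ ρ Q = ∑ j ∈ Finset.range (p.natDegree + 1), (-(p.coeff j - κ (q j))) * ρ ^ j := by
      rw [h1, ← sub_zero (∑ j ∈ _, _), ← hρ, eval_eq_sum_range, ← Finset.sum_sub_distrib]
      exact Finset.sum_congr rfl fun j _ => by ring
    rw [h2]
    refine Valuation.map_sum_lt v one_ne_zero fun j _ => ?_
    rw [mul_comm]
    refine val_mul_lt_right v ?_ ?_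
    · rw [map_pow]; exact pow_le_one' hle j
    · rw [Valuation.map_neg]; exact hq j
  have hs := (IsAlgClosed.splits Q).eq_prod_roots_of_monic hQm
  rw [hs, eval₂_multiset_prod, Multiset.map_map] at hev
  simp only [Function.comp_def, eval₂_sub, eval₂_X, eval₂_C] at hev
  obtain ⟨a, -, ha⟩ := val_multiset_lt Q.roots ρ hκ hle hev
  exact ⟨a, ha⟩
end Places

section Places2
variable {k : Type*} [Field k] [CharP k 2]
variable {Ω : Type*} [Field Ω] [CharP Ω 2] [Algebra k[X] Ω] {Γ : Type*} [LinearOrderedCommGroupWithZero Γ]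
variable {v : Valuation Ω Γ}

/-- constants -/
noncomputable def kap (k Ω : Type*) [Field k] [Field Ω] [Algebra k[X] Ω] : k →+* Ω :=
  (algebraMap k[X] Ω).comp C

lemma fin_res (hκ : TrivOn v (kap k Ω)) {b : k} (hb : v (algebraMap k[X] Ω X - kap k Ω b) < 1) (h : k[X]) :
    v (algebraMap k[X] Ω h - kap k Ω (h.eval b)) < 1 := by
  have hY : v (algebraMap k[X] Ω X) ≤ 1 := by
    have : algebraMap k[X] Ω X = (algebraMap k[X] Ω X - kap k Ω b) + kap k Ω b := by ring
    rw [this]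
    exact Valuation.map_add_le v hb.le (hκ.le_one _)
  have hi : ∀ p : k[X], v (algebraMap k[X] Ω p) ≤ 1 := by
    intro p
    rw [p.as_sum_range_C_mul_X_pow, map_sum]
    refine Valuation.map_sum_le v fun j _ => ?_
    rw [map_mul]
    refine val_mul_le_right v (hκ.le_one (p.coeff j)) ?_
    rw [map_pow, map_pow]; exact pow_le_one' hY j
  have e : algebraMap k[X] Ω h - kap k Ω (h.eval b) =
      algebraMap k[X] Ω (h /ₘ (X - C b)) * (algebraMap k[X] Ω X - kap k Ω b) := by
    have h1 := modByMonic_add_div h (X - C b)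
    rw [modByMonic_X_sub_C_eq_C_eval] at h1
    conv_lhs => rw [← h1]
    rw [map_add, map_mul, map_sub]
    simp only [kap, RingHom.comp_apply, eval_add, eval_mul, eval_sub, eval_X, eval_C]
    ring_nf
  rw [e]
  exact val_mul_lt_right v (hi _) hb

lemma fin_val (hκ : TrivOn v (kap k Ω)) {b : k} (hb : v (algebraMap k[X] Ω X - kap k Ω b) < 1) {h : k[X]}
    (h0 : h ≠ 0) :
    v (algebraMap k[X] Ω h) = v (algebraMap k[X] Ω X - kap k Ω b) ^ rootMultiplicity b h := by
  obtain ⟨q, hq, hq2⟩ := exists_eq_pow_rootMultiplicity_mul_and_not_dvd h h0 b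
  conv_lhs => rw [hq]
  rw [map_mul, map_pow, map_mul, map_pow]
  have h1 : v (algebraMap k[X] Ω q) = 1 := by
    have h2 := fin_res hκ hb q
    have h3 : q.eval b ≠ 0 := fun h => hq2 (dvd_iff_isRoot.mpr h)
    have h4 := hκ _ h3
    have : algebraMap k[X] Ω q = kap k Ω (q.eval b) + (algebraMap k[X] Ω q - kap k Ω (q.eval b)) := by ring
    rw [this, val_add_eq, h4]
    rw [h4]; exact h2
  rw [h1, mul_one, map_sub]
  rfl

lemma inf_res (hκ : TrivOn v (kap k Ω)) (hY : 1 < v (algebraMap k[X] Ω X)) {n : ℕ} {h : k[X]} (hn : h.natDegree ≤ n) :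
    v (algebraMap k[X] Ω h * (algebraMap k[X] Ω X)⁻¹ ^ n - kap k Ω (h.coeff n)) < 1 := by
  set Y := algebraMap k[X] Ω X with hYd
  have hY0 : Y ≠ 0 := by
    intro h; rw [h, map_zero] at hY; exact not_lt_zero hY
  have e : algebraMap k[X] Ω h * Y⁻¹ ^ n - kap k Ω (h.coeff n) =
      ∑ j ∈ Finset.range n, kap k Ω (h.coeff j) * Y⁻¹ ^ (n - j) := by
    conv_lhs => rw [h.as_sum_range_C_mul_X_pow' (show h.natDegree < n + 1 by omega)]
    rw [Finset.sum_range_succ, map_add, add_mul, map_mul, map_pow, map_sum, Finset.sum_mul]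
    have e1 : Y ^ n * Y⁻¹ ^ n = 1 := by rw [← mul_pow, mul_inv_cancel₀ hY0, one_pow]
    have e2 : ∀ p : k, algebraMap k[X] Ω (C p) = kap k Ω p := fun p => rfl
    rw [mul_assoc, e1, mul_one, e2]
    have e3 : (∑ j ∈ Finset.range n, C (h.coeff j) * X ^ j + C (h.coeff n) * X ^ n).coeff n = h.coeff n := by
      rw [← Finset.sum_range_succ, ← h.as_sum_range_C_mul_X_pow' (show h.natDegree < n + 1 by omega)]
    rw [e3, add_sub_cancel_right]
    refine Finset.sum_congr rfl fun j hj => ?_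
    have hj := Finset.mem_range.mp hj
    rw [map_mul, map_pow, e2, ← hYd, mul_assoc]
    congr 1
    obtain ⟨m, rfl⟩ := Nat.exists_eq_add_of_lt hj
    rw [show j + m + 1 - j = m + 1 by omega, show j + m + 1 = j + (m + 1) by ring, pow_add Y⁻¹, ← mul_assoc,
      ← mul_pow, mul_inv_cancel₀ hY0, one_pow, one_mul]
  rw [e]
  refine Valuation.map_sum_lt v one_ne_zero fun j hj => ?_
  have hj := Finset.mem_range.mp hj
  refine val_mul_lt_right v (hκ.le_one _) ?_
  rw [map_pow, map_inv₀]
  exact pow_lt_one₀ zero_le (inv_lt_one_of_one_lt₀ hY) (by omega)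

lemma inf_val (hκ : TrivOn v (kap k Ω)) (hY : 1 < v (algebraMap k[X] Ω X)) {h : k[X]} (h0 : h ≠ 0) :
    v (algebraMap k[X] Ω h) = v (algebraMap k[X] Ω X) ^ h.natDegree := by
  have h1 := inf_res hκ hY (le_refl h.natDegree)
  have hlc := hκ h.leadingCoeff (leadingCoeff_ne_zero.mpr h0)
  have hv0 : v (algebraMap k[X] Ω X) ≠ 0 := (lt_trans zero_lt_one hY).ne'
  have : v (algebraMap k[X] Ω h * (algebraMap k[X] Ω X)⁻¹ ^ h.natDegree) = 1 := by
    have e : algebraMap k[X] Ω h * (algebraMap k[X] Ω X)⁻¹ ^ h.natDegree = kap k Ω h.leadingCoeff +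
      (algebraMap k[X] Ω h * (algebraMap k[X] Ω X)⁻¹ ^ h.natDegree - kap k Ω (h.coeff h.natDegree)) := by
      rw [coeff_natDegree]; ring
    rw [e, val_add_eq, hlc]
    rw [hlc]; exact h1
  rw [map_mul, map_pow, map_inv₀, inv_pow] at this
  exact (mul_inv_eq_one₀ (pow_ne_zero _ hv0)).mp this

variable [FaithfulSMul k[X] Ω]

lemma exists_fin (b : k) : ∃ v : ValuationSubring Ω, TrivOn v.valuation (kap k Ω) ∧
    v.valuation (algebraMap k[X] Ω X - kap k Ω b) < 1 ∧
    v.valuation (algebraMap k[X] Ω X - kap k Ω b) ≠ 0 := by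
  letI : Algebra k Ω := (kap k Ω).toAlgebra
  refine exists_val (k := k) (algebraMap k[X] Ω X - kap k Ω b) ?_
  have : ∀ p : k[X], aeval (R := k) (algebraMap k[X] Ω X - kap k Ω b) p =
      algebraMap k[X] Ω (p.comp (X - C b)) := by
    intro p
    rw [comp, hom_eval₂, map_sub]
    rfl
  intro p q hpq
  rw [this, this] at hpq
  have h := congrArg (fun r : k[X] => r.comp (X + C b)) (FaithfulSMul.algebraMap_injective k[X] Ω hpq)
  simpa [comp_assoc] using h

lemma exists_inf : ∃ v : ValuationSubring Ω, TrivOn v.valuation (kap k Ω) ∧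
    1 < v.valuation (algebraMap k[X] Ω X) := by
  letI : Algebra k Ω := (kap k Ω).toAlgebra
  have hinj := FaithfulSMul.algebraMap_injective k[X] Ω
  have hY0 : algebraMap k[X] Ω X ≠ 0 := fun h => X_ne_zero (hinj (by rw [h, map_zero]))
  obtain ⟨v, h1, h2, h3⟩ := exists_val (k := k) (algebraMap k[X] Ω X)⁻¹ (by
    rw [injective_iff_map_eq_zero]
    intro p hp
    letI : Invertible (algebraMap k[X] Ω X) := invertibleOfNonzero hY0
    have hp' : eval₂ (kap k Ω) (⅟(algebraMap k[X] Ω X)) p.reverse.reverse = 0 ∨ True := Or.inr trivial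
    have h4 := eval₂_reverse_mul_pow (kap k Ω) (⅟(algebraMap k[X] Ω X)) p
    rw [invOf_invOf, invOf_eq_inv] at h4
    have h5 : eval₂ (kap k Ω) (algebraMap k[X] Ω X)⁻¹ p = 0 := hp
    rw [h5] at h4
    have h6 : eval₂ (kap k Ω) (algebraMap k[X] Ω X) p.reverse = 0 :=
      (mul_eq_zero.mp h4).resolve_right (pow_ne_zero _ (inv_ne_zero hY0))
    have h7 : algebraMap k[X] Ω (p.reverse) = 0 := by
      rw [← h6]
      conv_lhs => rw [← eval₂_C_X (p := p.reverse), hom_eval₂]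
      rfl
    have h8 : p.reverse = 0 := hinj (by rw [h7, map_zero])
    exact reverse_eq_zero.mp h8)
  refine ⟨v, h1, ?_⟩
  rw [map_inv₀] at h2 h3
  exact (inv_lt_one₀ (zero_lt_iff.mpr (by simpa using hY0))).mp h2
end Places2


section Fin
variable {k : Type*} [Field k] [IsAlgClosed k] [CharP k 2]
variable {Ω : Type*} [Field Ω] [IsAlgClosed Ω] [CharP Ω 2] [Algebra k[X] Ω] [FaithfulSMul k[X] Ω]
variable {i ℓ : ℕ}
variable {Γ : Type*} [LinearOrderedCommGroupWithZero Γ] {v : Valuation Ω Γ}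

lemma rts_res (hi : 1 ≤ i) (hℓ : Odd ℓ) (hκ : TrivOn v (kap k Ω)) {b : k}
    (hb : v (algebraMap k[X] Ω X - kap k Ω b) < 1) {ρ : Ω} (hρ : ρ ∈ rts k Ω (2 ^ i * ℓ + 1)) :
    v ρ ≤ 1 ∧ ∃ a, v (ρ - kap k Ω a) < 1 := by
  refine exists_residue hκ ((F1_monic (d_odd (ℓ := ℓ) hi) (d_gt hℓ)).map (algebraMap k[X] Ω))
    (fun j => ((F1 k (2 ^ i * ℓ + 1)).coeff j).eval b) (fun j => ?_) ?_
  · rw [coeff_map]; exact fin_res hκ hb _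
  · rw [eval_map_algebraMap]; exact (mem_rts hi hℓ).mp hρ

lemma rts0_sub : rts0 k Ω (2 ^ i * ℓ + 1) ⊆ rts k Ω (2 ^ i * ℓ + 1) := by
  classical
  unfold rts0
  exact (Finset.erase_subset _ _).trans (Finset.erase_subset _ _)

lemma cmp_eval [DecidableEq k[X][X]] (hi : 1 ≤ i) (hℓ : Odd ℓ) {u : k[X][X]} (h : IsCmp (2 ^ i * ℓ + 1) u)
    (c : k[X]) : ∏ ρ ∈ rts0 k Ω (2 ^ i * ℓ + 1) with minpoly k[X] ρ = u, (algebraMap k[X] Ω c - ρ) =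
      algebraMap k[X] Ω (u.eval c) := by
  have h1 := congrArg (eval (algebraMap k[X] Ω c)) (h.prod (Ω := Ω) hi hℓ)
  rw [eval_prod] at h1
  simp only [eval_sub, eval_X, eval_C] at h1
  rw [← h1, eval_map_apply]

lemma mkLS [DecidableEq k] [DecidableEq Ω] [DecidableEq k[X][X]] (hi : 1 ≤ i) (hℓ : Odd ℓ)
    (hns : ∀ u : k[X][X], IsCmp (2 ^ i * ℓ + 1) u → sig k u ≠ u)
    (hκ : TrivOn v (kap k Ω)) {b : k}
    (hb : v (algebraMap k[X] Ω X - kap k Ω b) < 1) (hb0 : v (algebraMap k[X] Ω X - kap k Ω b) ≠ 0) :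
    LS v (kap k Ω) i ℓ b (algebraMap k[X] Ω X - kap k Ω b) (rts k Ω (2 ^ i * ℓ + 1))
      (rts0 k Ω (2 ^ i * ℓ + 1)) (minpoly k[X]) (WW (k := k) Ω) := by
  have hY : kap k Ω b + (algebraMap k[X] Ω X - kap k Ω b) = algebraMap k[X] Ω X := by ring
  refine ⟨hκ, hi, hℓ, by simpa using hb0, hb, ?_, rts0_sub, one_mem_rts hi hℓ, ?_, ?_, ?_,
    fun ρ hρ => (rts_res hi hℓ hκ hb hρ).1, ?_, ?_, ?_, ?_, WW_le, ?_⟩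
  · intro ρ hρ
    rw [hY]; exact (mem_rts_iff hi hℓ).mp hρ
  · rw [hY]; exact Y_mem_rts hi hℓ
  · unfold rts0; simp
  · rw [hY]; unfold rts0; simp
  · intro c; rw [hY]; exact rts_prod hi hℓ c
  · intro ρ hρ; rw [hY]; exact rts_der hi hℓ hρ
  · intro u a μ
    by_cases hu : IsCmp (2 ^ i * ℓ + 1) u
    · have h := cmp_eval (Ω := Ω) hi hℓ hu (C a + C μ * (X - C b))
      have e : algebraMap k[X] Ω (C a + C μ * (X - C b)) =
          kap k Ω a + kap k Ω μ * (algebraMap k[X] Ω X - kap k Ω b) := by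
        rw [map_add, map_mul, map_sub]; rfl
      rw [e] at h
      rw [← map_prod, h]
      by_cases h0 : u.eval (C a + C μ * (X - C b)) = 0
      · right; rw [h0, map_zero, map_zero]
      · left; exact ⟨_, fin_val hκ hb h0⟩
    · left
      refine ⟨0, ?_⟩
      rw [Finset.filter_eq_empty_iff.mpr, Finset.prod_empty, pow_zero]
      intro ρ hρ h
      exact hu (h ▸ IsCmp.of_mem hi hℓ hρ)
  · intro ρ _ ρ' _ h; exact WW_zero h
  · intro N hN; exact WW_sum hi hℓ hns hN

lemma ord_le [DecidableEq k] (hi : 1 ≤ i) (hℓ : Odd ℓ)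
    (hns : ∀ u : k[X][X], IsCmp (2 ^ i * ℓ + 1) u → sig k u ≠ u) {g : k[X]} (hg0 : g ≠ 0)
    (hg : algebraMap k[X] Ω g =
      ∏ ρ ∈ rts0 k Ω (2 ^ i * ℓ + 1), ∏ ρ' ∈ rts0 k Ω (2 ^ i * ℓ + 1),
        (ρ - ρ') ^ WW (k := k) Ω ρ ρ') (b : k) :
    rootMultiplicity b g ≤ ∑ a ∈ mu k ℓ, cAB i ℓ a b := by
  classical
  obtain ⟨v, hκ, hb, hb0⟩ := exists_fin (k := k) (Ω := Ω) b
  have H := mkLS hi hℓ hns hκ hb hb0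
  set S := rts0 k Ω (2 ^ i * ℓ + 1) with hS
  have hex : ∀ ρ : Ω, ∃ a : k, ρ ∈ S → v.valuation (ρ - kap k Ω a) < 1 := by
    intro ρ
    by_cases hρ : ρ ∈ S
    · obtain ⟨a, ha⟩ := (rts_res hi hℓ hκ hb (rts0_sub hρ)).2
      exact ⟨a, fun _ => ha⟩
    · exact ⟨0, fun h => absurd h hρ⟩
  choose res hres using hex
  have huniq : ∀ ρ ∈ S, ∀ a, v.valuation (ρ - kap k Ω a) < 1 ↔ res ρ = a := by
    intro ρ hρ a
    constructor
    · intro h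
      have h1 : v.valuation (kap k Ω (res ρ - a)) < 1 := by
        have : kap k Ω (res ρ - a) = (ρ - kap k Ω a) - (ρ - kap k Ω (res ρ)) := by
          rw [map_sub]; ring
        rw [this]
        exact lt_of_le_of_lt (Valuation.map_sub _ _ _) (max_lt h (hres ρ hρ))
      exact sub_eq_zero.mp (hκ.eq_zero h1)
    · rintro rfl
      exact hres ρ hρ
  have hle1 : ∀ ρ ∈ S, v.valuation ρ ≤ 1 := fun ρ hρ => (rts_res hi hℓ hκ hb (rts0_sub hρ)).1
  have hfar : ∀ ρ ∈ S, ∀ ρ' ∈ S, res ρ ≠ res ρ' → v.valuation (ρ - ρ') = 1 := by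
    intro ρ hρ ρ' hρ' hne
    refine le_antisymm (Valuation.map_sub_le _ (hle1 ρ hρ) (hle1 ρ' hρ')) (not_lt.mp fun h => hne ?_)
    rw [← huniq ρ hρ]
    have : ρ - kap k Ω (res ρ') = (ρ - ρ') + (ρ' - kap k Ω (res ρ')) := by ring
    rw [this]
    exact lt_of_le_of_lt (Valuation.map_add _ _ _) (max_lt h (hres ρ' hρ'))
  have hfil : ∀ a, S.filter (fun ρ => v.valuation (ρ - kap k Ω a) < 1) = S.filter (fun ρ => res ρ = a) := by
    intro a
    exact Finset.filter_congr fun ρ hρ => huniq ρ hρ a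
  have hm : ∀ x ∈ S, res x ∈ S.image res := fun x hx => Finset.mem_image_of_mem res hx
  have hval : v.valuation (algebraMap k[X] Ω g) = ∏ a ∈ S.image res, ∏ ρ ∈ S with res ρ = a,
      ∏ ρ' ∈ S with res ρ' = a, v.valuation (ρ - ρ') ^ WW (k := k) Ω ρ ρ' := by
    rw [hg, map_prod, ← Finset.prod_fiberwise_of_maps_to (t := S.image res) (g := res) hm]
    refine Finset.prod_congr rfl fun a _ => Finset.prod_congr rfl fun ρ hρ => ?_
    rw [map_prod]
    obtain ⟨hρ1, hρ2⟩ := Finset.mem_filter.mp hρ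
    rw [Finset.prod_filter]
    refine Finset.prod_congr rfl fun ρ' hρ' => ?_
    rw [map_pow]
    split_ifs with h
    · rfl
    · rw [hfar ρ hρ1 ρ' hρ' (by rw [hρ2]; exact Ne.symm h), one_pow]
  have hlow : v.valuation (algebraMap k[X] Ω X - kap k Ω b) ^ (∑ a ∈ mu k ℓ, cAB i ℓ a b) ≤
      v.valuation (algebraMap k[X] Ω g) := by
    have h1 : v.valuation (algebraMap k[X] Ω X - kap k Ω b) ^ (∑ a ∈ S.image res, cAB i ℓ a b) ≤
      v.valuation (algebraMap k[X] Ω g) := by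
      rw [hval, ← Finset.prod_pow_eq_pow_sum]
      refine Finset.prod_le_prod' fun a _ => ?_
      have := H.localBd a
      rw [hfil a] at this
      exact this
    refine le_trans ((val_pow_anti hb0 hb).mpr ?_) h1
    rw [← Finset.sum_inter_add_sum_sdiff (S.image res) (mu k ℓ)]
    have h0 : ∑ a ∈ S.image res \ mu k ℓ, cAB i ℓ a b = 0 := by
      refine Finset.sum_eq_zero fun a ha => ?_
      have := (Finset.mem_sdiff.mp ha).2
      rw [mem_mu hℓ.pos] at this
      unfold cAB
      simp [this]
    rw [h0, add_zero]
    exact Finset.sum_le_sum_of_subset Finset.inter_subset_right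
  rw [fin_val hκ hb hg0] at hlow
  exact (val_pow_anti hb0 hb).mp hlow

lemma deg_lt (hi : 1 ≤ i) (hℓ : Odd ℓ) (h3 : 3 ≤ ℓ) (hne : ℓ ≠ 2 ^ i - 1)
    (hns : ∀ u : k[X][X], IsCmp (2 ^ i * ℓ + 1) u → sig k u ≠ u) {g : k[X]} (hg0 : g ≠ 0)
    (hg : algebraMap k[X] Ω g =
      ∏ ρ ∈ rts0 k Ω (2 ^ i * ℓ + 1), ∏ ρ' ∈ rts0 k Ω (2 ^ i * ℓ + 1),
        (ρ - ρ') ^ WW (k := k) Ω ρ ρ') : g.natDegree < (2 ^ i * ℓ - 2) ^ 2 := by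
  classical
  refine lt_of_le_of_lt ?_ (sum_lt (k := k) hi hℓ h3 hne)
  rw [(IsAlgClosed.splits g).natDegree_eq_card_roots, ← Multiset.toFinset_sum_count_eq]
  calc ∑ b ∈ g.roots.toFinset, g.roots.count b ≤ ∑ b ∈ g.roots.toFinset, ∑ a ∈ mu k ℓ, cAB i ℓ a b := by
        refine Finset.sum_le_sum fun b _ => ?_
        rw [count_roots]
        exact ord_le hi hℓ hns hg0 hg b
    _ ≤ ∑ b ∈ mu k ℓ, ∑ a ∈ mu k ℓ, cAB i ℓ a b := by
        rw [← Finset.sum_inter_add_sum_sdiff g.roots.toFinset (mu k ℓ)]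
        have h0 : ∑ b ∈ g.roots.toFinset \ mu k ℓ, ∑ a ∈ mu k ℓ, cAB i ℓ a b = 0 := by
          refine Finset.sum_eq_zero fun b hb => Finset.sum_eq_zero fun a _ => ?_
          have := (Finset.mem_sdiff.mp hb).2
          rw [mem_mu hℓ.pos] at this
          unfold cAB
          simp [this]
        rw [h0, add_zero]
        exact Finset.sum_le_sum_of_subset Finset.inter_subset_right
end Fin


section Inf
variable {k : Type*} [Field k] [IsAlgClosed k] [CharP k 2]
variable {Ω : Type*} [Field Ω] [IsAlgClosed Ω] [CharP Ω 2] [Algebra k[X] Ω] [FaithfulSMul k[X] Ω]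
variable {i ℓ : ℕ}
variable {Γ : Type*} [LinearOrderedCommGroupWithZero Γ] {v : Valuation Ω Γ}

lemma inf_rts_res (hi : 1 ≤ i) (hℓ : Odd ℓ) (hκ : TrivOn v (kap k Ω))
    (hY : 1 < v (algebraMap k[X] Ω X)) {ρ : Ω} (hρ : ρ ∈ rts k Ω (2 ^ i * ℓ + 1)) :
    v ρ ≤ v (algebraMap k[X] Ω X) ∧
      ∃ c, v (kap k Ω c * algebraMap k[X] Ω X - ρ) < v (algebraMap k[X] Ω X) := by
  set Y := algebraMap k[X] Ω X with hYd
  have hv0 : 0 < v Y := lt_trans zero_lt_one hY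
  have hY0 : Y ≠ 0 := fun h => by rw [h, map_zero] at hv0; exact lt_irrefl _ hv0
  have hF := F1_monic (k := k) (d_odd (ℓ := ℓ) hi) (d_gt hℓ)
  have hn : ((F1 k (2 ^ i * ℓ + 1)).map (algebraMap k[X] Ω)).natDegree = 2 ^ i * ℓ := by
    rw [hF.natDegree_map, F1_natDegree (d_odd hi) (d_gt hℓ), Nat.add_sub_cancel]
  have hev : ((F1 k (2 ^ i * ℓ + 1)).map (algebraMap k[X] Ω)).eval ρ = 0 := by
    rw [eval_map_algebraMap]; exact (mem_rts hi hℓ).mp hρ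
  obtain ⟨h1, a, h2⟩ := exists_residue (ρ := Y⁻¹ * ρ) hκ
    (p := scaleRoots ((F1 k (2 ^ i * ℓ + 1)).map (algebraMap k[X] Ω)) Y⁻¹)
    ((monic_scaleRoots_iff _).mpr (hF.map _))
    (fun j => ((F1 k (2 ^ i * ℓ + 1)).coeff j).coeff (2 ^ i * ℓ - j)) (fun j => by
      rw [coeff_scaleRoots, hn, coeff_map]
      refine inf_res hκ hY ?_
      by_cases h0 : (F1 k (2 ^ i * ℓ + 1)).coeff j = 0
      · rw [h0, natDegree_zero]; exact Nat.zero_le _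
      · have := (F1_wtle (k := k) (2 ^ i * ℓ + 1)).natDegree_coeff h0
        omega) (by
      have := scaleRoots_eval₂_mul (p := (F1 k (2 ^ i * ℓ + 1)).map (algebraMap k[X] Ω)) (RingHom.id Ω) ρ Y⁻¹
      rw [eval₂_id, eval₂_id, hev, mul_zero] at this
      simpa using this)
  constructor
  · have : ρ = Y * (Y⁻¹ * ρ) := by field_simp
    rw [this]
    exact val_mul_le_left v le_rfl h1
  · refine ⟨a, ?_⟩
    have : kap k Ω a * Y - ρ = -(Y⁻¹ * ρ - kap k Ω a) * Y := by field_simp; ring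
    rw [this, map_mul, Valuation.map_neg]
    exact mul_lt_of_lt_one_left hv0 h2

lemma inf_lower (hi : 1 ≤ i) (hℓ : Odd ℓ) (h3 : 3 ≤ 2 ^ i * ℓ) (hκ : TrivOn v (kap k Ω))
    (hY : 1 < v (algebraMap k[X] Ω X)) (c : k) :
    v (algebraMap k[X] Ω X) ^ (2 ^ i * ℓ - 2) ≤ v (algebraMap k[X] Ω X) *
      ∏ ρ ∈ rts0 k Ω (2 ^ i * ℓ + 1), v (kap k Ω c * algebraMap k[X] Ω X - ρ) := by
  classical
  set Y := algebraMap k[X] Ω X with hYd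
  have hv0 : 0 < v Y := lt_trans zero_lt_one hY
  have h2 : (2 : Ω) = 0 := CharTwo.two_eq_zero
  have hY1 : v (Y + 1) = v Y := by rw [val_add_eq]; rwa [map_one]
  have hYm : v (Y - 1) = v Y := by
    rw [show Y - 1 = Y + 1 by linear_combination -h2]; exact hY1
  have hcY : v (kap k Ω c * Y) ≤ v Y := val_mul_le_right v (hκ.le_one c) le_rfl
  by_cases hc : c = 1
  · have h := rts_der (k := k) hi hℓ (Y_mem_rts (k := k) (Ω := Ω) hi hℓ)
    rw [← hYd, show Y + Y + 1 = 1 by linear_combination Y * h2, one_pow,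
      ← Finset.mul_prod_erase _ _ (Finset.mem_erase.mpr ⟨(Y_ne_one' (k := k) (Ω := Ω)).symm, one_mem_rts (k := k) (Ω := Ω) hi hℓ⟩),
      Finset.erase_right_comm] at h
    have h' := congrArg v h
    rw [map_mul, map_mul, hY1, hYm, map_prod, val_add_eq v (x := Y ^ (2 ^ i * ℓ)), map_pow] at h'
    · rw [hc, map_one, one_mul]
      have e8 : 2 + (2 ^ i * ℓ - 2) = 2 ^ i * ℓ := by omega
      rw [← e8, pow_add, e8, sq, mul_assoc] at h'
      have h4 := mul_left_cancel₀ hv0.ne' h'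
      have h5 := mul_left_cancel₀ hv0.ne' h4
      rw [← h5]
      exact le_mul_of_one_le_left' hY.le
    · rw [map_one, map_pow]
      exact one_lt_pow₀ hY (by omega)
  · have h := rts_prod (k := k) (Ω := Ω) hi hℓ (kap k Ω c * Y)
    rw [← hYd, ← Finset.mul_prod_erase _ _ (one_mem_rts hi hℓ),
      ← Finset.mul_prod_erase _ _ (Finset.mem_erase.mpr ⟨Y_ne_one', Y_mem_rts hi hℓ⟩)] at h
    set hp : k[X] := (C c * X) ^ (2 ^ i * ℓ + 1) + X ^ (2 ^ i * ℓ + 1) + 1 + (C c * X + X + 1) ^ (2 ^ i * ℓ + 1) with hpd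
    have e1 : Fh (2 ^ i * ℓ + 1) (kap k Ω c * Y) Y = algebraMap k[X] Ω hp := by
      rw [hpd]
      unfold Fh
      simp only [map_add, map_mul, map_pow, map_one]
      rfl
    have e2 : hp.coeff (2 ^ i * ℓ) = (c + 1) ^ (2 ^ i * ℓ) := by
      rw [hpd, coeff_add, coeff_add, coeff_add, mul_pow, ← C_pow, coeff_C_mul, coeff_X_pow, if_neg (by omega),
        coeff_one, if_neg (by omega), show C c * X + X + 1 = C (c + 1) * X + 1 by rw [C_add, C_1]; ring,
        add_pow, finsetSum_coeff, Finset.sum_eq_single (2 ^ i * ℓ)]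
      · rw [one_pow, mul_one, mul_pow, ← C_pow, Nat.choose_succ_self_right]
        rw [← C_eq_natCast, coeff_mul_C, coeff_C_mul, coeff_X_pow, if_pos rfl]
        have hk2 : (2 : k) = 0 := CharTwo.two_eq_zero
        have : ((2 ^ i * ℓ + 1 : ℕ) : k) = 1 := by
          push_cast
          rw [hk2, zero_pow (by omega)]; ring
        rw [this]; ring
      · intro j _ hj
        rw [one_pow, mul_one, mul_pow, ← C_pow, ← C_eq_natCast, coeff_mul_C, coeff_C_mul,
          coeff_X_pow, if_neg (Ne.symm hj), mul_zero, zero_mul]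
      · intro h; exact absurd (Finset.mem_range.mpr (by omega)) h
    have hc1 : c + 1 ≠ 0 := fun h => hc (CharTwo.add_eq_zero.mp h)
    have e3 : hp.coeff (2 ^ i * ℓ) ≠ 0 := by rw [e2]; exact pow_ne_zero _ hc1
    have hp0 : hp ≠ 0 := by rintro h; rw [h, coeff_zero] at e3; exact e3 rfl
    have e4 : v Y ^ (2 ^ i * ℓ) ≤ v (algebraMap k[X] Ω hp) := by
      rw [inf_val hκ hY hp0]
      exact pow_le_pow_right₀ hY.le (le_natDegree_of_ne_zero e3)
    rw [← e1, ← h, map_mul, map_mul, map_mul, hY1] at e4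
    have e5 : v (kap k Ω c * Y - 1) ≤ v Y := Valuation.map_sub_le v hcY (by rw [map_one]; exact hY.le)
    have e6 : v (kap k Ω c * Y - Y) ≤ v Y := Valuation.map_sub_le v hcY le_rfl
    rw [map_prod] at e4
    have e7 : v Y ^ (2 ^ i * ℓ) ≤ v Y ^ 2 * (v Y * ∏ ρ ∈ rts0 k Ω (2 ^ i * ℓ + 1), v (kap k Ω c * Y - ρ)) := by
      refine e4.trans ?_
      have : ∀ P : Γ, v Y ^ 2 * (v Y * P) = v Y * (v Y * (v Y * P)) := fun P => by
        rw [sq]; simp only [mul_assoc]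
      rw [this]
      unfold rts0
      gcongr
    rw [show 2 ^ i * ℓ = 2 + (2 ^ i * ℓ - 2) by omega, pow_add] at e7
    have e8 : 2 + (2 ^ i * ℓ - 2) = 2 ^ i * ℓ := by omega
    rw [e8] at e7
    exact le_of_mul_le_mul_left e7 (pow_pos hv0 2)

end Inf


section Inf2
variable {k : Type*} [Field k] [IsAlgClosed k] [CharP k 2]
variable {Ω : Type*} [Field Ω] [IsAlgClosed Ω] [CharP Ω 2] [Algebra k[X] Ω] [FaithfulSMul k[X] Ω]
variable {i ℓ : ℕ}
variable {Γ : Type*} [LinearOrderedCommGroupWithZero Γ] {v : Valuation Ω Γ}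

lemma inf_fac (hi : 1 ≤ i) (hℓ : Odd ℓ) (hκ : TrivOn v (kap k Ω))
    (hY : 1 < v (algebraMap k[X] Ω X)) {ρ : Ω} (hρ : ρ ∈ rts0 k Ω (2 ^ i * ℓ + 1)) (c : k) :
    v (kap k Ω c * algebraMap k[X] Ω X - ρ) ≤ v (algebraMap k[X] Ω X) :=
  Valuation.map_sub_le v (val_mul_le_right v (hκ.le_one c) le_rfl)
    (inf_rts_res hi hℓ hκ hY (rts0_sub hρ)).1

lemma cmp_near [DecidableEq k[X][X]] (hi : 1 ≤ i) (hℓ : Odd ℓ) (hκ : TrivOn v (kap k Ω))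
    (hY : 1 < v (algebraMap k[X] Ω X)) {ρ : Ω} (hρ : ρ ∈ rts0 k Ω (2 ^ i * ℓ + 1)) (c : k)
    (hc : v (kap k Ω c * algebraMap k[X] Ω X - ρ) < v (algebraMap k[X] Ω X)) :
    v (algebraMap k[X] Ω X) * ∏ ρ' ∈ rts0 k Ω (2 ^ i * ℓ + 1) with minpoly k[X] ρ' = minpoly k[X] ρ,
      v (kap k Ω c * algebraMap k[X] Ω X - ρ') ≤
      v (algebraMap k[X] Ω X) ^ (Finset.card {ρ' ∈ rts0 k Ω (2 ^ i * ℓ + 1) | minpoly k[X] ρ' = minpoly k[X] ρ}) := by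
  classical
  set Y := algebraMap k[X] Ω X with hYd
  have hv0 : 0 < v Y := lt_trans zero_lt_one hY
  have hu := IsCmp.of_mem (k := k) hi hℓ hρ
  have h := cmp_eval (Ω := Ω) hi hℓ hu (C c * X)
  have hk : algebraMap k[X] Ω (C c * X) = kap k Ω c * Y := by rw [map_mul]; rfl
  rw [hk] at h
  have h' := congrArg v h
  rw [map_prod] at h'
  by_cases hg : (minpoly k[X] ρ).eval (C c * X) = 0
  · rw [h', hg, map_zero, map_zero, mul_zero]; exact zero_le
  set S := Finset.filter (fun ρ' => minpoly k[X] ρ' = minpoly k[X] ρ) (rts0 k Ω (2 ^ i * ℓ + 1)) with hS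
  have hρS : ρ ∈ S := Finset.mem_filter.mpr ⟨hρ, rfl⟩
  have hlt : ∏ ρ' ∈ S, v (kap k Ω c * Y - ρ') < v Y ^ S.card := by
    rw [← Finset.mul_prod_erase _ _ hρS]
    have hcard : S.card = (S.erase ρ).card + 1 := (Finset.card_erase_add_one hρS).symm
    rw [hcard, pow_succ']
    have h1 : ∏ ρ' ∈ S.erase ρ, v (kap k Ω c * Y - ρ') ≤ v Y ^ (S.erase ρ).card := by
      refine Finset.prod_le_pow_card _ _ _ fun x hx => ?_
      exact inf_fac hi hℓ hκ hY (Finset.mem_filter.mp (Finset.mem_erase.mp hx).2).1 c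
    calc _ ≤ v (kap k Ω c * Y - ρ) * v Y ^ (S.erase ρ).card := by gcongr
      _ < _ := mul_lt_mul_of_pos_right hc (pow_pos hv0 _)
  rw [h', inf_val hκ hY hg] at hlt ⊢
  rw [← hYd] at hlt ⊢
  have := (pow_lt_pow_iff_right₀ hY).mp hlt
  rw [← pow_succ']
  exact pow_le_pow_right₀ hY.le this

lemma cmp_far (hi : 1 ≤ i) (hℓ : Odd ℓ) (h3 : 3 ≤ 2 ^ i * ℓ) (hκ : TrivOn v (kap k Ω))
    (hY : 1 < v (algebraMap k[X] Ω X)) {ρ ρ' : Ω} (hρ : ρ ∈ rts0 k Ω (2 ^ i * ℓ + 1))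
    (hρ' : ρ' ∈ rts0 k Ω (2 ^ i * ℓ + 1)) (hne : minpoly k[X] ρ ≠ minpoly k[X] ρ') :
    v (ρ - ρ') = v (algebraMap k[X] Ω X) := by
  classical
  set Y := algebraMap k[X] Ω X with hYd
  have hv0 : 0 < v Y := lt_trans zero_lt_one hY
  obtain ⟨r1, c, r2⟩ := inf_rts_res hi hℓ hκ hY (rts0_sub hρ)
  obtain ⟨r1', -⟩ := inf_rts_res hi hℓ hκ hY (rts0_sub hρ')
  refine le_antisymm (Valuation.map_sub_le v r1 r1') ?_
  by_contra hcon
  push Not at hcon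
  have r2' : v (kap k Ω c * Y - ρ') < v Y := by
    rw [show kap k Ω c * Y - ρ' = (kap k Ω c * Y - ρ) + (ρ - ρ') by ring]
    exact Valuation.map_add_lt v r2 hcon
  have n1 := cmp_near hi hℓ hκ hY hρ c r2
  have n2 := cmp_near hi hℓ hκ hY hρ' c r2'
  have hl := inf_lower (k := k) hi hℓ h3 hκ hY c
  have hD := card_rts0 (k := k) (Ω := Ω) hi hℓ
  set T := rts0 k Ω (2 ^ i * ℓ + 1) with hT
  have s1 := Finset.prod_filter_mul_prod_filter_not T (fun x => minpoly k[X] x = minpoly k[X] ρ)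
    (fun x => v (kap k Ω c * Y - x))
  have s2 := Finset.prod_filter_mul_prod_filter_not (T.filter (fun x => ¬ minpoly k[X] x = minpoly k[X] ρ))
    (fun x => minpoly k[X] x = minpoly k[X] ρ') (fun x => v (kap k Ω c * Y - x))
  have c1 := Finset.card_filter_add_card_filter_not (s := T) (fun x => minpoly k[X] x = minpoly k[X] ρ)
  have c2 := Finset.card_filter_add_card_filter_not (s := T.filter (fun x => ¬ minpoly k[X] x = minpoly k[X] ρ))
    (fun x => minpoly k[X] x = minpoly k[X] ρ')
  have hff : (T.filter (fun x => ¬ minpoly k[X] x = minpoly k[X] ρ)).filter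
      (fun x => minpoly k[X] x = minpoly k[X] ρ') = T.filter (fun x => minpoly k[X] x = minpoly k[X] ρ') := by
    ext x
    simp only [Finset.mem_filter]
    constructor
    · rintro ⟨⟨a, -⟩, b⟩; exact ⟨a, b⟩
    · rintro ⟨a, b⟩; exact ⟨⟨a, fun h => hne (h.symm.trans b)⟩, b⟩
  rw [hff] at s2 c2
  set R := (T.filter (fun x => ¬ minpoly k[X] x = minpoly k[X] ρ)).filter
      (fun x => ¬ minpoly k[X] x = minpoly k[X] ρ') with hR
  have n3 : ∏ x ∈ R, v (kap k Ω c * Y - x) ≤ v Y ^ R.card := by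
    refine Finset.prod_le_pow_card _ _ _ fun x hx => ?_
    exact inf_fac hi hℓ hκ hY (Finset.mem_filter.mp (Finset.mem_filter.mp hx).1).1 c
  rw [← s1, ← s2, ← hD, ← c1, ← c2, pow_add, pow_add] at hl
  rw [← hYd] at hl n1 n2
  set A := ∏ x ∈ T with minpoly k[X] x = minpoly k[X] ρ, v (kap k Ω c * Y - x)
  set B := ∏ x ∈ T with minpoly k[X] x = minpoly k[X] ρ', v (kap k Ω c * Y - x)
  set E := ∏ x ∈ R, v (kap k Ω c * Y - x)
  have key : (v Y * A) * ((v Y * B) * E) ≤ v Y * (A * (B * E)) := by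
    refine le_trans ?_ hl
    gcongr
  have hpos : 0 < v Y * (A * (B * E)) := by
    refine lt_of_lt_of_le ?_ hl
    exact mul_pos (pow_pos hv0 _) (mul_pos (pow_pos hv0 _) (pow_pos hv0 _))
  have e : (v Y * A) * ((v Y * B) * E) = v Y * (v Y * (A * (B * E))) := by ac_rfl
  rw [e] at key
  exact absurd key (not_le.mpr (lt_mul_of_one_lt_left hpos hY))

end Inf2

theorem partB' (k : Type*) [Field k] [IsAlgClosed k] [CharP k 2]
    (Ω : Type*) [Field Ω] [IsAlgClosed Ω] [CharP Ω 2] [Algebra k[X] Ω] [FaithfulSMul k[X] Ω]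
    {i ℓ : ℕ} (hi : 1 ≤ i) (hℓ : Odd ℓ) (h3 : 3 ≤ ℓ) (hne : ℓ ≠ 2 ^ i - 1) :
    ∃ u : k[X][X], IsCmp (2 ^ i * ℓ + 1) u ∧ sig k u = u := by
  classical
  by_contra hcon
  have hns : ∀ u : k[X][X], IsCmp (2 ^ i * ℓ + 1) u → sig k u ≠ u := fun u hu h => hcon ⟨u, hu, h⟩
  have h3' : 3 ≤ 2 ^ i * ℓ := le_trans h3 (Nat.le_mul_of_pos_left _ (by positivity))
  obtain ⟨g, hg0, hg⟩ := prod_range (k := k) (Ω := Ω) hi hℓ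
  have hlt := deg_lt hi hℓ h3 hne hns hg0 hg
  obtain ⟨w, hκ, hY⟩ := exists_inf (k := k) (Ω := Ω)
  have e := congrArg w.valuation hg
  rw [inf_val hκ hY hg0, map_prod] at e
  have e2 : ∀ ρ ∈ rts0 k Ω (2 ^ i * ℓ + 1), w.valuation (∏ ρ' ∈ rts0 k Ω (2 ^ i * ℓ + 1), (ρ - ρ') ^ WW (k := k) Ω ρ ρ')
      = w.valuation (algebraMap k[X] Ω X) ^ (∑ ρ' ∈ rts0 k Ω (2 ^ i * ℓ + 1), WW (k := k) Ω ρ ρ') := by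
    intro ρ hρ
    rw [map_prod, ← Finset.prod_pow_eq_pow_sum]
    refine Finset.prod_congr rfl fun ρ' hρ' => ?_
    rw [map_pow]
    by_cases hm : minpoly k[X] ρ = minpoly k[X] ρ'
    · rw [WW_zero hm, pow_zero, pow_zero]
    · rw [cmp_far hi hℓ h3' hκ hY hρ hρ' hm]
  rw [Finset.prod_congr rfl e2, Finset.prod_pow_eq_pow_sum, WW_total hi hℓ hns] at e
  have := (pow_right_injective₀ (lt_trans zero_lt_one hY) hY.ne') e
  omega

section Final
variable (k : Type*) [Field k] [IsAlgClosed k] [CharP k 2]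
variable {i ℓ : ℕ}

theorem partB (hi : 1 ≤ i) (hℓ : Odd ℓ) (h3 : 3 ≤ ℓ) (hne : ℓ ≠ 2 ^ i - 1) :
    ∃ u : k[X][X], u.Monic ∧ wtle u.natDegree u ∧ Irreducible u ∧ ¬ u ∣ derivative u ∧ frobfix 2 u ∧
      u ∣ F1 k (2 ^ i * ℓ + 1) ∧ u ≠ X - C 1 ∧ u ≠ X - C X ∧ 0 < u.natDegree ∧ u.natDegree ≤ 2 ^ i * ℓ := by
  have : CharP (AlgebraicClosure (FractionRing k[X])) 2 :=
    charP_of_injective_algebraMap (FaithfulSMul.algebraMap_injective k (AlgebraicClosure (FractionRing k[X]))) 2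
  have : FaithfulSMul k[X] (AlgebraicClosure (FractionRing k[X])) := by
    rw [faithfulSMul_iff_algebraMap_injective, IsScalarTower.algebraMap_eq k[X] (FractionRing k[X])]
    exact (algebraMap (FractionRing k[X]) (AlgebraicClosure (FractionRing k[X]))).injective.comp (IsFractionRing.injective k[X] (FractionRing k[X]))
  obtain ⟨u, hu, hs⟩ := partB' k (AlgebraicClosure (FractionRing k[X])) hi hℓ h3 hne
  have hF := F1_monic (k := k) (d_odd (ℓ := ℓ) hi) (d_gt hℓ)
  have hpos : 0 < u.natDegree := hu.pos
  refine ⟨u, hu.1, hu.wt hi hℓ, hu.2.1, ?_, ?_, hu.2.2.1, hu.2.2.2.1, hu.2.2.2.2, hpos, ?_⟩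
  · intro hd
    obtain ⟨ρ, hρ⟩ := IsAlgClosed.exists_aeval_eq_zero_of_injective (AlgebraicClosure (FractionRing k[X]))
      (FaithfulSMul.algebraMap_injective k[X] (AlgebraicClosure (FractionRing k[X]))) u (by
        rw [degree_eq_natDegree hu.1.ne_zero]; exact_mod_cast hpos.ne')
    obtain ⟨w, hw⟩ := hu.2.2.1
    obtain ⟨t, ht⟩ := hd
    have e1 : aeval ρ (F1 k (2 ^ i * ℓ + 1)) = 0 := by rw [hw, map_mul, hρ, zero_mul]
    have e2 : aeval ρ (derivative (F1 k (2 ^ i * ℓ + 1))) = 0 := by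
      rw [hw, derivative_mul, ht, map_add, map_mul, map_mul, map_mul, hρ]; ring
    have e3 := F1_eval (k := k) (2 ^ i * ℓ + 1) ρ
    rw [e1, mul_zero] at e3
    have e4 := F1_der (k := k) (d_odd (ℓ := ℓ) hi) ρ
    rw [e2, mul_zero, Nat.add_sub_cancel] at e4
    exact F1_der_ne hi hℓ e3.symm e4.symm
  · intro a b
    rw [← sig_coeff, hs]
  · have := natDegree_le_of_dvd hu.2.2.1 hF.ne_zero
    rwa [F1_natDegree (d_odd hi) (d_gt hℓ), Nat.add_sub_cancel] at this

end Final


section PartC1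
variable {k : Type*} [Field k]

/-- top homogeneous part of a bivariate polynomial -/
noncomputable def top1 (p : k[X][X]) : k[X][X] := (theta p).leadingCoeff

lemma top1_mul (p q : k[X][X]) : top1 (p * q) = top1 p * top1 q := by
  unfold top1; rw [map_mul, leadingCoeff_mul]

lemma top1_one : top1 (1 : k[X][X]) = 1 := by
  unfold top1; rw [map_one, leadingCoeff_one]

lemma top1_coeff (p : k[X][X]) (j i : ℕ) : ((top1 p).coeff j).coeff i =
    if i + j = (theta p).natDegree then (p.coeff j).coeff i else 0 := theta_coeff p _ j i

/-- the Frobenius power acting on coefficients -/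
noncomputable def sigN (k : Type*) [Field k] [IsAlgClosed k] [CharP k 2] (N : ℕ) : k[X][X] ≃+* k[X][X] :=
  have : Fact (Nat.Prime 2) := ⟨Nat.prime_two⟩
  mapEquiv (mapEquiv (iterateFrobeniusEquiv k 2 N))

variable [IsAlgClosed k] [CharP k 2]

lemma sigN_coeff (N : ℕ) (p : k[X][X]) (j i : ℕ) :
    ((sigN k N p).coeff j).coeff i = ((p.coeff j).coeff i) ^ 2 ^ N := by
  have : Fact (Nat.Prime 2) := ⟨Nat.prime_two⟩
  unfold sigN
  simp [iterateFrobenius_def]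

lemma sigN_monic (N : ℕ) {p : k[X][X]} (h : p.Monic) : (sigN k N p).Monic := by
  have : Fact (Nat.Prime 2) := ⟨Nat.prime_two⟩
  unfold sigN; exact h.map _

lemma sigN_fix (N : ℕ) {p : k[X][X]} : sigN k N p = p ↔ frobfix (2 ^ N) p := by
  constructor
  · intro h i j
    rw [← sigN_coeff, h]
  · intro h
    ext j i
    rw [sigN_coeff, h i j]

lemma sigN_wtle (N t : ℕ) (p : k[X][X]) : wtle t (sigN k N p) ↔ wtle t p := by
  have : 2 ^ N ≠ 0 := by positivity
  unfold wtle
  simp only [sigN_coeff, pow_eq_zero_iff this]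

lemma sigN_top (N : ℕ) (p : k[X][X]) : top1 (sigN k N p) = sigN k N (top1 p) := by
  have hd : (theta (sigN k N p)).natDegree = (theta p).natDegree := by
    apply le_antisymm
    · rw [← wtle_iff_theta, sigN_wtle, wtle_iff_theta]
    · rw [← wtle_iff_theta, ← sigN_wtle N, wtle_iff_theta]
  ext j i
  rw [top1_coeff, sigN_coeff, sigN_coeff, top1_coeff, hd]
  split_ifs
  · rfl
  · rw [zero_pow (by positivity)]

lemma sigN_eval (N : ℕ) (p : k[X][X]) : evalEval 1 0 (sigN k N p) = (evalEval 1 0 p) ^ 2 ^ N := by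
  have : Fact (Nat.Prime 2) := ⟨Nat.prime_two⟩
  have h : sigN k N p = p.map (mapRingHom (iterateFrobenius k 2 N)) := rfl
  have e := map_mapRingHom_evalEval (iterateFrobenius k 2 N) p 1 0
  rw [map_one, map_zero, iterateFrobenius_def] at e
  rw [h, e]

lemma exists_top_factor (n : ℕ) : ∀ G : k[X][X], G.natDegree = n → G.Monic → evalEval 1 0 (top1 G) = 0 →
    ∃ u : k[X][X], u.Monic ∧ Irreducible u ∧ u ∣ G ∧ evalEval 1 0 (top1 u) = 0 := by
  induction n using Nat.strong_induction_on with
  | _ n ih =>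
    intro G hn hG h0
    by_cases hirr : Irreducible G
    · exact ⟨G, hG, hirr, dvd_rfl, h0⟩
    have h1 : G ≠ 1 := by
      rintro rfl
      rw [top1_one, evalEval_one] at h0
      exact one_ne_zero h0
    rw [hG.irreducible_iff_natDegree, not_and] at hirr
    have hirr := hirr h1
    push Not at hirr
    obtain ⟨a, b, ha, hb, hab, hda, hdb⟩ := hirr
    have hs : a.natDegree + b.natDegree = n := by rw [← ha.natDegree_mul hb, hab, hn]
    rw [← hab, top1_mul, evalEval_mul, mul_eq_zero] at h0
    rcases h0 with h0 | h0
    · obtain ⟨u, p1, p2, p3, p4⟩ := ih a.natDegree (by omega) a rfl ha h0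
      exact ⟨u, p1, p2, p3.trans ⟨b, hab.symm⟩, p4⟩
    · obtain ⟨u, p1, p2, p3, p4⟩ := ih b.natDegree (by omega) b rfl hb h0
      exact ⟨u, p1, p2, p3.trans ⟨a, by rw [mul_comm, hab]⟩, p4⟩

theorem factC (N : ℕ) {G : k[X][X]} (hG : G.Monic) (hw : wtle G.natDegree G) (hfix : frobfix (2 ^ N) G)
    (h0 : evalEval 1 0 (top1 G) = 0) (h1 : evalEval 1 0 (derivative (top1 G)) ≠ 0) :
    ∃ u : k[X][X], u.Monic ∧ wtle u.natDegree u ∧ Irreducible u ∧ ¬ u ∣ derivative u ∧ frobfix (2 ^ N) u ∧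
      u ∣ G ∧ 0 < u.natDegree ∧ evalEval 1 0 (top1 u) = 0 := by
  obtain ⟨u, hu, hirr, ⟨w, hw'⟩, hu0⟩ := exists_top_factor _ G rfl hG h0
  have hpos : 0 < u.natDegree := by
    rcases Nat.eq_zero_or_pos u.natDegree with h | h
    · exact absurd (hu.natDegree_eq_zero.mp h ▸ isUnit_one) hirr.1
    · exact h
  have hwm : w.Monic := hu.of_mul_monic_left (hw' ▸ hG)
  refine ⟨u, hu, wtle_factor hw' hu hwm hw, hirr, ?_, ?_, ⟨w, hw'⟩, hpos, hu0⟩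
  · intro hd
    have hd0 : derivative u = 0 := by
      by_contra hne
      have h1 := natDegree_le_of_dvd hd hne
      have h2 := natDegree_derivative_lt hpos.ne'
      omega
    have hd1 : derivative (top1 u) = 0 := by
      ext j i
      have := congrArg (fun p => (p.coeff j).coeff i) hd0
      simp only [coeff_derivative, coeff_zero] at this ⊢
      rw [← Nat.cast_succ, ← C_eq_natCast, coeff_mul_C] at this ⊢
      rw [top1_coeff]
      split_ifs
      · exact this
      · rw [zero_mul]
    apply h1
    rw [hw', top1_mul, derivative_mul, hd1, zero_mul, zero_add, evalEval_mul, hu0, zero_mul]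
  · rw [← sigN_fix]
    by_contra hne
    have hirr' : Irreducible (sigN k N u) := (MulEquiv.irreducible_iff (sigN k N)).mpr hirr
    have hdv : sigN k N u ∣ u * w := by
      rw [← hw', ← (sigN_fix N).mpr hfix]
      exact _root_.map_dvd _ ⟨w, hw'⟩
    rcases hirr'.prime.dvd_or_dvd hdv with h | h
    · exact hne (eq_of_monic_of_associated (sigN_monic N hu) hu (hirr'.associated_of_dvd hirr h))
    · obtain ⟨t, ht⟩ := h
      apply h1
      have hs : evalEval 1 0 (top1 (sigN k N u)) = 0 := by
        rw [sigN_top, sigN_eval, hu0, zero_pow (by positivity)]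
      rw [hw', ht, top1_mul, top1_mul, derivative_mul, derivative_mul]
      simp only [evalEval_mul, evalEval_add, hu0, hs]
      ring

end PartC1


section PartC2
variable {k : Type*} [Field k]

/-- a linear form in the two variables -/
noncomputable def lin (p e : k) : k[X][X] := C (C p * X) + C (C e) * X

lemma lin_eval (p e s v : k) : evalEval s v (lin p e) = p * s + e * v := by
  unfold lin
  simp [evalEval]

lemma lin_theta (p e : k) : theta (lin p e) = C (lin p e) * X := by
  unfold lin theta
  simp only [map_add, map_mul, coe_eval₂RingHom, eval₂_C, eval₂_X, eval₂_mul, RingHom.comp_apply]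
  ring

lemma lin_wtle (p e : k) : wtle 1 (lin p e) := by
  unfold lin
  refine (wtle_C ?_).add ?_
  · exact natDegree_C_mul_le _ _ |>.trans natDegree_X_le
  · simpa using (wtle_CC e).mul wtle_X

lemma lin_coeff_one (p e : k) : (lin p e).coeff 1 = C e := by
  unfold lin
  rw [coeff_add, coeff_C, if_neg one_ne_zero, coeff_C_mul, coeff_X_one]; ring

lemma lin_top {p e : k} (hp : p ≠ 0) : top1 (lin p e) = lin p e := by
  unfold top1
  rw [lin_theta, leadingCoeff_mul, leadingCoeff_C, leadingCoeff_X, mul_one]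

/-- power sum of linear forms -/
noncomputable def Hh (p e : Fin 4 → k) (j : ℕ) : k[X][X] := ∑ i, lin (p i) (e i) ^ j

/-- the plane section polynomial -/
noncomputable def Gg (d : ℕ) (p e : Fin 4 → k) (f : k[X]) : k[X][X] :=
  ∑ j ∈ Finset.range (d + 1), C (C (f.coeff j)) * Hh p e j

lemma Hh_wtle (p e : Fin 4 → k) (j : ℕ) : wtle j (Hh p e j) := by
  unfold Hh
  refine wtle_sum _ _ fun i _ => ?_
  simpa using (lin_wtle (p i) (e i)).pow j

lemma Gg_wtle (d : ℕ) (p e : Fin 4 → k) (f : k[X]) : wtle d (Gg d p e f) := by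
  unfold Gg
  refine wtle_sum _ _ fun j hj => ?_
  have := (wtle_CC (f.coeff j)).mul (Hh_wtle p e j)
  exact this.mono (by have := Finset.mem_range.mp hj; omega)

lemma Gg_coeff (d : ℕ) (p e : Fin 4 → k) (f : k[X]) :
    (Gg d p e f).coeff d = C (f.coeff d * ∑ i, e i ^ d) := by
  unfold Gg
  rw [finsetSum_coeff, Finset.sum_eq_single d]
  · rw [coeff_C_mul, C_mul]
    congr 1
    unfold Hh
    rw [finsetSum_coeff, map_sum]
    refine Finset.sum_congr rfl fun i _ => ?_
    have := coeff_pow_of_natDegree_le (m := d) (lin_wtle (p i) (e i)).natDegree_le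
    rw [mul_one] at this
    rw [this, lin_coeff_one, C_pow]
  · intro j hj hne
    rw [coeff_C_mul, coeff_eq_zero_of_natDegree_lt (p := Hh p e j), mul_zero]
    have := (Hh_wtle p e j).natDegree_le
    have := Finset.mem_range.mp hj
    omega
  · intro h; exact absurd (Finset.mem_range.mpr (Nat.lt_succ_self d)) h

lemma Gg_theta (d : ℕ) (p e : Fin 4 → k) (f : k[X]) :
    (theta (Gg d p e f)).coeff d = C (C (f.coeff d)) * Hh p e d := by
  have h1 : theta (Gg d p e f) = ∑ j ∈ Finset.range (d + 1), C (C (C (f.coeff j)) * Hh p e j) * X ^ j := by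
    unfold Gg
    rw [map_sum]
    refine Finset.sum_congr rfl fun j _ => ?_
    rw [map_mul, C_mul, mul_assoc]
    congr 1
    · simp [theta]
    · unfold Hh
      rw [map_sum, map_sum, Finset.sum_mul]
      refine Finset.sum_congr rfl fun i _ => ?_
      rw [map_pow, lin_theta, C_pow]; ring
  rw [h1, finsetSum_coeff, Finset.sum_eq_single d]
  · rw [coeff_C_mul, coeff_X_pow, if_pos rfl, mul_one]
  · intro j _ hne
    rw [coeff_C_mul, coeff_X_pow, if_neg hne.symm, mul_zero]
  · intro h; exact absurd (Finset.mem_range.mpr (Nat.lt_succ_self d)) h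

lemma Gg_top {d : ℕ} {p e : Fin 4 → k} {f : k[X]} (h : C (C (f.coeff d)) * Hh p e d ≠ 0) :
    top1 (Gg d p e f) = C (C (f.coeff d)) * Hh p e d := by
  have h1 := Gg_theta d p e f
  have h2 : (theta (Gg d p e f)).natDegree = d := by
    refine le_antisymm ((wtle_iff_theta _ _).mp (Gg_wtle d p e f)) (le_natDegree_of_ne_zero ?_)
    rwa [h1]
  unfold top1 leadingCoeff
  rw [h2, h1]

lemma Hh_eval (p e : Fin 4 → k) (d : ℕ) (s v : k) :
    evalEval s v (Hh p e d) = ∑ i, (p i * s + e i * v) ^ d := by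
  unfold Hh
  rw [← coe_evalEvalRingHom, map_sum]
  refine Finset.sum_congr rfl fun i _ => ?_
  rw [map_pow, coe_evalEvalRingHom, lin_eval]

lemma Gg_eval {d : ℕ} (p e : Fin 4 → k) {f : k[X]} (hf : f.natDegree ≤ d) (s v : k) :
    evalEval s v (Gg d p e f) = ∑ i, f.eval (p i * s + e i * v) := by
  unfold Gg
  rw [← coe_evalEvalRingHom, map_sum]
  simp only [map_mul, coe_evalEvalRingHom, Hh_eval, evalEval_CC, Finset.mul_sum]
  rw [Finset.sum_comm]
  refine Finset.sum_congr rfl fun i _ => ?_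
  rw [eval_eq_sum_range' (Nat.lt_succ_of_le hf)]

lemma Hh_der (p e : Fin 4 → k) (d : ℕ) :
    evalEval 1 0 (derivative (Hh p e d)) = d * ∑ i, p i ^ (d - 1) * e i := by
  unfold Hh
  rw [derivative_sum, ← coe_evalEvalRingHom, map_sum, Finset.mul_sum]
  refine Finset.sum_congr rfl fun i _ => ?_
  rw [derivative_pow, map_mul, map_mul, map_pow, coe_evalEvalRingHom, lin_eval]
  have : derivative (lin (p i) (e i)) = C (C (e i)) := by
    unfold lin; simp
  rw [this, evalEval_CC, evalEval_C, eval_natCast]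
  ring

lemma frobfix_lin [IsAlgClosed k] [CharP k 2] {N : ℕ} {d : ℕ} {p e : Fin 4 → k} {f : k[X]}
    (hp : ∀ i, p i ^ 2 ^ N = p i) (he : ∀ i, e i ^ 2 ^ N = e i)
    (hf : ∀ j, f.coeff j ^ 2 ^ N = f.coeff j) : frobfix (2 ^ N) (Gg d p e f) := by
  have : Fact (Nat.Prime 2) := ⟨Nat.prime_two⟩
  rw [← sigN_fix]
  have hC : ∀ a : k, a ^ 2 ^ N = a → sigN k N (C (C a)) = C (C a) := by
    intro a ha
    unfold sigN
    simp [iterateFrobenius_def, ha]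
  have hX : sigN k N X = X := by unfold sigN; simp
  have hCX : sigN k N (C X) = C X := by unfold sigN; simp
  unfold Gg Hh
  simp only [map_sum, map_mul, map_pow]
  refine Finset.sum_congr rfl fun j _ => ?_
  rw [hC _ (hf j)]
  congr 1
  refine Finset.sum_congr rfl fun i _ => ?_
  congr 1
  unfold lin
  rw [map_add, map_mul, map_mul, map_mul, hC _ (hp i), hC _ (he i), hX, hCX]
end PartC2

theorem planeC (d : ℕ) (hd : Odd d) : ∃ N0, ∀ N ≥ N0, ∀ (k : Type) [Field k] [IsAlgClosed k] [CharP k 2]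
    (p e : Fin 4 → k) (f : k[X]), f.natDegree ≤ d → (∀ i, p i ^ 2 ^ N = p i) → (∀ i, e i ^ 2 ^ N = e i) →
    (∀ j, f.coeff j ^ 2 ^ N = f.coeff j) → (∑ i, p i ^ d = 0) → (∑ i, p i ^ (d - 1) * e i ≠ 0) →
    (f.coeff d * ∑ i, e i ^ d = 1) → p 0 ≠ p 1 → p 1 ≠ p 2 → p 0 ≠ p 2 →
    ∃ x : Fin 4 → k, (∀ i, x i ^ 2 ^ N = x i) ∧ ∑ i, f.eval (x i) = 0 ∧ x 0 ≠ x 1 ∧ x 1 ≠ x 2 ∧ x 0 ≠ x 2 ∧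
      ∃ s v, ∀ i, x i = p i * s + e i * v := by
  choose N0 hN0 using fun D : ℕ => stepanov (D + 1) (d * (d + 4) + 1) (Nat.succ_pos D)
  refine ⟨∑ D ∈ Finset.range (d + 1), N0 D, ?_⟩
  intro N hN k _ _ _ p e f hf hp he hfc hA hB hC h01 h12 h02
  classical
  have : Fact (Nat.Prime 2) := ⟨Nat.prime_two⟩
  have hfd : f.coeff d ≠ 0 := fun h => by rw [h, zero_mul] at hC; exact zero_ne_one hC
  have hm : (Gg d p e f).Monic := by
    refine monic_of_natDegree_le_of_coeff_eq_one d (Gg_wtle d p e f).natDegree_le ?_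
    rw [Gg_coeff, hC, C_1]
  have hnd : (Gg d p e f).natDegree = d := by
    refine le_antisymm (Gg_wtle d p e f).natDegree_le (le_natDegree_of_ne_zero ?_)
    rw [Gg_coeff, hC, C_1]; exact one_ne_zero
  have hd1 : (d : k) = 1 := by
    obtain ⟨t, rfl⟩ := hd
    push_cast
    linear_combination (t : k) * (CharTwo.two_eq_zero : (2 : k) = 0)
  have hder : evalEval 1 0 (derivative (C (C (f.coeff d)) * Hh p e d)) ≠ 0 := by
    rw [derivative_C_mul, evalEval_mul, evalEval_CC, Hh_der, hd1, one_mul]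
    exact mul_ne_zero hfd hB
  have hne : C (C (f.coeff d)) * Hh p e d ≠ 0 := by
    intro h; rw [h] at hder; simp at hder
  have htop := Gg_top hne
  obtain ⟨u, hu, huw, huirr, hud, hufix, hudv, hupos, hu0⟩ := factC N hm (by rw [hnd]; exact Gg_wtle d p e f)
    (frobfix_lin hp he hfc) (by
      rw [htop, evalEval_mul, Hh_eval]
      simp only [mul_one, mul_zero, add_zero]
      rw [hA, mul_zero]) (by rw [htop]; exact hder)
  have hule : u.natDegree ≤ d := by
    rw [← hnd]; exact natDegree_le_of_dvd hudv hm.ne_zero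
  obtain ⟨S, hScard, hS⟩ := hN0 (u.natDegree - 1) N (le_trans (Finset.single_le_sum (f := N0)
    (fun _ _ => Nat.zero_le _) (Finset.mem_range.mpr (by omega))) hN) k u hu (by omega)
    (by rw [Nat.sub_add_cancel hupos]; exact huw) huirr hud hufix
  have hlin : ∀ a b : Fin 4, p a ≠ p b → ¬ u ∣ lin (p a) (e a) - lin (p b) (e b) := by
    rintro a b hab ⟨w, hw⟩
    have h1 : lin (p a) (e a) - lin (p b) (e b) = lin (p a - p b) (e a - e b) := by
      unfold lin; simp only [C_sub]; simp only [C_mul, C_sub]; ring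
    rw [h1] at hw
    have h2 := congrArg (evalEval 1 0) (congrArg top1 hw)
    rw [lin_top (sub_ne_zero.mpr hab), top1_mul, evalEval_mul, hu0, lin_eval] at h2
    apply hab
    linear_combination h2
  set B := (lin (p 0) (e 0) - lin (p 1) (e 1)) * ((lin (p 1) (e 1) - lin (p 2) (e 2)) *
    (lin (p 0) (e 0) - lin (p 2) (e 2))) with hBd
  have hBw : wtle 3 B := by
    have := fun a b => (lin_wtle (p a) (e a)).sub (lin_wtle (p b) (e b))
    exact (this 0 1).mul ((this 1 2).mul (this 0 2))
  have hBn : ¬ u ∣ B := by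
    intro h
    rcases huirr.prime.dvd_or_dvd h with h | h
    · exact hlin _ _ h01 h
    rcases huirr.prime.dvd_or_dvd h with h | h
    · exact hlin _ _ h12 h
    · exact hlin _ _ h02 h
  have hex : ∃ z ∈ S, evalEval z.1 z.2 B ≠ 0 := by
    by_contra hcon
    push Not at hcon
    have := lemmaZ hu rfl huw huirr hBw hBn S fun s hs => ⟨(hS s hs).2.2, hcon s hs⟩
    have h2 : u.natDegree * (3 + u.natDegree + 1) ≤ d * (d + 4) := Nat.mul_le_mul hule (by omega)
    omega
  obtain ⟨z, hz, hzB⟩ := hex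
  obtain ⟨z1, z2, z3⟩ := hS z hz
  rw [hBd, evalEval_mul, evalEval_mul, evalEval_sub, evalEval_sub, evalEval_sub] at hzB
  simp only [lin_eval, mul_ne_zero_iff, sub_ne_zero] at hzB
  refine ⟨fun i => p i * z.1 + e i * z.2, ?_, ?_, hzB.1, hzB.2.1, hzB.2.2, z.1, z.2, fun _ => rfl⟩
  · intro i
    simp only
    rw [add_pow_char_pow, mul_pow, mul_pow, hp, he, z1, z2]
  · rw [← Gg_eval p e hf]
    obtain ⟨w, hw⟩ := hudv
    rw [hw, evalEval_mul, z3, zero_mul]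


lemma frobfix_pow {k : Type*} [Field k] {u : k[X][X]} (h : frobfix 2 u) (N : ℕ) : frobfix (2 ^ N) u := by
  intro i j
  induction N with
  | zero => simp
  | succ N ih => rw [pow_succ, pow_mul, ih, h i j]

theorem pointC (i ℓ : ℕ) (hi : 1 ≤ i) (hℓ : Odd ℓ) (h3 : 3 ≤ ℓ) (hne : ℓ ≠ 2 ^ i - 1) :
    ∃ N0, ∀ N ≥ N0, ∀ (k : Type) [Field k] [IsAlgClosed k] [CharP k 2],
    ∃ p e : Fin 4 → k, (∀ j, p j ^ 2 ^ N = p j) ∧ (∀ j, e j ^ 2 ^ N = e j) ∧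
      p 3 = p 0 + p 1 + p 2 ∧ e 3 = e 0 + e 1 + e 2 ∧ (∑ j, p j ^ (2 ^ i * ℓ + 1) = 0) ∧
      (∑ j, p j ^ (2 ^ i * ℓ) * e j ≠ 0) ∧ (∑ j, e j ^ (2 ^ i * ℓ + 1) ≠ 0) ∧
      p 0 ≠ p 1 ∧ p 1 ≠ p 2 ∧ p 0 ≠ p 2 := by
  set m := 2 ^ i * ℓ with hm
  have hm0 : 0 < m := by rw [hm]; positivity
  choose N0 hN0 using fun D : ℕ => stepanov (D + 1) (m * (2 * m + 3) + 1) (Nat.succ_pos D)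
  refine ⟨∑ D ∈ Finset.range (m + 1), N0 D + (m + 1), ?_⟩
  intro N hN k _ _ _
  classical
  have : Fact (Nat.Prime 2) := ⟨Nat.prime_two⟩
  have h2 : (2 : k) = 0 := CharTwo.two_eq_zero
  have hNN : ∑ D ∈ Finset.range (m + 1), N0 D ≤ N := by omega
  obtain ⟨u, hu, huw, huirr, hud, hufix, hudv, hu1, huX, hupos, hule⟩ := partB k hi hℓ h3 hne
  rw [← hm] at hudv hule
  obtain ⟨S, hScard, hS⟩ := hN0 (u.natDegree - 1) N (le_trans (Finset.single_le_sum (f := N0)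
    (fun _ _ => Nat.zero_le _) (Finset.mem_range.mpr (by omega))) hNN) k u hu (by omega)
    (by rw [Nat.sub_add_cancel hupos]; exact huw) huirr hud (frobfix_pow hufix N)
  set B : k[X][X] := (X - C 1) * ((X - C X) * C (X ^ m + 1)) with hBd
  have hBw : wtle (m + 2) B := by
    have b1 : wtle 1 (X - C 1 : k[X][X]) := wtle_X.sub (wtle_C (by simp))
    have b2 : wtle 1 (X - C X : k[X][X]) := wtle_X.sub (wtle_C (by simp))
    have b3 : wtle m (C (X ^ m + 1) : k[X][X]) := wtle_C (by compute_degree)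
    exact (b1.mul (b2.mul b3)).mono (by omega)
  have hBn : ¬ u ∣ B := by
    intro h
    rcases huirr.prime.dvd_or_dvd h with h | h
    · exact hu1 (eq_of_monic_of_associated hu (monic_X_sub_C _) (huirr.associated_of_dvd (irreducible_X_sub_C _) h))
    rcases huirr.prime.dvd_or_dvd h with h | h
    · exact huX (eq_of_monic_of_associated hu (monic_X_sub_C _) (huirr.associated_of_dvd (irreducible_X_sub_C _) h))
    · have h0 : (X ^ m + 1 : k[X]) ≠ 0 := by
        have := monic_X_pow_add_C (R := k) 1 hm0.ne'
        rw [C_1] at this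
        exact this.ne_zero
      have := natDegree_le_of_dvd h (C_ne_zero.mpr h0)
      rw [natDegree_C] at this
      omega
  have hex : ∃ z ∈ S, evalEval z.1 z.2 B ≠ 0 := by
    by_contra hcon
    push Not at hcon
    have := lemmaZ hu rfl huw huirr hBw hBn S fun s hs => ⟨(hS s hs).2.2, hcon s hs⟩
    have h2 : u.natDegree * (m + 2 + u.natDegree + 1) ≤ m * (2 * m + 3) := Nat.mul_le_mul hule (by omega)
    omega
  obtain ⟨⟨a, b⟩, hz, hzB⟩ := hex
  obtain ⟨z1, z2, z3⟩ := hS _ hz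
  simp only at z1 z2 z3 hzB
  have hB' : (b - 1) * ((b - a) * (a ^ m + 1)) ≠ 0 := by
    have : evalEval a b B = (b - 1) * ((b - a) * (a ^ m + 1)) := by
      rw [hBd]; simp [evalEval]
    rwa [← this]
  simp only [mul_ne_zero_iff, sub_ne_zero] at hB'
  obtain ⟨q1, q2, q3⟩ := hB'
  have q4 : a ≠ 1 := by
    rintro rfl; apply q3; rw [one_pow]; linear_combination h2
  have hF : a ^ (m + 1) + b ^ (m + 1) + 1 + (a + b + 1) ^ (m + 1) = 0 := by
    have h := congrArg (evalEval a b) (F1_mul (k := k) (m + 1))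
    obtain ⟨w, hw⟩ := hudv
    rw [hw, evalEval_mul, evalEval_mul, z3] at h
    simp [evalEval] at h
    have e1 : b + (a + 1) = a + b + 1 := by ring
    rw [e1] at h
    linear_combination -h
  have h1 : (1 : k) ^ 2 ^ N = 1 := one_pow _
  have h0 : (0 : k) ^ 2 ^ N = 0 := zero_pow (by positivity)
  obtain ⟨e0, e0f, e0s, e0n⟩ : ∃ e0 : Fin 4 → k, (∀ j, e0 j ^ 2 ^ N = e0 j) ∧ e0 3 = e0 0 + e0 1 + e0 2 ∧
      a ^ m * e0 0 + b ^ m * e0 1 + e0 2 + (a + b + 1) ^ m * e0 3 ≠ 0 := by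
    by_cases hw : (a + b + 1) ^ m = 1
    · refine ⟨![1, 0, 0, 1], ?_, by simp, ?_⟩
      · intro j; fin_cases j <;> simp
      · simpa [hw] using q3
    · refine ⟨![0, 0, 1, 1], ?_, by simp, ?_⟩
      · intro j; fin_cases j <;> simp
      · simp only [Matrix.cons_val]
        intro h
        apply hw
        linear_combination h - h2
  set p : Fin 4 → k := ![a, b, 1, a + b + 1] with hp
  have hpf : ∀ j, p j ^ 2 ^ N = p j := by
    intro j
    fin_cases j
    · exact z1
    · exact z2
    · exact h1
    · change (a + b + 1) ^ 2 ^ N = a + b + 1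
      rw [add_pow_char_pow, add_pow_char_pow, z1, z2, h1]
  have hpsum : ∑ j, p j ^ (m + 1) = 0 := by
    rw [Fin.sum_univ_four]
    simpa [hp] using hF
  have hpe : ∑ j, p j ^ m * e0 j ≠ 0 := by
    rw [Fin.sum_univ_four]
    simpa [hp] using e0n
  set h : k[X] := ∑ j, (C (p j) + C (e0 j) * X) ^ (m + 1) with hh
  have hdeg : h.natDegree ≤ m + 1 := by
    rw [hh]
    refine natDegree_sum_le_of_forall_le _ _ fun j _ => ?_
    refine natDegree_pow_le.trans ?_
    have : (C (p j) + C (e0 j) * X).natDegree ≤ 1 := by compute_degree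
    calc _ ≤ (m + 1) * 1 := Nat.mul_le_mul le_rfl this
      _ = _ := mul_one _
  have hm1 : ((m + 1 : ℕ) : k) = 1 := by
    rw [hm]; push_cast
    rw [h2, zero_pow (by omega)]; ring
  have hder : (derivative h).eval 0 = ∑ j, p j ^ m * e0 j := by
    rw [hh, derivative_sum, eval_finset_sum]
    refine Finset.sum_congr rfl fun j _ => ?_
    rw [derivative_pow, hm1]
    simp
  have hh0 : h ≠ 0 := by
    intro h0; rw [h0] at hder; apply hpe; rw [← hder]; simp
  obtain ⟨t, ht, hte⟩ : ∃ t : k, t ^ 2 ^ N = t ∧ h.eval t ≠ 0 := by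
    by_contra hcon
    push Not at hcon
    obtain ⟨T, hT, hTf⟩ := card_FQ (k := k) (Q := 2 ^ N) rfl (by omega)
    have hsub : T ⊆ h.roots.toFinset := fun x hx => by
      rw [Multiset.mem_toFinset, mem_roots hh0]; exact hcon x (hTf x hx)
    have c1 := Finset.card_le_card hsub
    have c2 := Multiset.toFinset_card_le h.roots
    have c3 := card_roots' h
    have c4 : N < 2 ^ N := Nat.lt_two_pow_self
    omega
  have hev : h.eval t = ∑ j, (p j + e0 j * t) ^ (m + 1) := by
    rw [hh, eval_finset_sum]; simp
  have ht0 : t ≠ 0 := by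
    rintro rfl
    apply hte
    rw [hev]; simpa using hpsum
  refine ⟨p, fun j => p j + e0 j * t, hpf, ?_, by simp [hp], ?_, hpsum, ?_, ?_, ?_, ?_, ?_⟩
  · intro j
    simp only
    rw [add_pow_char_pow, mul_pow, hpf, e0f, ht]
  · simp only [e0s]
    simp [hp]; ring
  · have : ∑ j, p j ^ m * (p j + e0 j * t) = (∑ j, p j ^ (m + 1)) + (∑ j, p j ^ m * e0 j) * t := by
      rw [Finset.sum_mul, ← Finset.sum_add_distrib]
      refine Finset.sum_congr rfl fun j _ => ?_
      ring
    rw [this, hpsum, zero_add]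
    exact mul_ne_zero hpe ht0
  · rw [← hev]; exact hte
  · exact Ne.symm q2
  · exact q1
  · exact q4

lemma fixed_mem {L k : Type*} [Field L] [Fintype L] [Field k] [Algebra L k] {x : k}
    (hx : x ^ Fintype.card L = x) : ∃ y : L, algebraMap L k y = x := by
  classical
  have hq : 1 < Fintype.card L := Fintype.one_lt_card
  have h0 : (X ^ Fintype.card L - X : k[X]) ≠ 0 := FiniteField.X_pow_card_sub_X_ne_zero k hq
  have hsub : Finset.univ.image (algebraMap L k) ⊆ (X ^ Fintype.card L - X : k[X]).roots.toFinset := by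
    intro y hy
    obtain ⟨z, -, rfl⟩ := Finset.mem_image.mp hy
    rw [Multiset.mem_toFinset, mem_roots h0, IsRoot, eval_sub, eval_pow, eval_X, ← map_pow,
      FiniteField.pow_card, sub_self]
  have hcard : (X ^ Fintype.card L - X : k[X]).roots.toFinset.card ≤ (Finset.univ.image (algebraMap L k)).card := by
    rw [Finset.card_image_of_injective _ (algebraMap L k).injective, Finset.card_univ]
    refine (Multiset.toFinset_card_le _).trans ((card_roots' _).trans ?_)
    rw [FiniteField.X_pow_card_sub_X_natDegree_eq k hq]
  have heq := Finset.eq_of_subset_of_card_le hsub hcard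
  have hxm : x ∈ Finset.univ.image (algebraMap L k) := by
    rw [heq, Multiset.mem_toFinset, mem_roots h0, IsRoot, eval_sub, eval_pow, eval_X, hx, sub_self]
  obtain ⟨z, -, hz⟩ := Finset.mem_image.mp hxm
  exact ⟨z, hz⟩

lemma not_apn_of_four {L : Type*} [Field L] [Finite L] [CharP L 2] {f : L → L} {x y z : L}
    (hxy : x ≠ y) (hyz : y ≠ z) (hxz : x ≠ z) (h : f x + f y + f z + f (x + y + z) = 0) : ¬ IsAPN f := by
  intro hA
  have h2 : (2 : L) = 0 := CharTwo.two_eq_zero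
  have ha : x + y ≠ 0 := fun h => hxy (CharTwo.add_eq_zero.mp h)
  have h3 := hA (x + y) ha (f x + f y)
  have hsub : ({x, y, z} : Set L) ⊆ {t : L | f (t + (x + y)) + f t = f x + f y} := by
    rintro t (rfl | rfl | rfl)
    · change f (t + (t + y)) + f t = _
      rw [show t + (t + y) = y by linear_combination t * h2]; ring
    · change f (t + (x + t)) + f t = _
      rw [show t + (x + t) = x by linear_combination t * h2]
    · change f (t + (x + y)) + f t = _
      rw [show t + (x + y) = x + y + t by ring]
      linear_combination h - (f x + f y) * h2
  have h4 := Set.ncard_le_ncard hsub (Set.toFinite _)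
  rw [Set.ncard_eq_three.mpr ⟨x, y, z, hxy, hxz, hyz, rfl⟩] at h4
  omega

theorem odd_degree_not_gold_not_kasami_not_exceptional
    (n : ℕ) (hn : 0 < n) (F : Type*) [Field F] [Fintype F]
    (hF : Fintype.card F = 2 ^ n) (f : Polynomial F) (d : ℕ)
    (hdeg : f.natDegree = d) (hd3 : 3 ≤ d) (hodd : Odd d)
    (hGold : ¬ ∃ k : ℕ, 1 ≤ k ∧ d = 2 ^ k + 1)
    (hKW : ¬ ∃ k : ℕ, 2 ≤ k ∧ d = 2 ^ (2 * k) - 2 ^ k + 1) :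
    ∃ M : ℕ, 0 < M ∧ ∀ m : ℕ, M ≤ m →
      ∀ (L : Type) [Field L] [Fintype L] [Algebra F L],
        Fintype.card L = (2 ^ n) ^ m →
          ¬ IsAPN (fun x : L => Polynomial.aeval x f) := by
  classical
  have : Fact (Nat.Prime 2) := ⟨Nat.prime_two⟩
  obtain ⟨i, ℓ, hℓ, hil⟩ := Nat.exists_eq_two_pow_mul_odd (n := d - 1) (by omega)
  have hd : d = 2 ^ i * ℓ + 1 := by omega
  have hi : 1 ≤ i := by
    rcases Nat.eq_zero_or_pos i with rfl | h
    · exfalso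
      rw [pow_zero, one_mul] at hd
      obtain ⟨a, ha⟩ := hℓ
      obtain ⟨b, hb⟩ := hodd
      omega
    · exact h
  have h3 : 3 ≤ ℓ := by
    by_contra hlt
    obtain ⟨a, ha⟩ := hℓ
    have : ℓ = 1 := by omega
    exact hGold ⟨i, hi, by rw [hd, this, mul_one]⟩
  have hne : ℓ ≠ 2 ^ i - 1 := by
    intro h
    have hi2 : 2 ≤ i := by
      by_contra hlt
      have : i = 1 := by omega
      rw [this] at h
      omega
    refine hKW ⟨i, hi2, ?_⟩
    rw [hd, h, Nat.mul_sub, mul_one, two_mul, pow_add]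
  obtain ⟨N1, hN1⟩ := pointC i ℓ hi hℓ h3 hne
  obtain ⟨N2, hN2⟩ := planeC d hodd
  refine ⟨N1 + N2 + 1, by omega, ?_⟩
  intro m hm L _ _ _ hL
  set N := n * m with hNd
  have hNm : m ≤ N := Nat.le_mul_of_pos_left _ hn
  have hL' : Fintype.card L = 2 ^ N := by rw [hL, ← pow_mul]
  have hcL : CharP L 2 := by
    have hN0 : N ≠ 0 := by omega
    obtain ⟨p, hp⟩ := CharP.exists L
    have hpp : p.Prime := CharP.char_is_prime L p
    have : (2 ^ N : ℕ) = (0 : L) := by rw [← hL', Nat.cast_card_eq_zero]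
    rw [CharP.cast_eq_zero_iff L p] at this
    have := (Nat.prime_dvd_prime_iff_eq hpp Nat.prime_two).mp (hpp.dvd_of_dvd_pow this)
    rwa [this] at hp
  have hck : CharP (AlgebraicClosure L) 2 :=
    charP_of_injective_algebraMap (algebraMap L (AlgebraicClosure L)).injective 2
  obtain ⟨p, e, hp, he, hp3, he3, hA, hB, hC, h01, h12, h02⟩ := hN1 N (by omega) (AlgebraicClosure L)
  set ι := algebraMap L (AlgebraicClosure L) with hι
  set g : L[X] := f.map (algebraMap F L) with hg
  have hgd : g.natDegree = d := by rw [hg, natDegree_map, hdeg]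
  set fk : (AlgebraicClosure L)[X] := g.map ι with hfk
  have hfd : fk.natDegree = d := by rw [hfk, natDegree_map, hgd]
  have hfix : ∀ y : L, ι y ^ 2 ^ N = ι y := fun y => by
    rw [← map_pow, ← hL', FiniteField.pow_card]
  have hlc : fk.coeff d ≠ 0 := by
    have : fk.leadingCoeff ≠ 0 := by
      rw [leadingCoeff_ne_zero]
      intro h0; rw [h0, natDegree_zero] at hfd; omega
    rwa [leadingCoeff, hfd] at this
  have hfc : ∀ j, fk.coeff j ^ 2 ^ N = fk.coeff j := fun j => by rw [hfk, coeff_map]; exact hfix _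
  rw [← hd] at hA hC
  set c := (fk.coeff d * ∑ j, e j ^ d)⁻¹ with hc
  have hcne : fk.coeff d * ∑ j, e j ^ d ≠ 0 := mul_ne_zero hlc hC
  have hcf : c ^ 2 ^ N = c := by
    rw [hc, inv_pow, mul_pow, hfc, ← iterateFrobenius_def 2 N (∑ j, e j ^ d), map_sum]
    congr 2
    refine Finset.sum_congr rfl fun j _ => ?_
    rw [iterateFrobenius_def, ← pow_mul, mul_comm d, pow_mul, he]
  obtain ⟨x, hx, hxs, x01, x12, x02, s, v, hsv⟩ := hN2 N (by omega) (AlgebraicClosure L) p e (C c * fk)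
    ((natDegree_C_mul_le _ _).trans hfd.le) hp he
    (fun j => by rw [coeff_C_mul, mul_pow, hcf, hfc]) hA (by rwa [show d - 1 = 2 ^ i * ℓ by omega])
    (by rw [coeff_C_mul, mul_assoc]; exact inv_mul_cancel₀ hcne) h01 h12 h02
  choose y hy using fun j => fixed_mem (L := L) (x := x j) (by rw [hL']; exact hx j)
  have hy3 : y 3 = y 0 + y 1 + y 2 := by
    apply ι.injective
    rw [map_add, map_add, hy, hy, hy, hy, hsv, hsv, hsv, hsv, hp3, he3]
    ring
  refine not_apn_of_four (x := y 0) (y := y 1) (z := y 2) ?_ ?_ ?_ ?_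
  · intro h; apply x01; rw [← hy, ← hy, h]
  · intro h; apply x12; rw [← hy, ← hy, h]
  · intro h; apply x02; rw [← hy, ← hy, h]
  · have hz : ∑ j, fk.eval (x j) = 0 := by
      simp only [eval_mul, eval_C, ← Finset.mul_sum] at hxs
      exact (mul_eq_zero.mp hxs).resolve_left (inv_ne_zero hcne)
    have hev : ∀ j, fk.eval (x j) = ι (aeval (y j) f) := fun j => by
      rw [← hy j, hfk, eval_map_apply, hg, eval_map_algebraMap]
    rw [Fin.sum_univ_four] at hz
    simp only [hev, ← map_add] at hz
    rw [← hy3]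
    exact (map_eq_zero ι).mp hz
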